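/- Let δ > 0 and let μ be a probability measure on ℝ with μ([δ,∞)) = 1 and finite mean ∫ x μ(dx) < ∞. Define r : [-π,π] → ℝ by r(x) = (1/(2^{3/2}π)) · inf{ y ∈ ℝ : |x|/π ≤ μ((-∞,y]) } for 0 < |x| < π and r(x) = 0 otherwise, and set f(x,y) := r(x) r(y) for x,y ∈ [-π,π]. Let (G_{i,j} : i,j ∈ ℤ) be a centered stationary Gaussian process with spectral density f, and for N ≥ 1 let Ḡ_N be the N×N real symmetric random matrix with entries Ḡ_N(i,j) = (G_{i,j} + G_{j,i})/√N for 1 ≤ i,j ≤ N. Then there exists a probability measure ν on ℝ which is absolutely continuous with respect to Lebesgue measure such that the empirical spectral distribution of Ḡ_N converges weakly in probability to ν as N → ∞ (this limit ν equals the free multiplicative convolution of μ with the standard semicircle law). -/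

import Mathlib

open MeasureTheory Real Filter

/-- The empirical spectral distribution of an `N × N` real matrix: the uniform probability
measure on the (real) roots of its characteristic polynomial, counted with multiplicity.
For a real symmetric matrix these roots are exactly the eigenvalues `λ_1 ≤ … ≤ λ_N`
counted with multiplicity, so this is `(1/N) ∑_{j=1}^N δ_{λ_j}`. -/
noncomputable def ESD {N : ℕ} (M : Matrix (Fin N) (Fin N) ℝ) : Measure ℝ :=
  (N : ENNReal)⁻¹ • (M.charpoly.roots.map Measure.dirac).sum

open scoped Matrix

section Resolvent

variable {ι : Type*} [Fintype ι] [DecidableEq ι]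

/-- The resolvent `(H - z)⁻¹` of a real matrix, as a complex matrix. -/
noncomputable def realResolvent (H : Matrix ι ι ℝ) (z : ℂ) : Matrix ι ι ℂ :=
  (H.map Complex.ofReal - Matrix.scalar ι z)⁻¹

lemma im_sum_star_mul_mulVec {H : Matrix ι ι ℝ} (hH : H.IsSymm) (z : ℂ) (u : ι → ℂ) :
    (∑ i, star (u i) * ((H.map Complex.ofReal - Matrix.scalar ι z) *ᵥ u) i).im
      = - (z.im * ∑ i, ‖u i‖ ^ 2) := by
  have h1 : (∑ i, star (u i) * ((H.map Complex.ofReal) *ᵥ u) i).im = 0 := by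
    rw [← Complex.conj_eq_iff_im]
    simp only [Matrix.mulVec, dotProduct, Finset.mul_sum, map_sum, Matrix.map_apply]
    rw [Finset.sum_comm]
    refine Finset.sum_congr rfl fun i _ => Finset.sum_congr rfl fun j _ => ?_
    simp only [map_mul, Complex.conj_ofReal, Complex.star_def, Complex.conj_conj]
    rw [← hH.apply i j]
    ring
  have h2 : ∑ i, star (u i) * ((Matrix.scalar ι z) *ᵥ u) i
      = z * ((∑ i, ‖u i‖ ^ 2 : ℝ) : ℂ) := by
    push_cast
    rw [Finset.mul_sum]
    refine Finset.sum_congr rfl fun i _ => ?_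
    simp only [Matrix.scalar_apply, Matrix.mulVec_diagonal, ← Complex.conj_mul',
      Complex.star_def]
    ring
  simp only [Matrix.sub_mulVec, Pi.sub_apply, mul_sub, Finset.sum_sub_distrib, Complex.sub_im,
    h1, h2, zero_sub]
  simp [-Complex.ofReal_sum, -Complex.ofReal_pow]

lemma im_sq_mul_sum_norm_sq_le {H : Matrix ι ι ℝ} (hH : H.IsSymm) {z : ℂ} (hz : 0 < z.im)
    (u : ι → ℂ) :
    z.im ^ 2 * ∑ i, ‖u i‖ ^ 2
      ≤ ∑ i, ‖((H.map Complex.ofReal - Matrix.scalar ι z) *ᵥ u) i‖ ^ 2 := by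
  set v := (H.map Complex.ofReal - Matrix.scalar ι z) *ᵥ u
  set S := ∑ i, ‖u i‖ ^ 2
  set Q := ∑ i, ‖v i‖ ^ 2
  have hS : 0 ≤ S := by positivity
  have hQ : 0 ≤ Q := by positivity
  have h1 : z.im * S ≤ ∑ i, ‖u i‖ * ‖v i‖ := by
    have := im_sum_star_mul_mulVec hH z u
    calc z.im * S = -(∑ i, star (u i) * v i).im := by rw [this]; ring
      _ ≤ ‖∑ i, star (u i) * v i‖ := (neg_le_abs _).trans (Complex.abs_im_le_norm _)
      _ ≤ ∑ i, ‖star (u i) * v i‖ := norm_sum_le _ _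
      _ = _ := by simp
  have h2 : (∑ i, ‖u i‖ * ‖v i‖) ^ 2 ≤ S * Q := Finset.sum_mul_sq_le_sq_mul_sq _ _ _
  have h3 : (z.im * S) ^ 2 ≤ S * Q := (pow_le_pow_left₀ (by positivity) h1 2).trans h2
  rcases hS.eq_or_lt with h0 | h0
  · rw [← h0]; simpa using hQ
  · have : S * (z.im ^ 2 * S) ≤ S * Q := by nlinarith
    exact le_of_mul_le_mul_left this h0

lemma isUnit_det_sub_scalar {H : Matrix ι ι ℝ} (hH : H.IsSymm) {z : ℂ} (hz : 0 < z.im) :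
    IsUnit (H.map Complex.ofReal - Matrix.scalar ι z).det := by
  rw [isUnit_iff_ne_zero]
  intro h0
  obtain ⟨u, hu, hu0⟩ := Matrix.exists_mulVec_eq_zero_iff.2 h0
  have h1 := im_sq_mul_sum_norm_sq_le hH hz u
  simp only [hu0, Pi.zero_apply, norm_zero] at h1
  have h2 : ∑ i, ‖u i‖ ^ 2 = 0 := by
    have : 0 ≤ ∑ i, ‖u i‖ ^ 2 := by positivity
    have h3 : 0 < z.im ^ 2 := by positivity
    simp at h1
    nlinarith
  apply hu
  ext i
  rw [Finset.sum_eq_zero_iff_of_nonneg (fun _ _ => by positivity)] at h2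
  simpa using h2 i (Finset.mem_univ _)

lemma mul_realResolvent {H : Matrix ι ι ℝ} (hH : H.IsSymm) {z : ℂ} (hz : 0 < z.im) :
    (H.map Complex.ofReal - Matrix.scalar ι z) * realResolvent H z = 1 :=
  Matrix.mul_nonsing_inv _ (isUnit_det_sub_scalar hH hz)

lemma realResolvent_mul {H : Matrix ι ι ℝ} (hH : H.IsSymm) {z : ℂ} (hz : 0 < z.im) :
    realResolvent H z * (H.map Complex.ofReal - Matrix.scalar ι z) = 1 :=
  Matrix.nonsing_inv_mul _ (isUnit_det_sub_scalar hH hz)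

lemma realResolvent_transpose {H : Matrix ι ι ℝ} (hH : H.IsSymm) (z : ℂ) :
    (realResolvent H z)ᵀ = realResolvent H z := by
  rw [realResolvent, Matrix.transpose_nonsing_inv, Matrix.transpose_sub, ← Matrix.transpose_map,
    hH.eq]
  simp

lemma realResolvent_symm {H : Matrix ι ι ℝ} (hH : H.IsSymm) (z : ℂ) (i j : ι) :
    realResolvent H z i j = realResolvent H z j i :=
  congrFun (congrFun (realResolvent_transpose hH z) j) i

lemma sum_norm_sq_realResolvent_mulVec_le {H : Matrix ι ι ℝ} (hH : H.IsSymm) {z : ℂ}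
    (hz : 0 < z.im) (v : ι → ℂ) :
    ∑ i, ‖(realResolvent H z *ᵥ v) i‖ ^ 2 ≤ (∑ i, ‖v i‖ ^ 2) / z.im ^ 2 := by
  have := im_sq_mul_sum_norm_sq_le hH hz (realResolvent H z *ᵥ v)
  rw [Matrix.mulVec_mulVec, mul_realResolvent hH hz, Matrix.one_mulVec] at this
  rw [le_div_iff₀ (by positivity)]
  linarith

lemma sum_norm_sq_realResolvent_le {H : Matrix ι ι ℝ} (hH : H.IsSymm) {z : ℂ}
    (hz : 0 < z.im) (j : ι) :
    ∑ i, ‖realResolvent H z i j‖ ^ 2 ≤ 1 / z.im ^ 2 := by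
  have := sum_norm_sq_realResolvent_mulVec_le hH hz (Pi.single j 1)
  simp only [Matrix.mulVec_single_one] at this
  refine this.trans_eq ?_
  congr 1
  rw [Finset.sum_eq_single j] <;> simp +contextual

lemma norm_realResolvent_le {H : Matrix ι ι ℝ} (hH : H.IsSymm) {z : ℂ}
    (hz : 0 < z.im) (i j : ι) : ‖realResolvent H z i j‖ ≤ 1 / z.im := by
  have h1 := sum_norm_sq_realResolvent_le hH hz j
  have h2 := Finset.single_le_sum (f := fun i => ‖realResolvent H z i j‖ ^ 2)
    (fun _ _ => by positivity) (Finset.mem_univ i)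
  have h3 : ‖realResolvent H z i j‖ ^ 2 ≤ (1 / z.im) ^ 2 := by
    rw [div_pow, one_pow]; exact h2.trans h1
  exact le_of_sq_le_sq h3 (by positivity)

lemma im_realResolvent_nonneg {H : Matrix ι ι ℝ} (hH : H.IsSymm) {z : ℂ}
    (hz : 0 < z.im) (i : ι) : 0 ≤ (realResolvent H z i i).im := by
  have := im_sum_star_mul_mulVec hH z (realResolvent H z *ᵥ (Pi.single i 1))
  rw [Matrix.mulVec_mulVec, mul_realResolvent hH hz, Matrix.one_mulVec] at this
  rw [Finset.sum_eq_single i (by simp +contextual) (by simp)] at this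
  simp at this
  rw [this]
  positivity

lemma realResolvent_sub_realResolvent {H H' : Matrix ι ι ℝ} (hH : H.IsSymm) (hH' : H'.IsSymm)
    {z : ℂ} (hz : 0 < z.im) :
    realResolvent H z - realResolvent H' z
      = realResolvent H z * (H' - H).map Complex.ofReal * realResolvent H' z := by
  have h : (H' - H).map Complex.ofReal = (H'.map Complex.ofReal - Matrix.scalar ι z)
      - (H.map Complex.ofReal - Matrix.scalar ι z) := by
    ext i j; simp
  rw [h, Matrix.mul_sub, Matrix.sub_mul, realResolvent_mul hH hz, Matrix.mul_assoc,
    mul_realResolvent hH' hz]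
  simp

lemma continuous_realResolvent {X : Type*} [TopologicalSpace X] {H : X → Matrix ι ι ℝ}
    (hc : Continuous H) (hH : ∀ x, (H x).IsSymm) {z : ℂ} (hz : 0 < z.im) :
    Continuous fun x => realResolvent (H x) z := by
  have hA : Continuous fun x => (H x).map Complex.ofReal - Matrix.scalar ι z :=
    (hc.matrix_map Complex.continuous_ofReal).sub continuous_const
  unfold realResolvent
  simp_rw [Matrix.inv_def, Ring.inverse_eq_inv']
  exact (hA.matrix_det.inv₀ fun x => (isUnit_det_sub_scalar (hH x) hz).ne_zero).smul
    hA.matrix_adjugate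

lemma trace_realResolvent_conj {H O : Matrix ι ι ℝ} (hO : O * Oᵀ = 1) (z : ℂ) :
    (realResolvent (O * H * Oᵀ) z).trace = (realResolvent H z).trace := by
  have hO' : Oᵀ * O = 1 := mul_eq_one_comm.1 hO
  set Oc := O.map Complex.ofReal with hOc
  set Pc := Oᵀ.map Complex.ofReal
  have h1 : Oc * Pc = 1 := by
    have := Matrix.map_mul (L := O) (M := Oᵀ) (f := Complex.ofRealHom)
    rw [hO] at this
    refine this.symm.trans ?_
    simp
  have h2 : Pc * Oc = 1 := mul_eq_one_comm.1 h1
  have h3 : (O * H * Oᵀ).map Complex.ofReal - Matrix.scalar ι z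
      = Oc * (H.map Complex.ofReal - Matrix.scalar ι z) * Pc := by
    have e : (O * H * Oᵀ).map Complex.ofReal = Oc * H.map Complex.ofReal * Pc := by
      have := Matrix.map_mul (L := O * H) (M := Oᵀ) (f := Complex.ofRealHom)
      have h' := Matrix.map_mul (L := O) (M := H) (f := Complex.ofRealHom)
      rw [h'] at this
      exact this
    rw [e, Matrix.mul_sub, Matrix.sub_mul]
    congr 1
    rw [(Matrix.scalar_commute z (fun r => mul_comm z r) Oc).eq.symm, Matrix.mul_assoc, h1,
      Matrix.mul_one]
  rw [realResolvent, h3, Matrix.mul_inv_rev, Matrix.mul_inv_rev, Matrix.trace_mul_comm,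
    Matrix.mul_assoc, Matrix.inv_eq_left_inv h2, Matrix.inv_eq_left_inv h1, h2, Matrix.mul_one]
  rfl

end Resolvent

section Spectrum

lemma exists_orthogonal_diagonalization {ι : Type*} [Fintype ι] [DecidableEq ι]
    {H : Matrix ι ι ℝ} (hH : H.IsSymm) :
    ∃ (O : Matrix ι ι ℝ) (d : ι → ℝ), O * Oᵀ = 1 ∧ H = O * Matrix.diagonal d * Oᵀ ∧
      H.charpoly.roots = Multiset.map d Finset.univ.val := by
  have hA : H.IsHermitian := by
    rw [Matrix.IsHermitian, Matrix.conjTranspose_eq_transpose_of_trivial]; exact hH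
  refine ⟨hA.eigenvectorUnitary, hA.eigenvalues, ?_, ?_, ?_⟩
  · have := hA.eigenvectorUnitary.2
    rw [Matrix.mem_unitaryGroup_iff] at this
    rwa [Matrix.star_eq_conjTranspose, Matrix.conjTranspose_eq_transpose_of_trivial] at this
  · have := hA.spectral_theorem
    rw [Unitary.conjStarAlgAut_apply] at this
    simpa [Matrix.star_eq_conjTranspose, Matrix.conjTranspose_eq_transpose_of_trivial] using this
  · rw [hA.roots_charpoly_eq_eigenvalues]
    simp

lemma ESD_eq_sum_dirac {N : ℕ} {M : Matrix (Fin N) (Fin N) ℝ} {d : Fin N → ℝ}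
    (h : M.charpoly.roots = Multiset.map d Finset.univ.val) :
    ESD M = (N : ENNReal)⁻¹ • ∑ i, Measure.dirac (d i) := by
  rw [ESD, h, Multiset.map_map]; rfl

lemma isProbabilityMeasure_ESD {N : ℕ} (hN : N ≠ 0) {M : Matrix (Fin N) (Fin N) ℝ}
    (hM : M.IsSymm) : IsProbabilityMeasure (ESD M) := by
  obtain ⟨O, d, -, -, h⟩ := exists_orthogonal_diagonalization hM
  rw [ESD_eq_sum_dirac h]
  constructor
  simp only [Measure.smul_apply, Measure.coe_finsetSum, Finset.sum_apply, measure_univ,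
    smul_eq_mul, Finset.sum_const, Finset.card_univ, Fintype.card_fin, nsmul_eq_mul, mul_one]
  exact ENNReal.inv_mul_cancel (by exact_mod_cast hN) (by simp)

lemma integrable_ESD_of_roots {E : Type*} [NormedAddCommGroup E] 
    {N : ℕ} (hN : N ≠ 0) {M : Matrix (Fin N) (Fin N) ℝ} {d : Fin N → ℝ}
    (h : M.charpoly.roots = Multiset.map d Finset.univ.val) {f : ℝ → E} 
    (hf : StronglyMeasurable f) : Integrable f (ESD M) := by
  rw [ESD_eq_sum_dirac h]
  refine Integrable.smul_measure ?_ (by simpa using hN)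
  exact integrable_finsetSum_measure.2 fun i _ => integrable_dirac' hf (by simp)

lemma integral_ESD_of_roots {E : Type*} [NormedAddCommGroup E] [NormedSpace ℝ E] [CompleteSpace E]
    {N : ℕ} {M : Matrix (Fin N) (Fin N) ℝ} {d : Fin N → ℝ}
    (h : M.charpoly.roots = Multiset.map d Finset.univ.val) {f : ℝ → E} 
    (hf : StronglyMeasurable f) :
    ∫ x, f x ∂(ESD M) = (N : ℝ)⁻¹ • ∑ i, f (d i) := by
  rw [ESD_eq_sum_dirac h, integral_smul_measure, integral_finsetSum_measure]
  · simp [integral_dirac' _ _ hf]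
  · exact fun i _ => integrable_dirac' hf (by simp)

/-- The resolvent function `x ↦ (x - z)⁻¹`. -/
noncomputable def cauchyKernel (z : ℂ) (x : ℝ) : ℂ := ((x : ℂ) - z)⁻¹

lemma ofReal_sub_ne_zero {z : ℂ} (hz : z.im ≠ 0) (x : ℝ) : (x : ℂ) - z ≠ 0 := by
  intro h
  have := congrArg Complex.im h
  simp at this
  exact hz this

lemma continuous_cauchyKernel {z : ℂ} (hz : z.im ≠ 0) : Continuous (cauchyKernel z) :=
  (Complex.continuous_ofReal.sub continuous_const).inv₀ (ofReal_sub_ne_zero hz)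

lemma trace_realResolvent_diagonal {ι : Type*} [Fintype ι] [DecidableEq ι] (d : ι → ℝ) {z : ℂ}
    (hz : z.im ≠ 0) : (realResolvent (Matrix.diagonal d) z).trace = ∑ i, cauchyKernel z (d i) := by
  have : realResolvent (Matrix.diagonal d) z = Matrix.diagonal fun i => cauchyKernel z (d i) := by
    refine Matrix.inv_eq_left_inv ?_
    rw [Matrix.diagonal_map (by simp), Matrix.scalar_apply, Matrix.diagonal_sub,
      Matrix.diagonal_mul_diagonal, ← Matrix.diagonal_one]
    congr 1
    ext i
    exact inv_mul_cancel₀ (ofReal_sub_ne_zero hz _)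
  rw [this, Matrix.trace_diagonal]

lemma integral_cauchyKernel_ESD {N : ℕ} {M : Matrix (Fin N) (Fin N) ℝ} (hM : M.IsSymm)
    {z : ℂ} (hz : z.im ≠ 0) :
    ∫ x, cauchyKernel z x ∂(ESD M) = (N : ℂ)⁻¹ * (realResolvent M z).trace := by
  obtain ⟨O, d, hO, hd, h⟩ := exists_orthogonal_diagonalization hM
  rw [integral_ESD_of_roots h (continuous_cauchyKernel hz).stronglyMeasurable]
  conv_rhs => rw [hd, trace_realResolvent_conj hO, trace_realResolvent_diagonal d hz]
  simp

lemma integral_sq_ESD {N : ℕ} {M : Matrix (Fin N) (Fin N) ℝ} (hM : M.IsSymm) :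
    ∫ x, x ^ 2 ∂(ESD M) = (N : ℝ)⁻¹ * ∑ i, ∑ j, M i j ^ 2 := by
  obtain ⟨O, d, hO, hd, h⟩ := exists_orthogonal_diagonalization hM
  rw [integral_ESD_of_roots h (by fun_prop), smul_eq_mul]
  congr 1
  have h1 : ∑ i, ∑ j, M i j ^ 2 = (M * M).trace := by
    simp only [Matrix.trace, Matrix.diag, Matrix.mul_apply, sq]
    refine Finset.sum_congr rfl fun i _ => Finset.sum_congr rfl fun j _ => ?_
    rw [hM.apply j i]
  have hO' : Oᵀ * O = 1 := mul_eq_one_comm.1 hO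
  have h2 : M * M = O * (Matrix.diagonal d * Matrix.diagonal d) * Oᵀ := by
    calc M * M = O * Matrix.diagonal d * Oᵀ * (O * Matrix.diagonal d * Oᵀ) := by rw [← hd]
      _ = O * Matrix.diagonal d * (Oᵀ * O) * Matrix.diagonal d * Oᵀ := by
        simp only [Matrix.mul_assoc]
      _ = _ := by rw [hO']; simp only [Matrix.mul_assoc, Matrix.one_mul]
  rw [h1, h2, Matrix.trace_mul_comm, ← Matrix.mul_assoc, hO', Matrix.one_mul,
    Matrix.diagonal_mul_diagonal, Matrix.trace_diagonal]
  simp [sq]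

lemma integrable_ESD {E : Type*} [NormedAddCommGroup E] {N : ℕ} (hN : N ≠ 0)
    {M : Matrix (Fin N) (Fin N) ℝ} (hM : M.IsSymm) {f : ℝ → E}
    (hf : StronglyMeasurable f) : Integrable f (ESD M) := by
  obtain ⟨O, d, -, -, h⟩ := exists_orthogonal_diagonalization hM
  exact integrable_ESD_of_roots hN h hf

end Spectrum

section StieltjesTransform

open scoped Topology BoundedContinuousFunction

lemma norm_cauchyKernel_le {z : ℂ} (hz : z.im ≠ 0) (x : ℝ) : ‖cauchyKernel z x‖ ≤ |z.im|⁻¹ := by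
  rw [cauchyKernel, norm_inv]
  refine inv_anti₀ (abs_pos.2 hz) ?_
  calc |z.im| = |((x : ℂ) - z).im| := by simp
    _ ≤ _ := Complex.abs_im_le_norm _

/-- The resolvent function as a bounded continuous function. -/
noncomputable def boundedCauchyKernel (z : ℂ) (hz : z.im ≠ 0) : ℝ →ᵇ ℂ :=
  BoundedContinuousFunction.ofNormedAddCommGroup (cauchyKernel z) (continuous_cauchyKernel hz)
    |z.im|⁻¹ (norm_cauchyKernel_le hz)

@[simp] lemma boundedCauchyKernel_apply (z : ℂ) (hz : z.im ≠ 0) (x : ℝ) :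
    boundedCauchyKernel z hz x = cauchyKernel z x := rfl

lemma cauchyKernel_sub {z w : ℂ} (hz : z.im ≠ 0) (hw : w.im ≠ 0) (x : ℝ) :
    cauchyKernel z x - cauchyKernel w x = (z - w) * (cauchyKernel z x * cauchyKernel w x) := by
  have h1 := ofReal_sub_ne_zero hz x
  have h2 := ofReal_sub_ne_zero hw x
  simp only [cauchyKernel]
  field_simp
  ring

lemma star_cauchyKernel (z : ℂ) (x : ℝ) : star (cauchyKernel z x) = cauchyKernel (star z) x := by
  simp [cauchyKernel]

lemma integrable_cauchyKernel (ν : Measure ℝ) [IsFiniteMeasure ν] {z : ℂ} (hz : z.im ≠ 0) :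
    Integrable (cauchyKernel z) ν :=
  (boundedCauchyKernel z hz).integrable ν

/-- The closed span of the constants and the resolvent functions. -/
noncomputable def cauchySpan : Submodule ℂ (ℝ →ᵇ ℂ) :=
  (Submodule.span ℂ (insert 1 (Set.range fun z : {z : ℂ // z.im ≠ 0} =>
    boundedCauchyKernel z.1 z.2))).topologicalClosure

lemma boundedCauchyKernel_mem_cauchySpan (z : ℂ) (hz : z.im ≠ 0) :
    boundedCauchyKernel z hz ∈ cauchySpan :=
  Submodule.le_topologicalClosure _
    (Submodule.subset_span (Set.mem_insert_of_mem _ ⟨⟨z, hz⟩, rfl⟩))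

lemma one_mem_cauchySpan : (1 : ℝ →ᵇ ℂ) ∈ cauchySpan :=
  Submodule.le_topologicalClosure _ (Submodule.subset_span (Set.mem_insert _ _))

lemma isClosed_cauchySpan : IsClosed (cauchySpan : Set (ℝ →ᵇ ℂ)) :=
  Submodule.isClosed_topologicalClosure _

lemma cauchySpan_induction {S : Submodule ℂ (ℝ →ᵇ ℂ)} (hS : IsClosed (S : Set (ℝ →ᵇ ℂ)))
    (h1 : 1 ∈ S) (h2 : ∀ z hz, boundedCauchyKernel z hz ∈ S) : cauchySpan ≤ S := by
  refine Submodule.topologicalClosure_minimal _ (Submodule.span_le.2 ?_) hS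
  rintro f (rfl | ⟨z, rfl⟩)
  exacts [h1, h2 _ _]

lemma boundedCauchyKernel_mul_mem {z w : ℂ} (hz : z.im ≠ 0) (hw : w.im ≠ 0) :
    boundedCauchyKernel z hz * boundedCauchyKernel w hw ∈ cauchySpan := by
  have key : ∀ {z w : ℂ} (hz : z.im ≠ 0) (hw : w.im ≠ 0), z ≠ w →
      boundedCauchyKernel z hz * boundedCauchyKernel w hw ∈ cauchySpan := by
    intro z w hz hw hzw
    have : boundedCauchyKernel z hz * boundedCauchyKernel w hw
        = (z - w)⁻¹ • (boundedCauchyKernel z hz - boundedCauchyKernel w hw) := by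
      ext x
      have := cauchyKernel_sub hz hw x
      simp only [BoundedContinuousFunction.coe_mul, BoundedContinuousFunction.coe_smul,
        BoundedContinuousFunction.coe_sub, Pi.mul_apply, Pi.sub_apply,
        boundedCauchyKernel_apply, this, smul_eq_mul]
      rw [inv_mul_cancel_left₀ (sub_ne_zero.2 hzw)]
    rw [this]
    exact Submodule.smul_mem _ _ (Submodule.sub_mem _ (boundedCauchyKernel_mem_cauchySpan _ _)
      (boundedCauchyKernel_mem_cauchySpan _ _))
  by_cases hzw : z = w
  · subst hzw
    set u : ℕ → ℂ := fun n => z + (1 / ((n : ℝ) + 1) : ℝ) with hu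
    have hui : ∀ n, (u n).im = z.im := fun n => by simp [hu]
    have hun : ∀ n, (u n).im ≠ 0 := fun n => by rwa [hui]
    have hne : ∀ n, u n ≠ z := fun n => by
      simp only [hu, ne_eq, add_eq_left]
      norm_cast
      positivity
    have hlim : Tendsto (fun n => boundedCauchyKernel (u n) (hun n)) atTop
        (𝓝 (boundedCauchyKernel z hz)) := by
      rw [tendsto_iff_norm_sub_tendsto_zero]
      have hb : Tendsto (fun n : ℕ => 1 / ((n : ℝ) + 1) * (|z.im|⁻¹ * |z.im|⁻¹)) atTop (𝓝 0) := by
        simpa using tendsto_one_div_add_atTop_nhds_zero_nat.mul_const (|z.im|⁻¹ * |z.im|⁻¹)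
      refine squeeze_zero (fun _ => norm_nonneg _) (fun n => ?_) hb
      rw [BoundedContinuousFunction.norm_le (by positivity)]
      intro x
      simp only [BoundedContinuousFunction.coe_sub, Pi.sub_apply, boundedCauchyKernel_apply,
        cauchyKernel_sub (hun n) hz, norm_mul]
      gcongr
      · simp only [hu, add_sub_cancel_left, Complex.norm_real, Real.norm_eq_abs]
        rw [abs_of_nonneg (by positivity)]
      · exact (norm_cauchyKernel_le (hun n) x).trans_eq (by rw [hui])
      · exact norm_cauchyKernel_le hz x
    exact isClosed_cauchySpan.mem_of_tendsto (hlim.mul_const _)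
      (Eventually.of_forall fun n => key _ _ (hne n))
  · exact key hz hw hzw

lemma mul_mem_cauchySpan {f g : ℝ →ᵇ ℂ} (hf : f ∈ cauchySpan) (hg : g ∈ cauchySpan) :
    f * g ∈ cauchySpan := by
  have hR : ∀ g : ℝ →ᵇ ℂ, 1 * g ∈ cauchySpan → (∀ z hz, boundedCauchyKernel z hz * g ∈ cauchySpan)
      → ∀ f ∈ cauchySpan, f * g ∈ cauchySpan := by
    intro g h1 h2
    exact cauchySpan_induction (S := cauchySpan.comap (LinearMap.mulRight ℂ g))
      (isClosed_cauchySpan.preimage (continuous_mul_const g)) h1 h2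
  refine hR g (by simpa using hg) (fun z hz => ?_) f hf
  rw [mul_comm]
  refine hR _ (by simpa using boundedCauchyKernel_mem_cauchySpan z hz) (fun w hw => ?_) g hg
  exact boundedCauchyKernel_mul_mem hw hz

lemma star_mem_cauchySpan {f : ℝ →ᵇ ℂ} (hf : f ∈ cauchySpan) : star f ∈ cauchySpan := by
  let S : Submodule ℂ (ℝ →ᵇ ℂ) :=
    { carrier := {f | star f ∈ cauchySpan}
      add_mem' := fun ha hb => by
        simp only [Set.mem_ofPred_eq, star_add] at *; exact Submodule.add_mem _ ha hb
      zero_mem' := by simp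
      smul_mem' := fun c f hf => by
        simp only [Set.mem_ofPred_eq, star_smul] at *; exact Submodule.smul_mem _ _ hf }
  refine cauchySpan_induction (S := S) (isClosed_cauchySpan.preimage continuous_star) ?_ ?_ hf
  · change star (1 : ℝ →ᵇ ℂ) ∈ cauchySpan
    rw [star_one]; exact one_mem_cauchySpan
  · intro z hz
    change star _ ∈ cauchySpan
    have hz' : (star z).im ≠ 0 := by simpa using hz
    have : star (boundedCauchyKernel z hz) = boundedCauchyKernel (star z) hz' := by
      ext x; exact star_cauchyKernel z x
    rw [this]
    exact boundedCauchyKernel_mem_cauchySpan _ _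

/-- A probability measure on `ℝ` is determined by its Stieltjes transform. -/
theorem ext_of_integral_cauchyKernel {ν ν' : Measure ℝ} [IsProbabilityMeasure ν]
    [IsProbabilityMeasure ν']
    (h : ∀ z : ℂ, 0 < z.im → ∫ x, cauchyKernel z x ∂ν = ∫ x, cauchyKernel z x ∂ν') : ν = ν' := by
  let A : StarSubalgebra ℂ (ℝ →ᵇ ℂ) :=
    { carrier := cauchySpan
      mul_mem' := mul_mem_cauchySpan
      one_mem' := one_mem_cauchySpan
      add_mem' := cauchySpan.add_mem
      zero_mem' := cauchySpan.zero_mem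
      algebraMap_mem' := fun c => by
        rw [Algebra.algebraMap_eq_smul_one]
        exact cauchySpan.smul_mem _ one_mem_cauchySpan
      star_mem' := star_mem_cauchySpan }
  refine ext_of_forall_mem_subalgebra_integral_eq_of_polish (A := A) ?_ ?_
  · intro x y hxy
    refine ⟨boundedCauchyKernel Complex.I (by simp), ⟨_, ⟨boundedCauchyKernel Complex.I (by simp),
      boundedCauchyKernel_mem_cauchySpan _ _, rfl⟩, rfl⟩, ?_⟩
    change cauchyKernel Complex.I x ≠ cauchyKernel Complex.I y
    simpa [cauchyKernel] using hxy
  · have hz : ∀ z : ℂ, z.im ≠ 0 → ∫ x, cauchyKernel z x ∂ν = ∫ x, cauchyKernel z x ∂ν' := by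
      intro z hz
      rcases hz.lt_or_gt with h0 | h0
      · have := h (star z) (by simpa using h0)
        simp_rw [← star_cauchyKernel] at this
        simp only [← starRingEnd_apply] at this
        rw [integral_conj, integral_conj] at this
        exact (starRingEnd ℂ).injective this
      · exact h z h0
    let S : Submodule ℂ (ℝ →ᵇ ℂ) :=
      { carrier := {f | ∫ x, f x ∂ν = ∫ x, f x ∂ν'}
        add_mem' := fun {a b} ha hb => by
          simp only [Set.mem_ofPred_eq, BoundedContinuousFunction.coe_add, Pi.add_apply] at *
          rw [integral_add (a.integrable ν) (b.integrable ν), ha, hb,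
            integral_add (a.integrable ν') (b.integrable ν')]
        zero_mem' := by simp
        smul_mem' := fun c f hf => by
          simp only [Set.mem_ofPred_eq, BoundedContinuousFunction.coe_smul] at *
          rw [integral_smul, integral_smul, hf] }
    have hcont : ∀ (κ : Measure ℝ) [IsProbabilityMeasure κ],
        Continuous fun f : ℝ →ᵇ ℂ => ∫ x, f x ∂κ := by
      intro κ _
      refine LipschitzWith.continuous (K := 1) (LipschitzWith.of_dist_le_mul fun f g => ?_)
      rw [dist_eq_norm, dist_eq_norm, ← integral_sub (f.integrable κ) (g.integrable κ)]
      refine (norm_integral_le_of_norm_le_const (C := ‖f - g‖)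
        (Eventually.of_forall fun x => (f - g).norm_coe_le_norm x)).trans ?_
      simp
    refine cauchySpan_induction (S := S) (isClosed_eq (hcont ν) (hcont ν')) ?_ ?_
    · simp [S]
    · intro z hz'
      exact hz z hz'

end StieltjesTransform

section ConvergenceInProbability

open scoped Topology BoundedContinuousFunction

lemma exists_subseq_tendsto_of_integral_sq_le {κ : ℕ → ProbabilityMeasure ℝ} {K : ℝ}
    (hint : ∀ n, Integrable (fun x : ℝ => x ^ 2) (κ n : Measure ℝ))
    (hK : ∀ n, ∫ x, x ^ 2 ∂(κ n : Measure ℝ) ≤ K) :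
    ∃ (ν : ProbabilityMeasure ℝ) (φ : ℕ → ℕ), StrictMono φ ∧ Tendsto (κ ∘ φ) atTop (𝓝 ν) := by
  have htight : IsTightMeasureSet {((μ : ProbabilityMeasure ℝ) : Measure ℝ) | μ ∈ Set.range κ} := by
    rw [isTightMeasureSet_iff_exists_isCompact_measure_compl_le]
    intro ε hε
    have hK0 : 0 ≤ K := (integral_nonneg fun x => sq_nonneg x).trans (hK 0)
    obtain ⟨R, hR, hRε⟩ : ∃ R : ℝ, 0 < R ∧ ENNReal.ofReal (K / R ^ 2) ≤ ε := by
      have h0 : Tendsto (fun R : ℝ => ENNReal.ofReal (K / R ^ 2)) atTop (𝓝 0) := by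
        have : Tendsto (fun R : ℝ => K / R ^ 2) atTop (𝓝 0) :=
          tendsto_const_nhds.div_atTop (tendsto_pow_atTop two_ne_zero)
        simpa using ENNReal.tendsto_ofReal this
      obtain ⟨R, h1, h2⟩ := ((h0.eventually (ge_mem_nhds hε)).and (eventually_gt_atTop 0)).exists
      exact ⟨R, h2, h1⟩
    refine ⟨Set.Icc (-R) R, isCompact_Icc, ?_⟩
    rintro _ ⟨_, ⟨n, rfl⟩, rfl⟩
    refine le_trans ?_ hRε
    have h1 : (Set.Icc (-R) R)ᶜ ⊆ {x : ℝ | R ^ 2 ≤ x ^ 2} := by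
      intro x hx
      by_contra hlt
      have hlt : x ^ 2 < R ^ 2 := not_le.1 hlt
      exact hx (abs_le.1 (abs_lt_of_sq_lt_sq hlt hR.le).le)
    refine (measure_mono h1).trans ?_
    have h2 := mul_meas_ge_le_integral_of_nonneg (μ := (κ n : Measure ℝ))
      (Eventually.of_forall fun x : ℝ => sq_nonneg x) (hint n) (R ^ 2)
    rw [← ofReal_measureReal]
    refine ENNReal.ofReal_le_ofReal ?_
    rw [le_div_iff₀ (by positivity), mul_comm]
    exact h2.trans (hK n)
  obtain ⟨ν, -, φ, hφ, hlim⟩ := (isCompact_closure_of_isTightMeasureSet htight).tendsto_subseq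
    (x := κ) (fun n => subset_closure ⟨n, rfl⟩)
  exact ⟨ν, φ, hφ, hlim⟩

lemma continuous_integral_cauchyKernel (ν : Measure ℝ) [IsProbabilityMeasure ν] :
    Continuous fun z : {z : ℂ // 0 < z.im} => ∫ x, cauchyKernel z x ∂ν := by
  rw [continuous_iff_continuousAt]
  intro z
  have hz := z.2
  have hev : ∀ᶠ w : {z : ℂ // 0 < z.im} in 𝓝 z, (z : ℂ).im / 2 < (w : ℂ).im :=
    (Complex.continuous_im.comp continuous_subtype_val).continuousAt.eventually_const_lt
      (show (z : ℂ).im / 2 < (z : ℂ).im by linarith)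
  refine continuousAt_of_dominated (bound := fun _ => ((z : ℂ).im / 2)⁻¹)
    (Eventually.of_forall fun w => (continuous_cauchyKernel w.2.ne').aestronglyMeasurable)
    ?_ (integrable_const _) ?_
  · filter_upwards [hev] with w hw
    refine Eventually.of_forall fun x => (norm_cauchyKernel_le w.2.ne' x).trans ?_
    rw [abs_of_pos w.2]
    exact inv_anti₀ (by linarith) hw.le
  · refine Eventually.of_forall fun x => ?_
    exact ContinuousAt.inv₀ (by fun_prop) (ofReal_sub_ne_zero z.2.ne' x)

instance : Nonempty {z : ℂ // 0 < z.im} := ⟨⟨Complex.I, by simp⟩⟩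

lemma ext_of_integral_cauchyKernel_denseSeq {ν ν' : Measure ℝ} [IsProbabilityMeasure ν]
    [IsProbabilityMeasure ν']
    (h : ∀ k, ∫ x, cauchyKernel (TopologicalSpace.denseSeq {z : ℂ // 0 < z.im} k) x ∂ν =
      ∫ x, cauchyKernel (TopologicalSpace.denseSeq {z : ℂ // 0 < z.im} k) x ∂ν') : ν = ν' := by
  refine ext_of_integral_cauchyKernel fun z hz => ?_
  exact congrFun ((TopologicalSpace.denseRange_denseSeq {z : ℂ // 0 < z.im}).equalizer
    (continuous_integral_cauchyKernel ν) (continuous_integral_cauchyKernel ν') (funext h)) ⟨z, hz⟩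

lemma exists_subseq_tendsto_of_cauchyKernel {κ : ℕ → ProbabilityMeasure ℝ} {K : ℝ}
    (hint : ∀ n, Integrable (fun x : ℝ => x ^ 2) (κ n : Measure ℝ))
    (hK : ∀ n, ∫ x, x ^ 2 ∂(κ n : Measure ℝ) ≤ K) {q : ℕ → {z : ℂ // 0 < z.im}} {m : ℕ → ℂ}
    (hm : ∀ n, ∀ k ≤ n, ‖∫ x, cauchyKernel (q k) x ∂(κ n : Measure ℝ) - m k‖ < 1 / (n + 1)) :
    ∃ (ν : ProbabilityMeasure ℝ) (φ : ℕ → ℕ), StrictMono φ ∧ Tendsto (κ ∘ φ) atTop (𝓝 ν) ∧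
      ∀ k, ∫ x, cauchyKernel (q k) x ∂(ν : Measure ℝ) = m k := by
  obtain ⟨ν, φ, hφ, hlim⟩ := exists_subseq_tendsto_of_integral_sq_le hint hK
  refine ⟨ν, φ, hφ, hlim, fun k => ?_⟩
  have h1 := (ProbabilityMeasure.tendsto_iff_forall_integral_rclike_tendsto ℂ).1 hlim
    (boundedCauchyKernel (q k) (q k).2.ne')
  refine tendsto_nhds_unique h1 ?_
  rw [tendsto_iff_norm_sub_tendsto_zero]
  refine squeeze_zero' (Eventually.of_forall fun _ => norm_nonneg _) ?_
    ((tendsto_one_div_add_atTop_nhds_zero_nat (𝕜 := ℝ)).comp hφ.tendsto_atTop)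
  filter_upwards [eventually_ge_atTop k] with n hn
  exact (hm (φ n) k (hn.trans hφ.le_apply)).le

lemma absolutelyContinuous_of_norm_integral_cauchyKernel_le {ν : Measure ℝ}
    [IsProbabilityMeasure ν] {C : ℝ}
    (hC : ∀ z : ℂ, 0 < z.im → ‖∫ x, cauchyKernel z x ∂ν‖ ≤ C) : ν ≪ volume := by
  have hC0 : 0 ≤ C := (norm_nonneg _).trans (hC Complex.I (by simp))
  have hIcc : ∀ a b : ℝ, a < b → ν.real (Set.Ioc a b) ≤ (5 / 4 * C) * (b - a) := by
    intro a b hab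
    set z : ℂ := ⟨(a + b) / 2, b - a⟩ with hz
    have hzim : 0 < z.im := by simpa [hz] using hab
    have h1 : (∫ x, cauchyKernel z x ∂ν).im ≤ C :=
      (le_abs_self _).trans ((Complex.abs_im_le_norm _).trans (hC z hzim))
    have h2 : (∫ x, cauchyKernel z x ∂ν).im = ∫ x, (cauchyKernel z x).im ∂ν :=
      (integral_im (𝕜 := ℂ) (integrable_cauchyKernel ν hzim.ne')).symm
    have him : ∀ x : ℝ, (cauchyKernel z x).im = (b - a) / ((x - (a + b) / 2) ^ 2 + (b - a) ^ 2) := by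
      intro x
      simp only [cauchyKernel, Complex.inv_im, Complex.normSq_apply, hz]
      simp
      ring_nf
    have h3 : ∫ x, (Set.Ioc a b).indicator (fun _ => (4 / 5 * (b - a)⁻¹ : ℝ)) x ∂ν
        ≤ ∫ x, (cauchyKernel z x).im ∂ν := by
      refine integral_mono ((integrable_const _).indicator measurableSet_Ioc)
        (integrable_cauchyKernel ν hzim.ne').im fun x => ?_
      change _ ≤ (cauchyKernel z x).im
      have hba : 0 < b - a := by linarith
      rw [him]
      by_cases hx : x ∈ Set.Ioc a b
      · rw [Set.indicator_of_mem hx, le_div_iff₀ (by positivity)]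
        have h4 : (x - (a + b) / 2) ^ 2 ≤ (b - a) ^ 2 / 4 := by nlinarith [hx.1, hx.2]
        have h5 : (b - a)⁻¹ * (b - a) = 1 := inv_mul_cancel₀ hba.ne'
        have h6 : (0 : ℝ) < (b - a)⁻¹ := inv_pos.2 hba
        calc 4 / 5 * (b - a)⁻¹ * ((x - (a + b) / 2) ^ 2 + (b - a) ^ 2)
            ≤ 4 / 5 * (b - a)⁻¹ * ((b - a) ^ 2 / 4 + (b - a) ^ 2) := by gcongr
          _ = ((b - a)⁻¹ * (b - a)) * (b - a) := by ring
          _ = b - a := by rw [h5, one_mul]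
      · rw [Set.indicator_of_notMem hx]; positivity
    rw [integral_indicator_const _ measurableSet_Ioc, ← h2, smul_eq_mul] at h3
    have hba : 0 < b - a := by linarith
    have h4 := h3.trans h1
    have h5 : ν.real (Set.Ioc a b) = (ν.real (Set.Ioc a b) * (4 / 5 * (b - a)⁻¹)) *
        (5 / 4 * (b - a)) := by field_simp
    rw [h5]
    calc _ ≤ C * (5 / 4 * (b - a)) := by gcongr
      _ = _ := by ring
  set D : NNReal := ⟨5 / 4 * C, by positivity⟩ with hD
  let g : StieltjesFunction ℝ :=
    { toFun := fun x => (D : ℝ) * x - ProbabilityTheory.cdf ν x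
      mono' := by
        intro a b hab
        rcases hab.eq_or_lt with rfl | hlt
        · exact le_rfl
        have h1 := hIcc a b hlt
        have h2 : ν.real (Set.Ioc a b) = ProbabilityTheory.cdf ν b - ProbabilityTheory.cdf ν a := by
          have := (ProbabilityTheory.cdf ν).measure_Ioc a b
          rw [ProbabilityTheory.measure_cdf] at this
          rw [Measure.real, this, ENNReal.toReal_ofReal]
          exact sub_nonneg.2 ((ProbabilityTheory.cdf ν).mono hab)
        rw [h2] at h1
        have h3 : (D : ℝ) = 5 / 4 * C := rfl
        simp only [h3]
        linarith
      right_continuous' := fun x => by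
        refine ContinuousWithinAt.sub (by fun_prop) ((ProbabilityTheory.cdf ν).right_continuous x) }
  have hsum : g + ProbabilityTheory.cdf ν = D • StieltjesFunction.id := by
    ext x
    change (D : ℝ) * x - ProbabilityTheory.cdf ν x + ProbabilityTheory.cdf ν x = _
    rw [sub_add_cancel]
    rfl
  have hmeas : (g + ProbabilityTheory.cdf ν).measure = (D • StieltjesFunction.id).measure := by
    rw [hsum]
  rw [StieltjesFunction.measure_add, StieltjesFunction.measure_smul,
    ProbabilityTheory.measure_cdf, ← Real.volume_eq_stieltjes_id] at hmeas
  have hle : ν ≤ D • volume := by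
    rw [← hmeas]
    exact Measure.le_add_left le_rfl
  exact (Measure.absolutelyContinuous_of_le hle).trans (Measure.smul_absolutelyContinuous)

/-- Convergence in probability of Stieltjes transforms to a bounded limit, together with tightness,
gives convergence of random measures to an absolutely continuous probability measure. -/
theorem exists_absolutelyContinuous_tendstoInMeasure {Ω : Type*} [MeasurableSpace Ω]
    (P : Measure Ω) [IsProbabilityMeasure P] {κ : ℕ → Ω → Measure ℝ}
    (hκ : ∀ N, N ≠ 0 → ∀ ω, IsProbabilityMeasure (κ N ω))
    (hκ2 : ∀ N, N ≠ 0 → ∀ ω, Integrable (fun x : ℝ => x ^ 2) (κ N ω))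
    {C₂ : ℝ} (htight : ∀ N, N ≠ 0 → ∀ K : ℝ, 0 < K →
      P {ω | K ≤ ∫ x, x ^ 2 ∂κ N ω} ≤ ENNReal.ofReal (C₂ / K))
    {m : ℂ → ℂ} {C : ℝ} (hmC : ∀ z : ℂ, 0 < z.im → ‖m z‖ ≤ C)
    (hconv : ∀ z : ℂ, 0 < z.im →
      TendstoInMeasure P (fun N ω => ∫ x, cauchyKernel z x ∂κ N ω) atTop fun _ => m z) :
    ∃ ν : Measure ℝ, IsProbabilityMeasure ν ∧ ν ≪ volume ∧ ∀ φ : ℝ →ᵇ ℝ,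
      TendstoInMeasure P (fun N ω => ∫ x, φ x ∂κ N ω) atTop fun _ => ∫ x, φ x ∂ν := by
  set q := TopologicalSpace.denseSeq {z : ℂ // 0 < z.im} with hq
  let good : ℕ → ℕ → ℝ → Set Ω := fun N n K =>
    {ω | ∫ x, x ^ 2 ∂κ N ω < K ∧ ∀ k ≤ n, ‖∫ x, cauchyKernel (q k) x ∂κ N ω - m (q k)‖ < 1 / (n + 1)}
  have hgood : ∀ ε : ENNReal, 0 < ε → ∃ K, ∀ n, ∀ᶠ N in atTop, P (good N n K)ᶜ ≤ ε := by
    intro ε hε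
    obtain ⟨K, hK, hKε⟩ : ∃ K : ℝ, 0 < K ∧ ENNReal.ofReal (C₂ / K) ≤ ε / 2 := by
      have h0 : Tendsto (fun K : ℝ => ENNReal.ofReal (C₂ / K)) atTop (𝓝 0) := by
        have : Tendsto (fun K : ℝ => C₂ / K) atTop (𝓝 0) := tendsto_const_nhds.div_atTop tendsto_id
        simpa using ENNReal.tendsto_ofReal this
      obtain ⟨R, h1, h2⟩ := ((h0.eventually (ge_mem_nhds (ENNReal.half_pos hε.ne'))).and
        (eventually_gt_atTop 0)).exists
      exact ⟨R, h2, h1⟩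
    refine ⟨K, fun n => ?_⟩
    have hsum : Tendsto (fun N => ∑ k ∈ Finset.range (n + 1),
        P {ω | 1 / ((n : ℝ) + 1) ≤ ‖∫ x, cauchyKernel (q k) x ∂κ N ω - m (q k)‖}) atTop (𝓝 0) := by
      have : (0 : ENNReal) = ∑ k ∈ Finset.range (n + 1), 0 := by simp
      rw [this]
      refine tendsto_finsetSum _ fun k _ => ?_
      exact tendstoInMeasure_iff_norm.1 (hconv (q k) (q k).2) _ (by positivity)
    filter_upwards [hsum.eventually (ge_mem_nhds (ENNReal.half_pos hε.ne')), eventually_ne_atTop 0]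
      with N hN hN0
    have hsub : (good N n K)ᶜ ⊆ {ω | K ≤ ∫ x, x ^ 2 ∂κ N ω} ∪ ⋃ k ∈ Finset.range (n + 1),
        {ω | 1 / ((n : ℝ) + 1) ≤ ‖∫ x, cauchyKernel (q k) x ∂κ N ω - m (q k)‖} := by
      intro ω hω
      by_contra hcon
      simp only [Set.mem_union, Set.mem_iUnion, Set.mem_ofPred_eq, Finset.mem_range, not_or,
        not_exists, not_le, Nat.lt_succ_iff] at hcon
      exact hω ⟨hcon.1, fun k hk => hcon.2 k hk⟩
    calc P (good N n K)ᶜ ≤ _ := measure_mono hsub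
      _ ≤ _ := measure_union_le _ _
      _ ≤ ε / 2 + ε / 2 := add_le_add ((htight N hN0 K hK).trans hKε)
          ((measure_biUnion_finset_le _ _).trans hN)
      _ = ε := ENNReal.add_halves ε
  have hseq : ∀ K, ∀ N : ℕ → ℕ, ∀ ω : ℕ → Ω, (∀ n, N n ≠ 0) → (∀ n, ω n ∈ good (N n) n K) →
      ∃ (ν : Measure ℝ) (_ : IsProbabilityMeasure ν) (φ : ℕ → ℕ),
      (∀ k, ∫ x, cauchyKernel (q k) x ∂ν = m (q k)) ∧ ∀ g : ℝ →ᵇ ℝ,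
        Tendsto (fun n => ∫ x, g x ∂κ (N (φ n)) (ω (φ n))) atTop (𝓝 (∫ x, g x ∂ν)) := by
    intro K N ω hN hω
    obtain ⟨ν, φ, -, hlim, hν⟩ := exists_subseq_tendsto_of_cauchyKernel
      (κ := fun n => ⟨κ (N n) (ω n), hκ _ (hN n) _⟩) (K := K) (q := q) (m := fun k => m (q k))
      (fun n => hκ2 _ (hN n) _) (fun n => (hω n).1.le) (fun n => (hω n).2)
    exact ⟨ν, ν.2, φ, hν, fun g => ProbabilityMeasure.tendsto_iff_forall_integral_tendsto.1 hlim g⟩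
  obtain ⟨ν, hνp, hν⟩ : ∃ (ν : Measure ℝ) (_ : IsProbabilityMeasure ν),
      ∀ k, ∫ x, cauchyKernel (q k) x ∂ν = m (q k) := by
    obtain ⟨K, hK⟩ := hgood (1 / 2) (by simp)
    have hex : ∀ n, ∃ N : ℕ, ∃ ω, N ≠ 0 ∧ ω ∈ good N n K := by
      intro n
      obtain ⟨N, hN, hN0⟩ := ((hK n).and (eventually_ne_atTop 0)).exists
      by_contra hcon
      push Not at hcon
      have : (good N n K)ᶜ = Set.univ := by
        rw [Set.compl_univ_iff, Set.eq_empty_iff_forall_notMem]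
        exact fun ω hω => hcon N ω hN0 hω
      rw [this, measure_univ] at hN
      exact absurd hN (by simp)
    choose N ω hN hω using hex
    obtain ⟨ν, hνp, -, hν, -⟩ := hseq K N ω hN hω
    exact ⟨ν, hνp, hν⟩
  refine ⟨ν, hνp, absolutelyContinuous_of_norm_integral_cauchyKernel_le (C := C) ?_, fun φ => ?_⟩
  · intro z hz
    refine (TopologicalSpace.denseRange_denseSeq {z : ℂ // 0 < z.im}).induction_on
      (p := fun z => ‖∫ x, cauchyKernel z x ∂ν‖ ≤ C) ⟨z, hz⟩ ?_ ?_
    · exact isClosed_le (continuous_integral_cauchyKernel ν).norm continuous_const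
    · intro k
      rw [hν k]
      exact hmC _ (q k).2
  · rw [tendstoInMeasure_iff_norm]
    intro ε hε
    rw [ENNReal.tendsto_nhds_zero]
    intro η hη
    obtain ⟨K, hK⟩ := hgood η hη
    obtain ⟨n, hn⟩ : ∃ n, ∀ N, N ≠ 0 → ∀ ω ∈ good N n K,
        ‖∫ x, φ x ∂κ N ω - ∫ x, φ x ∂ν‖ < ε := by
      by_contra hcon
      push Not at hcon
      choose N hN ω hω hbad using hcon
      obtain ⟨ν', hνp', ψ, hν', hlim⟩ := hseq K N ω hN hω
      have : ν' = ν := ext_of_integral_cauchyKernel_denseSeq fun k => (hν' k).trans (hν k).symm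
      subst this
      have h0 := tendsto_iff_norm_sub_tendsto_zero.1 (hlim φ)
      exact absurd (ge_of_tendsto' h0 fun j => hbad (ψ j)) (not_le.2 hε)
    filter_upwards [hK n, eventually_ne_atTop 0] with N hN hN0
    refine (measure_mono fun ω hω => ?_).trans hN
    intro hω'
    exact absurd hω (not_le.2 (hn N hN0 ω hω'))

end ConvergenceInProbability

section GaussianAnalysis

open ProbabilityTheory

variable {α ι : Type*} [MeasurableSpace α] [Fintype ι]

lemma integrable_of_measurable_of_norm_le {E : Type*} [NormedAddCommGroup E] [MeasurableSpace E]
    [BorelSpace E] [SecondCountableTopology E] (μ : Measure α) [IsFiniteMeasure μ] {f : α → E}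
    (hf : Measurable f) {B : ℝ} (hB : ∀ x, ‖f x‖ ≤ B) : Integrable f μ :=
  Integrable.of_bound hf.aestronglyMeasurable B (Eventually.of_forall hB)

lemma norm_integral_le_of_norm_le_of_isProbabilityMeasure (μ : Measure α) [IsProbabilityMeasure μ]
    {f : α → ℂ} {B : ℝ} (hB : ∀ x, ‖f x‖ ≤ B) : ‖∫ x, f x ∂μ‖ ≤ B := by
  simpa using norm_integral_le_of_norm_le_const (μ := μ) (Eventually.of_forall hB)

lemma integral_norm_sub_sq_eq (μ : Measure α) [IsProbabilityMeasure μ] {f : α → ℂ}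
    (hf : Measurable f) {B : ℝ} (hB : ∀ x, ‖f x‖ ≤ B) (a : ℂ) :
    ∫ x, ‖f x - a‖ ^ 2 ∂μ = ∫ x, ‖f x - ∫ y, f y ∂μ‖ ^ 2 ∂μ + ‖∫ y, f y ∂μ - a‖ ^ 2 := by
  set E := ∫ y, f y ∂μ with hE
  have hi : Integrable f μ := integrable_of_measurable_of_norm_le μ hf hB
  have h1 : ∀ x, ‖f x - a‖ ^ 2 = ‖f x - E‖ ^ 2 + 2 * ((f x - E) * star (E - a)).re + ‖E - a‖ ^ 2 := by
    intro x
    have : f x - a = (f x - E) + (E - a) := by ring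
    rw [this]
    simp only [← Complex.normSq_eq_norm_sq, Complex.normSq_add, Complex.star_def]
    ring
  have h2 : Integrable (fun x => ‖f x - E‖ ^ 2) μ := by
    refine integrable_of_measurable_of_norm_le μ (by fun_prop) (B := (B + ‖E‖) ^ 2) fun x => ?_
    rw [norm_pow, norm_norm]
    gcongr
    exact (norm_sub_le _ _).trans (add_le_add_left (hB x) _)
  have h3 : Integrable (fun x => (f x - E) * star (E - a)) μ :=
    (hi.sub (integrable_const E)).mul_const _
  have h3' : Integrable (fun x => ((f x - E) * star (E - a)).re) μ := h3.re
  simp_rw [h1]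
  have h5 : Integrable (fun x => ‖f x - E‖ ^ 2 + 2 * ((f x - E) * star (E - a)).re) μ :=
    h2.add (h3'.const_mul 2)
  rw [integral_add h5 (integrable_const _), integral_add h2 (h3'.const_mul 2),
    integral_const_mul]
  have h4 : ∫ x, ((f x - E) * star (E - a)).re ∂μ = 0 := by
    have := integral_re (𝕜 := ℂ) h3
    refine this.trans ?_
    rw [integral_mul_const, integral_sub hi (integrable_const E)]
    simp [← hE]
  rw [h4]
  simp

lemma integral_norm_sub_integral_sq_le (μ : Measure α) [IsProbabilityMeasure μ] {f : α → ℂ}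
    (hf : Measurable f) {B : ℝ} (hB : ∀ x, ‖f x‖ ≤ B) (a : ℂ) :
    ∫ x, ‖f x - ∫ y, f y ∂μ‖ ^ 2 ∂μ ≤ ∫ x, ‖f x - a‖ ^ 2 ∂μ := by
  rw [integral_norm_sub_sq_eq μ hf hB a]
  have : 0 ≤ ‖∫ y, f y ∂μ - a‖ ^ 2 := by positivity
  linarith

lemma integrable_sq_gaussianReal : Integrable (fun t : ℝ => t ^ 2) (gaussianReal 0 1) :=
  (memLp_id_gaussianReal (μ := 0) (v := 1) 2).integrable_sq

lemma integrable_id_gaussianReal : Integrable (fun t : ℝ => t) (gaussianReal 0 1) :=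
  (memLp_id_gaussianReal (μ := 0) (v := 1) 1).integrable le_rfl

lemma integral_sq_gaussianReal : ∫ t : ℝ, t ^ 2 ∂(gaussianReal 0 1) = 1 := by
  have h := variance_id_gaussianReal (μ := 0) (v := 1)
  rw [variance_of_integral_eq_zero aemeasurable_id (by simp)] at h
  simpa using h

/-- Gaussian integration by parts. -/
lemma integral_mul_gaussianReal {h h' : ℝ → ℂ} (hd : ∀ t, HasDerivAt h (h' t) t) {B B' : ℝ}
    (hB : ∀ t, ‖h t‖ ≤ B) (hB' : ∀ t, ‖h' t‖ ≤ B') :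
    ∫ t : ℝ, (t : ℂ) * h t ∂(gaussianReal 0 1) = ∫ t, h' t ∂(gaussianReal 0 1) := by
  have hc : Continuous h := continuous_iff_continuousAt.2 fun t => (hd t).continuousAt
  have hm' : Measurable h' := by
    have : h' = deriv h := funext fun t => (hd t).deriv.symm
    rw [this]; exact measurable_deriv h
  have hpdf : ∀ t : ℝ, HasDerivAt (gaussianPDFReal 0 1) (-t * gaussianPDFReal 0 1 t) t := by
    intro t
    simp only [gaussianPDFReal_def, NNReal.coe_one, mul_one, sub_zero]
    have h1 : HasDerivAt (fun x : ℝ => -x ^ 2 / 2) (-t) t := by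
      refine ((hasDerivAt_pow 2 t).neg.div_const 2).congr_deriv ?_
      norm_num
      ring
    exact (h1.exp.const_mul ((√(2 * π))⁻¹)).congr_deriv (by ring)
  have hi2 : Integrable (fun t : ℝ => (gaussianPDFReal 0 1 t : ℝ)) := integrable_gaussianPDFReal _ _
  have hi1 : Integrable (fun t : ℝ => t * gaussianPDFReal 0 1 t) := by
    have h0 := integrable_id_gaussianReal
    rw [gaussianReal_of_var_ne_zero _ one_ne_zero] at h0
    rw [integrable_withDensity_iff_integrable_smul' (measurable_gaussianPDF 0 1)
      (Eventually.of_forall fun _ => gaussianPDF_lt_top)] at h0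
    refine h0.congr (Eventually.of_forall fun t => ?_)
    simp [toReal_gaussianPDF, mul_comm]
  have hmul : ∀ {p : ℝ → ℝ} {g : ℝ → ℂ} {C : ℝ}, Integrable p → Measurable g → (∀ t, ‖g t‖ ≤ C) →
      Integrable (fun t => g t * (p t : ℂ)) := by
    intro p g C hp hg hC
    exact hp.ofReal.bdd_mul hg.aestronglyMeasurable (Eventually.of_forall hC)
  have key := integral_mul_deriv_eq_deriv_mul_of_integrable (u := h)
    (v := fun t => (gaussianPDFReal 0 1 t : ℂ)) (u' := h')
    (v' := fun t => ((-t * gaussianPDFReal 0 1 t : ℝ) : ℂ)) (fun t _ => hd t)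
    (fun t _ => (hpdf t).ofReal_comp) ?_ ?_ ?_
  · rw [integral_gaussianReal_eq_integral_smul one_ne_zero,
      integral_gaussianReal_eq_integral_smul one_ne_zero]
    have e1 : ∫ t, h t * ((-t * gaussianPDFReal 0 1 t : ℝ) : ℂ)
        = - ∫ t, gaussianPDFReal 0 1 t • ((t : ℂ) * h t) := by
      rw [← integral_neg]
      refine integral_congr_ae (Eventually.of_forall fun t => ?_)
      simp only [Complex.real_smul]; push_cast; ring
    have e2 : ∫ t, h' t * (gaussianPDFReal 0 1 t : ℂ) = ∫ t, gaussianPDFReal 0 1 t • h' t := by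
      refine integral_congr_ae (Eventually.of_forall fun t => ?_)
      simp only [Complex.real_smul]; ring
    rw [e1, e2] at key
    exact neg_injective key
  · exact hmul (p := fun t => -t * gaussianPDFReal 0 1 t) (by simpa using hi1.neg) hc.measurable hB
  · exact hmul hi2 hm' hB'
  · exact hmul hi2 hc.measurable hB

/-- The law of a family of independent standard Gaussian variables. -/
noncomputable def gaussianPi (ι : Type*) [Fintype ι] : Measure (ι → ℝ) :=
  Measure.pi fun _ => gaussianReal 0 1

instance : IsProbabilityMeasure (gaussianPi ι) := by
  unfold gaussianPi; infer_instance

lemma measurePreserving_update [DecidableEq ι] (a : ι) :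
    MeasurePreserving (fun p : (ι → ℝ) × ℝ => Function.update p.1 a p.2)
      ((gaussianPi ι).prod (gaussianReal 0 1)) (gaussianPi ι) := by
  have hm : Measurable fun p : (ι → ℝ) × ℝ => Function.update p.1 a p.2 := by
    refine measurable_pi_iff.2 fun i => ?_
    by_cases hi : i = a
    · subst hi; simpa using measurable_snd
    · simp only [Function.update_of_ne hi]; fun_prop
  refine ⟨hm, (Measure.pi_eq fun s hs => ?_).symm⟩
  rw [Measure.map_apply hm (MeasurableSet.univ_pi hs)]
  have : (fun p : (ι → ℝ) × ℝ => Function.update p.1 a p.2) ⁻¹' (Set.univ.pi s)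
      = (Set.univ.pi (Function.update s a Set.univ)) ×ˢ (s a) := by
    ext p
    simp only [Set.mem_preimage, Set.mem_pi, Set.mem_univ, true_implies, Set.mem_prod]
    constructor
    · intro h
      refine ⟨fun i => ?_, by simpa using h a⟩
      by_cases hi : i = a
      · subst hi; simp
      · simpa [hi] using h i
    · rintro ⟨h1, h2⟩ i
      by_cases hi : i = a
      · subst hi; simpa using h2
      · simpa [hi] using h1 i
  rw [this, Measure.prod_prod, gaussianPi, Measure.pi_pi,
    ← Finset.mul_prod_erase _ (fun i => gaussianReal 0 1 (s i)) (Finset.mem_univ a),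
    ← Finset.mul_prod_erase _ _ (Finset.mem_univ a)]
  simp only [Function.update_self, measure_univ, one_mul]
  rw [mul_comm]
  congr 1
  refine Finset.prod_congr rfl fun i hi => ?_
  rw [Function.update_of_ne (Finset.ne_of_mem_erase hi)]

/-- Gaussian integration by parts in one coordinate. -/
lemma integral_mul_gaussianPi [DecidableEq ι] (a : ι) {F F' : (ι → ℝ) → ℂ} (hF : Measurable F)
    (hF' : Measurable F')
    (hd : ∀ w t, HasDerivAt (fun s => F (Function.update w a s)) (F' (Function.update w a t)) t)
    {B B' : ℝ} (hB : ∀ w, ‖F w‖ ≤ B) (hB' : ∀ w, ‖F' w‖ ≤ B') :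
    ∫ w, (w a : ℂ) * F w ∂(gaussianPi ι) = ∫ w, F' w ∂(gaussianPi ι) := by
  have hmp := measurePreserving_update (ι := ι) a
  have hI' : Integrable F' (gaussianPi ι) := integrable_of_measurable_of_norm_le _ hF' hB'
  have hev : Integrable (fun w : ι → ℝ => w a) (gaussianPi ι) :=
    (measurePreserving_eval (fun _ : ι => gaussianReal 0 1) a).integrable_comp_of_integrable
      integrable_id_gaussianReal
  have hI : Integrable (fun w => (w a : ℂ) * F w) (gaussianPi ι) :=
    hev.ofReal.mul_bdd hF.aestronglyMeasurable (Eventually.of_forall hB)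
  have h1 : ∀ G : (ι → ℝ) → ℂ, Integrable G (gaussianPi ι) → ∫ w, G w ∂(gaussianPi ι) =
      ∫ w, ∫ t, G (Function.update w a t) ∂(gaussianReal 0 1) ∂(gaussianPi ι) := by
    intro G hG
    rw [← hmp.map_eq] at hG
    have h0 := hG.comp_measurable hmp.measurable
    refine Eq.trans ?_ (integral_prod _ h0)
    conv_lhs => rw [← hmp.map_eq]
    exact integral_map hmp.measurable.aemeasurable hG.aestronglyMeasurable
  rw [h1 _ hI, h1 _ hI']
  congr 1
  ext w
  simp only [Function.update_self]
  exact integral_mul_gaussianReal (hd w) (fun t => hB _) (fun t => hB' _)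

lemma integral_norm_sub_integral_sq_gaussianPi_fin_le (m : ℕ) {f : (Fin m → ℝ) → ℂ}
    (hf : Measurable f) {B : ℝ} (hB : ∀ w, ‖f w‖ ≤ B) {c : ℝ}
    (hc : ∀ w k t, ‖f (Function.update w k t) - f w‖ ≤ c * |t - w k|) :
    ∫ w, ‖f w - ∫ w', f w' ∂(gaussianPi (Fin m))‖ ^ 2 ∂(gaussianPi (Fin m)) ≤ m * c ^ 2 := by
  induction m with
  | zero =>
    have : ∀ w, f w = f 0 := fun w => congrArg f (Subsingleton.elim _ _)
    simp [this]
  | succ m ih =>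
    set γ := gaussianReal 0 1
    set e := MeasurableEquiv.piFinSuccAbove (fun _ : Fin (m + 1) => ℝ) 0 with he
    have hmp : MeasurePreserving e.symm (γ.prod (gaussianPi (Fin m))) (gaussianPi (Fin (m + 1))) :=
      (measurePreserving_piFinSuccAbove (fun _ : Fin (m + 1) => γ) 0).symm
    have hsymm : ∀ t w, e.symm (t, w) = Fin.cons t w := by
      intro t w
      simp [he, MeasurableEquiv.piFinSuccAbove, Fin.insertNthEquiv]
    have hcons : Measurable fun p : (Fin m → ℝ) × ℝ => f (Fin.cons p.2 p.1) := by
      have : (fun p : (Fin m → ℝ) × ℝ => f (Fin.cons p.2 p.1)) = fun p => f (e.symm (p.2, p.1)) := by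
        simp [hsymm]
      rw [this]
      exact hf.comp (e.symm.measurable.comp measurable_swap)
    set g : (Fin m → ℝ) → ℂ := fun w => ∫ t, f (Fin.cons t w) ∂γ with hg
    have hgm : Measurable g := by
      refine StronglyMeasurable.measurable ?_
      exact hcons.stronglyMeasurable.integral_prod_right
    have hgB : ∀ w, ‖g w‖ ≤ B := fun w =>
      norm_integral_le_of_norm_le_of_isProbabilityMeasure γ fun t => hB _
    have hw : ∀ w, Measurable fun t => f (Fin.cons t w) := fun w =>
      hcons.comp (measurable_const.prodMk measurable_id)
    have hgi : ∀ w, Integrable (fun t => f (Fin.cons t w)) γ := fun w =>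
      integrable_of_measurable_of_norm_le γ (hw w) fun t => hB _
    have hgc : ∀ w k t, ‖g (Function.update w k t) - g w‖ ≤ c * |t - w k| := by
      intro w k t
      rw [hg]
      simp only
      rw [← integral_sub (hgi _) (hgi _)]
      refine norm_integral_le_of_norm_le_of_isProbabilityMeasure γ fun s => ?_
      have := hc (Fin.cons s w) k.succ t
      rwa [← Fin.cons_update, Fin.cons_succ] at this
    have hint : ∀ G : (Fin (m + 1) → ℝ) → ℝ, Measurable G → (∃ C, ∀ w, ‖G w‖ ≤ C) →
        ∫ w, G w ∂(gaussianPi (Fin (m + 1))) =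
          ∫ w, ∫ t, G (Fin.cons t w) ∂γ ∂(gaussianPi (Fin m)) := by
      rintro G hG ⟨C, hC⟩
      rw [← hmp.integral_comp e.symm.measurableEmbedding, ← integral_prod_swap, integral_prod]
      · simp [hsymm]
      · exact integrable_of_measurable_of_norm_le _
          (hG.comp (e.symm.measurable.comp measurable_swap)) fun _ => hC _
    have hintC : ∫ w, f w ∂(gaussianPi (Fin (m + 1))) = ∫ w, g w ∂(gaussianPi (Fin m)) := by
      rw [← hmp.integral_comp e.symm.measurableEmbedding, ← integral_prod_swap, integral_prod]
      · simp [hsymm, hg]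
      · exact integrable_of_measurable_of_norm_le _
          (hf.comp (e.symm.measurable.comp measurable_swap)) fun _ => hB _
    rw [hintC]
    set E := ∫ w, g w ∂(gaussianPi (Fin m)) with hE
    have hbd : ∀ {x a : ℂ} {A : ℝ}, ‖x‖ ≤ A → ‖‖x - a‖ ^ 2‖ ≤ (A + ‖a‖) ^ 2 := by
      intro x a A hx
      rw [norm_pow, norm_norm]
      gcongr
      exact (norm_sub_le _ _).trans (add_le_add_left hx _)
    rw [hint _ (by fun_prop) ⟨_, fun w => hbd (hB w)⟩]
    have hc2 : ∀ w, ∫ t, ‖f (Fin.cons t w) - g w‖ ^ 2 ∂γ ≤ c ^ 2 := by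
      intro w
      refine (integral_norm_sub_integral_sq_le γ (hw w) (fun t => hB _) (f (Fin.cons 0 w))).trans ?_
      calc ∫ t, ‖f (Fin.cons t w) - f (Fin.cons 0 w)‖ ^ 2 ∂γ ≤ ∫ t, c ^ 2 * t ^ 2 ∂γ := by
            refine integral_mono_of_nonneg (Eventually.of_forall fun t => by positivity)
              (integrable_sq_gaussianReal.const_mul _) (Eventually.of_forall fun t => ?_)
            have := hc (Fin.cons 0 w) 0 t
            rw [Fin.update_cons_zero, Fin.cons_zero, sub_zero] at this
            calc ‖f (Fin.cons t w) - f (Fin.cons 0 w)‖ ^ 2 ≤ (c * |t|) ^ 2 := by gcongr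
              _ = c ^ 2 * t ^ 2 := by rw [mul_pow, sq_abs]
        _ = c ^ 2 := by rw [integral_const_mul, integral_sq_gaussianReal, mul_one]
    calc ∫ w, ∫ t, ‖f (Fin.cons t w) - E‖ ^ 2 ∂γ ∂(gaussianPi (Fin m))
        = ∫ w, (∫ t, ‖f (Fin.cons t w) - g w‖ ^ 2 ∂γ + ‖g w - E‖ ^ 2) ∂(gaussianPi (Fin m)) := by
          congr 1; ext w
          exact integral_norm_sub_sq_eq γ (hw w) (fun t => hB _) E
      _ ≤ ∫ w, (c ^ 2 + ‖g w - E‖ ^ 2) ∂(gaussianPi (Fin m)) := by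
          refine integral_mono_of_nonneg (Eventually.of_forall fun w => ?_) ?_
            (Eventually.of_forall fun w => ?_)
          · exact add_nonneg (integral_nonneg fun _ => by positivity) (by positivity)
          · exact (integrable_const _).add (integrable_of_measurable_of_norm_le _ (by fun_prop)
              fun w => hbd (hgB w))
          · exact add_le_add_left (hc2 w) _
      _ = c ^ 2 + ∫ w, ‖g w - E‖ ^ 2 ∂(gaussianPi (Fin m)) := by
          rw [integral_add (integrable_const _) (integrable_of_measurable_of_norm_le _ (by fun_prop)
              fun w => hbd (hgB w))]
          simp
      _ ≤ c ^ 2 + m * c ^ 2 := by gcongr; exact ih hgm hgB hgc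
      _ = _ := by push_cast; ring

/-- The Efron–Stein inequality for bounded functions, Lipschitz in each coordinate. -/
theorem integral_norm_sub_integral_sq_gaussianPi_le [DecidableEq ι] {f : (ι → ℝ) → ℂ}
    (hf : Measurable f) {B : ℝ} (hB : ∀ w, ‖f w‖ ≤ B) {c : ℝ}
    (hc : ∀ w k t, ‖f (Function.update w k t) - f w‖ ≤ c * |t - w k|) :
    ∫ w, ‖f w - ∫ w', f w' ∂(gaussianPi ι)‖ ^ 2 ∂(gaussianPi ι) ≤ Fintype.card ι * c ^ 2 := by
  set e := (Fintype.equivFin ι).symm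
  have hmp := measurePreserving_piCongrLeft (fun _ : ι => gaussianReal 0 1) e
  set E := MeasurableEquiv.piCongrLeft (fun _ : ι => ℝ) e with hE
  have hmp' : MeasurePreserving E (gaussianPi (Fin (Fintype.card ι))) (gaussianPi ι) := hmp
  have hEapp : ∀ w i, E w i = w (e.symm i) := by
    intro w i
    obtain ⟨j, rfl⟩ := e.surjective i
    rw [e.symm_apply_apply]
    exact MeasurableEquiv.piCongrLeft_apply_apply ..
  have h := integral_norm_sub_integral_sq_gaussianPi_fin_le (Fintype.card ι) (f := fun w => f (E w))
    (hf.comp E.measurable) (fun w => hB _) (c := c) ?_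
  · rw [hmp'.integral_comp E.measurableEmbedding f,
      hmp'.integral_comp E.measurableEmbedding (fun w => ‖f w - ∫ w', f w' ∂(gaussianPi ι)‖ ^ 2)] at h
    exact h
  · intro w k t
    have h1 : E (Function.update w k t) = Function.update (E w) (e k) t := by
      ext i
      rw [hEapp]
      by_cases hi : i = e k
      · subst hi; simp
      · rw [Function.update_of_ne hi, Function.update_of_ne, hEapp]
        rintro rfl; simp at hi
    have h2 := hc (E w) (e k) t
    rwa [← h1, hEapp, e.symm_apply_apply] at h2

end GaussianAnalysis

section ProfiledWigner

open ProbabilityTheory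

variable {n : ℕ}

/-- The symmetric matrix with entries `s i * s j * (w (i, j) + w (j, i)) / √n`. -/
noncomputable def profiledMatrix (s : Fin n → ℝ) (w : Fin n × Fin n → ℝ) :
    Matrix (Fin n) (Fin n) ℝ :=
  Matrix.of fun i j => s i * s j * (w (i, j) + w (j, i)) / √n

lemma profiledMatrix_apply (s : Fin n → ℝ) (w : Fin n × Fin n → ℝ) (i j : Fin n) :
    profiledMatrix s w i j = s i * s j * (w (i, j) + w (j, i)) / √n := rfl

lemma isSymm_profiledMatrix (s : Fin n → ℝ) (w : Fin n × Fin n → ℝ) :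
    (profiledMatrix s w).IsSymm := by
  ext i j
  simp only [Matrix.transpose_apply, profiledMatrix_apply]
  ring

lemma continuous_profiledMatrix (s : Fin n → ℝ) : Continuous (profiledMatrix s) := by
  refine continuous_matrix fun i j => ?_
  simp only [profiledMatrix_apply]
  fun_prop

/-- The resolvent of `profiledMatrix`. -/
noncomputable def profiledResolvent (s : Fin n → ℝ) (z : ℂ) (w : Fin n × Fin n → ℝ) :
    Matrix (Fin n) (Fin n) ℂ :=
  realResolvent (profiledMatrix s w) z

lemma profiledMatrix_update (s : Fin n → ℝ) (w : Fin n × Fin n → ℝ) (a b : Fin n) (t : ℝ) :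
    profiledMatrix s (Function.update w (a, b) t) = profiledMatrix s w +
      ((t - w (a, b)) * (s a * s b / √n)) • (Matrix.single a b 1 + Matrix.single b a 1) := by
  have hu : ∀ i j, Function.update w (a, b) t (i, j) = w (i, j) +
      (t - w (a, b)) * (Matrix.single a b (1 : ℝ) i j) := by
    intro i j
    by_cases h : (i, j) = (a, b)
    · obtain ⟨rfl, rfl⟩ := Prod.mk.inj h
      simp
    · rw [Function.update_of_ne h, Matrix.single_apply_of_ne]
      · simp
      · rintro ⟨rfl, rfl⟩; exact h rfl
  have hs : ∀ i j, Matrix.single a b (1 : ℝ) i j * (s i * s j)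
      = Matrix.single a b (1 : ℝ) i j * (s a * s b) := by
    intro i j
    by_cases h : a = i ∧ b = j
    · obtain ⟨rfl, rfl⟩ := h; rfl
    · rw [Matrix.single_apply_of_ne _ _ _ _ _ h]; simp
  ext i j
  simp only [profiledMatrix_apply, Matrix.add_apply, Matrix.smul_apply, hu, smul_eq_mul]
  have e1 := hs i j
  have e2 := hs j i
  have e3 : Matrix.single b a (1 : ℝ) i j = Matrix.single a b (1 : ℝ) j i := by
    rw [← Matrix.transpose_single]; rfl
  rw [e3]
  linear_combination ((t - w (a, b)) / √n) * (e1 + e2)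

lemma mul_single_add_single_mul (A B : Matrix (Fin n) (Fin n) ℂ) (a b i j : Fin n) :
    (A * (Matrix.single a b (1 : ℂ) + Matrix.single b a 1) * B : Matrix _ _ ℂ) i j = A i a * B b j + A i b * B a j := by
  rw [mul_add, add_mul, Matrix.add_apply]
  have : ∀ a b : Fin n, (A * Matrix.single a b (1 : ℂ) * B : Matrix _ _ ℂ) i j = A i a * B b j := by
    intro a b
    rw [Matrix.mul_apply, Finset.sum_eq_single b]
    · simp
    · intro k _ hk
      rw [Matrix.mul_single_apply_of_ne (hbj := hk), zero_mul]
    · simp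
  rw [this, this]

lemma profiledResolvent_update_sub {z : ℂ} (hz : 0 < z.im) (s : Fin n → ℝ)
    (w : Fin n × Fin n → ℝ) (a b i j : Fin n) (t : ℝ) :
    profiledResolvent s z (Function.update w (a, b) t) i j - profiledResolvent s z w i j =
      -(((t - w (a, b)) * (s a * s b / √n) : ℝ) : ℂ) *
      (profiledResolvent s z (Function.update w (a, b) t) i a * profiledResolvent s z w b j
      + profiledResolvent s z (Function.update w (a, b) t) i b * profiledResolvent s z w a j) := by
  rw [← Matrix.sub_apply, profiledResolvent, profiledResolvent,
    realResolvent_sub_realResolvent (isSymm_profiledMatrix _ _) (isSymm_profiledMatrix _ _) hz,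
    ← mul_single_add_single_mul]
  have : (profiledMatrix s w - profiledMatrix s (Function.update w (a, b) t)).map Complex.ofReal
      = -(((t - w (a, b)) * (s a * s b / √n) : ℝ) : ℂ) •
        (Matrix.single a b (1 : ℂ) + Matrix.single b a 1) := by
    rw [profiledMatrix_update]
    ext i j
    simp only [Matrix.map_apply, Matrix.sub_apply, Matrix.add_apply, Matrix.smul_apply,
      Matrix.single_apply, smul_eq_mul]
    split_ifs <;> push_cast <;> ring
  rw [this, Matrix.mul_smul, Matrix.smul_mul, Matrix.smul_apply, smul_eq_mul]

lemma continuous_profiledResolvent {z : ℂ} (hz : 0 < z.im) (s : Fin n → ℝ) :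
    Continuous (profiledResolvent s z) :=
  continuous_realResolvent (continuous_profiledMatrix s) (isSymm_profiledMatrix s) hz

lemma continuous_profiledResolvent_apply {z : ℂ} (hz : 0 < z.im) (s : Fin n → ℝ) (i j : Fin n) :
    Continuous fun w => profiledResolvent s z w i j :=
  (continuous_profiledResolvent hz s).matrix_elem i j

lemma norm_profiledResolvent_le {z : ℂ} (hz : 0 < z.im) (s : Fin n → ℝ) (w : Fin n × Fin n → ℝ)
    (i j : Fin n) : ‖profiledResolvent s z w i j‖ ≤ 1 / z.im :=
  norm_realResolvent_le (isSymm_profiledMatrix _ _) hz i j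

lemma profiledResolvent_symm (s : Fin n → ℝ) (z : ℂ) (w : Fin n × Fin n → ℝ) (i j : Fin n) :
    profiledResolvent s z w i j = profiledResolvent s z w j i :=
  realResolvent_symm (isSymm_profiledMatrix _ _) z i j

lemma hasDerivAt_profiledResolvent {z : ℂ} (hz : 0 < z.im) (s : Fin n → ℝ)
    (w : Fin n × Fin n → ℝ) (a b i j : Fin n) (t : ℝ) :
    HasDerivAt (fun u => profiledResolvent s z (Function.update w (a, b) u) i j)
      (-((s a * s b / √n : ℝ) : ℂ) *
      (profiledResolvent s z (Function.update w (a, b) t) i a *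
        profiledResolvent s z (Function.update w (a, b) t) b j
      + profiledResolvent s z (Function.update w (a, b) t) i b *
        profiledResolvent s z (Function.update w (a, b) t) a j)) t := by
  rw [hasDerivAt_iff_tendsto_slope]
  have hcont : ∀ k l, Continuous fun u => profiledResolvent s z (Function.update w (a, b) u) k l :=
    fun k l => (continuous_profiledResolvent_apply hz s k l).comp
      (continuous_const.update (a, b) continuous_id)
  have hlim : Tendsto (fun u => -((s a * s b / √n : ℝ) : ℂ) *
      (profiledResolvent s z (Function.update w (a, b) u) i a *
        profiledResolvent s z (Function.update w (a, b) t) b j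
      + profiledResolvent s z (Function.update w (a, b) u) i b *
        profiledResolvent s z (Function.update w (a, b) t) a j)) (nhds t) (nhds _) :=
    Continuous.tendsto (by have := hcont i a; have := hcont i b; fun_prop) t
  refine (hlim.mono_left nhdsWithin_le_nhds).congr' ?_
  filter_upwards [self_mem_nhdsWithin] with u hu
  have hut : ((u : ℂ) - t) ≠ 0 := by
    rw [← Complex.ofReal_sub]
    exact Complex.ofReal_ne_zero.2 (sub_ne_zero.2 hu)
  have h := profiledResolvent_update_sub hz s (Function.update w (a, b) t) a b i j u
  rw [Function.update_idem, Function.update_self] at h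
  rw [slope_def_module, h, Complex.real_smul]
  push_cast
  field_simp

lemma sum_norm_profiledResolvent_mul_le {z : ℂ} (hz : 0 < z.im) (s : Fin n → ℝ)
    (w w' : Fin n × Fin n → ℝ) (a b : Fin n) :
    ∑ k, ‖profiledResolvent s z w k a * profiledResolvent s z w' b k‖ ≤ 1 / z.im ^ 2 := by
  have h1 := sum_norm_sq_realResolvent_le (isSymm_profiledMatrix s w) hz a
  have h2 := sum_norm_sq_realResolvent_le (isSymm_profiledMatrix s w') hz b
  calc ∑ k, ‖profiledResolvent s z w k a * profiledResolvent s z w' b k‖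
      ≤ ∑ k, (‖profiledResolvent s z w k a‖ ^ 2 + ‖profiledResolvent s z w' k b‖ ^ 2) / 2 := by
        refine Finset.sum_le_sum fun k _ => ?_
        rw [profiledResolvent_symm s z w' b k, norm_mul]
        nlinarith [sq_nonneg (‖profiledResolvent s z w k a‖ - ‖profiledResolvent s z w' k b‖)]
    _ = (∑ k, ‖profiledResolvent s z w k a‖ ^ 2 + ∑ k, ‖profiledResolvent s z w' k b‖ ^ 2) / 2 := by
        rw [← Finset.sum_div, Finset.sum_add_distrib]
    _ ≤ _ := by
        have h1' : ∑ k, ‖profiledResolvent s z w k a‖ ^ 2 ≤ 1 / z.im ^ 2 := h1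
        have h2' : ∑ k, ‖profiledResolvent s z w' k b‖ ^ 2 ≤ 1 / z.im ^ 2 := h2
        linarith

/-- The normalized weighted trace of the resolvent. -/
noncomputable def weightedTrace (u : Fin n → ℝ) (s : Fin n → ℝ) (z : ℂ) (w : Fin n × Fin n → ℝ) :
    ℂ :=
  (n : ℂ)⁻¹ * ∑ k, (u k : ℂ) * profiledResolvent s z w k k

lemma continuous_weightedTrace {z : ℂ} (hz : 0 < z.im) (u s : Fin n → ℝ) :
    Continuous (weightedTrace u s z) := by
  unfold weightedTrace
  have := fun k => continuous_profiledResolvent_apply hz s k k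
  fun_prop

lemma norm_weightedTrace_le {z : ℂ} (hz : 0 < z.im) (hn : n ≠ 0) {u : Fin n → ℝ} {U : ℝ}
    (hu : ∀ k, |u k| ≤ U) (s : Fin n → ℝ) (w : Fin n × Fin n → ℝ) :
    ‖weightedTrace u s z w‖ ≤ U / z.im := by
  have hn' : (0 : ℝ) < n := by positivity
  rw [weightedTrace, norm_mul, norm_inv, Complex.norm_natCast, inv_mul_le_iff₀ hn']
  calc ‖∑ k, (u k : ℂ) * profiledResolvent s z w k k‖ ≤ ∑ _k : Fin n, U * (1 / z.im) := by
        refine norm_sum_le_of_le _ fun k _ => ?_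
        rw [norm_mul, Complex.norm_real]
        exact mul_le_mul (hu k) (norm_profiledResolvent_le hz s w k k) (norm_nonneg _)
          ((abs_nonneg _).trans (hu k))
    _ = n * (U / z.im) := by
        rw [Finset.sum_const, Finset.card_univ, Fintype.card_fin, nsmul_eq_mul, mul_one_div]

lemma norm_weightedTrace_update_sub_le {z : ℂ} (hz : 0 < z.im) {u s : Fin n → ℝ}
    {U M : ℝ} (hu : ∀ k, |u k| ≤ U) (hs : ∀ k, s k ^ 2 ≤ M) (w : Fin n × Fin n → ℝ)
    (p : Fin n × Fin n) (t : ℝ) :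
    ‖weightedTrace u s z (Function.update w p t) - weightedTrace u s z w‖
      ≤ ((n : ℝ)⁻¹ * (M / √n) * (U * (2 / z.im ^ 2))) * |t - w p| := by
  obtain ⟨a, b⟩ := p
  have hM : |s a * s b| ≤ M := by
    rw [abs_le]
    constructor <;> nlinarith [sq_nonneg (s a - s b), sq_nonneg (s a + s b), hs a, hs b]
  have hM0 : 0 ≤ M := (abs_nonneg _).trans hM
  set R := profiledResolvent s z w with hR
  set R' := profiledResolvent s z (Function.update w (a, b) t) with hR'
  rw [weightedTrace, weightedTrace, ← mul_sub, ← Finset.sum_sub_distrib]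
  have h1 : ∀ k, (u k : ℂ) * R' k k - (u k : ℂ) * R k k
      = -(((t - w (a, b)) * (s a * s b / √n) : ℝ) : ℂ) *
        ((u k : ℂ) * (R' k a * R b k + R' k b * R a k)) := by
    intro k
    rw [← mul_sub, hR, hR', profiledResolvent_update_sub hz]
    ring
  rw [Finset.sum_congr rfl fun k _ => h1 k, ← Finset.mul_sum, norm_mul, norm_mul, norm_inv,
    Complex.norm_natCast, norm_neg, Complex.norm_real, norm_mul, Real.norm_eq_abs, Real.norm_eq_abs]
  have h2 : ‖∑ k, (u k : ℂ) * (R' k a * R b k + R' k b * R a k)‖ ≤ U * (2 / z.im ^ 2) := by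
    have hU : 0 ≤ U := (abs_nonneg _).trans (hu a)
    calc _ ≤ ∑ k, U * (‖R' k a * R b k‖ + ‖R' k b * R a k‖) := by
          refine norm_sum_le_of_le _ fun k _ => ?_
          rw [norm_mul, Complex.norm_real]
          gcongr
          · exact hu k
          · exact norm_add_le _ _
      _ = U * (∑ k, ‖R' k a * R b k‖ + ∑ k, ‖R' k b * R a k‖) := by
          rw [← Finset.mul_sum, Finset.sum_add_distrib]
      _ ≤ U * (1 / z.im ^ 2 + 1 / z.im ^ 2) := by
          gcongr
          · exact sum_norm_profiledResolvent_mul_le hz s _ _ a b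
          · exact sum_norm_profiledResolvent_mul_le hz s _ _ b a
      _ = _ := by ring
  have h3 : |s a * s b / √n| ≤ M / √n := by
    rw [abs_div, abs_of_nonneg (Real.sqrt_nonneg _)]
    gcongr
  calc (n : ℝ)⁻¹ * (|t - w (a, b)| * |s a * s b / √n| *
        ‖∑ k, (u k : ℂ) * (R' k a * R b k + R' k b * R a k)‖)
      ≤ (n : ℝ)⁻¹ * (|t - w (a, b)| * (M / √n) * (U * (2 / z.im ^ 2))) := by gcongr
    _ = _ := by ring

lemma integral_norm_weightedTrace_sub_sq_le {z : ℂ} (hz : 0 < z.im) (hn : n ≠ 0) {u s : Fin n → ℝ}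
    {U M : ℝ} (hu : ∀ k, |u k| ≤ U) (hs : ∀ k, s k ^ 2 ≤ M) :
    ∫ w, ‖weightedTrace u s z w - ∫ w', weightedTrace u s z w' ∂(gaussianPi _)‖ ^ 2 ∂(gaussianPi _)
      ≤ (2 * U * M / z.im ^ 2) ^ 2 / n := by
  have hn' : (n : ℝ) ≠ 0 := by positivity
  refine (integral_norm_sub_integral_sq_gaussianPi_le (continuous_weightedTrace hz u s).measurable
    (norm_weightedTrace_le hz hn hu s) (norm_weightedTrace_update_sub_le hz hu hs)).trans
    (le_of_eq ?_)
  have hsq : √(n : ℝ) ^ 2 = n := Real.sq_sqrt (Nat.cast_nonneg n)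
  rw [Fintype.card_prod, Fintype.card_fin]
  push_cast
  have : ((n : ℝ)⁻¹ * (M / √n) * (U * (2 / z.im ^ 2))) ^ 2
      = (2 * U * M / z.im ^ 2) ^ 2 / (n ^ 2 * √(n : ℝ) ^ 2) := by ring
  rw [this, hsq]
  field_simp

end ProfiledWigner

section LoopEquation

open ProbabilityTheory

lemma integral_le_sqrt_integral_sq {α : Type*} [MeasurableSpace α] (μ : Measure α)
    [IsProbabilityMeasure μ] {f : α → ℝ} (hf : Integrable f μ)
    (hf2 : Integrable (fun x => f x ^ 2) μ) : ∫ x, f x ∂μ ≤ √(∫ x, f x ^ 2 ∂μ) := by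
  refine Real.le_sqrt_of_sq_le ?_
  set c := ∫ x, f x ∂μ with hc
  have h0 : 0 ≤ ∫ x, (f x - c) ^ 2 ∂μ := integral_nonneg fun _ => sq_nonneg _
  have h1 : ∀ x, (f x - c) ^ 2 = f x ^ 2 - 2 * c * f x + c ^ 2 := fun x => by ring
  simp_rw [h1] at h0
  have h2 : Integrable (fun x => f x ^ 2 - 2 * c * f x) μ := hf2.sub (hf.const_mul _)
  rw [integral_add h2 (integrable_const _), integral_sub hf2 (hf.const_mul _),
    integral_const_mul, ← hc] at h0
  simp only [integral_const, probReal_univ, one_smul] at h0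
  linarith [sq c]

variable {n : ℕ}

lemma integrable_of_continuous_of_norm_le {E : Type*} [NormedAddCommGroup E] [MeasurableSpace E]
    [BorelSpace E] [SecondCountableTopology E] {ι : Type*} [Fintype ι] {f : (ι → ℝ) → E}
    (hf : Continuous f) {B : ℝ} (hB : ∀ x, ‖f x‖ ≤ B) : Integrable f (gaussianPi ι) :=
  integrable_of_measurable_of_norm_le _ hf.measurable hB

lemma integrable_eval_gaussianPi {ι : Type*} [Fintype ι] (a : ι) :
    Integrable (fun w : ι → ℝ => w a) (gaussianPi ι) :=
  (measurePreserving_eval (fun _ : ι => gaussianReal 0 1) a).integrable_comp_of_integrable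
    integrable_id_gaussianReal

lemma integrable_profiledResolvent {z : ℂ} (hz : 0 < z.im) (s : Fin n → ℝ) (i j : Fin n) :
    Integrable (fun w => profiledResolvent s z w i j) (gaussianPi _) :=
  integrable_of_continuous_of_norm_le (continuous_profiledResolvent_apply hz s i j)
    fun w => norm_profiledResolvent_le hz s w i j

lemma norm_profiledResolvent_mul_le {z : ℂ} (hz : 0 < z.im) (s : Fin n → ℝ)
    (w : Fin n × Fin n → ℝ) (i j k l : Fin n) :
    ‖profiledResolvent s z w i j * profiledResolvent s z w k l‖ ≤ 1 / z.im * (1 / z.im) := by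
  rw [norm_mul]
  exact mul_le_mul (norm_profiledResolvent_le hz s w i j) (norm_profiledResolvent_le hz s w k l)
    (norm_nonneg _) (by positivity)

lemma integrable_profiledResolvent_mul {z : ℂ} (hz : 0 < z.im) (s : Fin n → ℝ) (i j k l : Fin n) :
    Integrable (fun w => profiledResolvent s z w i j * profiledResolvent s z w k l)
      (gaussianPi _) :=
  integrable_of_continuous_of_norm_le ((continuous_profiledResolvent_apply hz s i j).mul
    (continuous_profiledResolvent_apply hz s k l)) (B := 1 / z.im * (1 / z.im))
    fun w => norm_profiledResolvent_mul_le hz s w i j k l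

lemma integrable_eval_mul_profiledResolvent {z : ℂ} (hz : 0 < z.im) (s : Fin n → ℝ)
    (p : Fin n × Fin n) (i j : Fin n) :
    Integrable (fun w => (w p : ℂ) * profiledResolvent s z w i j) (gaussianPi _) :=
  (integrable_eval_gaussianPi p).ofReal.mul_bdd
    (continuous_profiledResolvent_apply hz s i j).aestronglyMeasurable
    (Eventually.of_forall fun w => norm_profiledResolvent_le hz s w i j)

lemma integral_eval_mul_profiledResolvent {z : ℂ} (hz : 0 < z.im) (s : Fin n → ℝ)
    (a b i j : Fin n) :
    ∫ w, (w (a, b) : ℂ) * profiledResolvent s z w i j ∂(gaussianPi _) =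
      ∫ w, -((s a * s b / √n : ℝ) : ℂ) *
        (profiledResolvent s z w i a * profiledResolvent s z w b j
        + profiledResolvent s z w i b * profiledResolvent s z w a j) ∂(gaussianPi _) := by
  have hc := continuous_profiledResolvent_apply hz s
  refine integral_mul_gaussianPi (a, b) (hc i j).measurable ?_
    (fun w t => hasDerivAt_profiledResolvent hz s w a b i j t)
    (fun w => norm_profiledResolvent_le hz s w i j)
    (B' := |s a * s b / √n| * (1 / z.im * (1 / z.im) + 1 / z.im * (1 / z.im))) ?_
  · have h1 := hc i a; have h2 := hc b j; have h3 := hc i b; have h4 := hc a j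
    exact Continuous.measurable (by fun_prop)
  · intro w
    rw [norm_mul, norm_neg, Complex.norm_real, Real.norm_eq_abs]
    gcongr
    exact (norm_add_le _ _).trans (add_le_add (norm_profiledResolvent_mul_le hz s w _ _ _ _)
      (norm_profiledResolvent_mul_le hz s w _ _ _ _))

lemma integral_profiledMatrix_mul_profiledResolvent {z : ℂ} (hz : 0 < z.im) (s : Fin n → ℝ)
    (i k : Fin n) :
    ∫ w, (profiledMatrix s w i k : ℂ) * profiledResolvent s z w k i ∂(gaussianPi _) =
      -((2 * (s i ^ 2 * s k ^ 2) / n : ℝ) : ℂ) *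
        (∫ w, profiledResolvent s z w k i * profiledResolvent s z w k i ∂(gaussianPi _) +
        ∫ w, profiledResolvent s z w k k * profiledResolvent s z w i i ∂(gaussianPi _)) := by
  have h1 : ∀ w, (profiledMatrix s w i k : ℂ) * profiledResolvent s z w k i =
      ((s i * s k / √n : ℝ) : ℂ) * ((w (i, k) : ℂ) * profiledResolvent s z w k i +
        (w (k, i) : ℂ) * profiledResolvent s z w k i) := by
    intro w
    rw [profiledMatrix_apply]
    push_cast
    ring
  simp_rw [h1]
  rw [integral_const_mul, integral_add (integrable_eval_mul_profiledResolvent hz s _ _ _)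
    (integrable_eval_mul_profiledResolvent hz s _ _ _), integral_eval_mul_profiledResolvent hz,
    integral_eval_mul_profiledResolvent hz, integral_const_mul, integral_const_mul,
    integral_add (integrable_profiledResolvent_mul hz s _ _ _ _)
      (integrable_profiledResolvent_mul hz s _ _ _ _),
    integral_add (integrable_profiledResolvent_mul hz s _ _ _ _)
      (integrable_profiledResolvent_mul hz s _ _ _ _)]
  have hsq : (2 * (s i ^ 2 * s k ^ 2) / n : ℝ)
      = (s i * s k / √n) * (s i * s k / √n) + (s i * s k / √n) * (s k * s i / √n) := by
    have : √(n : ℝ) ^ 2 = n := Real.sq_sqrt (Nat.cast_nonneg n)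
    have e : (s i * s k / √n) * (s i * s k / √n) + (s i * s k / √n) * (s k * s i / √n)
        = 2 * (s i ^ 2 * s k ^ 2) / √(n : ℝ) ^ 2 := by ring
    rw [e, this]
  rw [hsq]
  push_cast
  ring

lemma sum_profiledMatrix_mul_profiledResolvent {z : ℂ} (hz : 0 < z.im) (s : Fin n → ℝ)
    (w : Fin n × Fin n → ℝ) (i : Fin n) :
    ∑ k, (profiledMatrix s w i k : ℂ) * profiledResolvent s z w k i =
      1 + z * profiledResolvent s z w i i := by
  have h := congrFun (congrFun (mul_realResolvent (isSymm_profiledMatrix s w) hz) i) i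
  rw [sub_mul, Matrix.sub_apply, Matrix.one_apply_eq, sub_eq_iff_eq_add] at h
  rw [Matrix.mul_apply] at h
  have e : Matrix.scalar (Fin n) z = z • (1 : Matrix (Fin n) (Fin n) ℂ) := by
    rw [Matrix.smul_one_eq_diagonal]
    rfl
  rw [e, Matrix.smul_mul, one_mul] at h
  exact h

lemma loop_equation {z : ℂ} (hz : 0 < z.im) (s : Fin n → ℝ) (i : Fin n) :
    (z + 2 * (∫ w, weightedTrace (fun k => s k ^ 2) s z w ∂(gaussianPi _)) * (s i ^ 2 : ℝ)) *
      (∫ w, profiledResolvent s z w i i ∂(gaussianPi _)) + 1 =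
    -(((2 * s i ^ 2 / n : ℝ) : ℂ) * ∑ k, ((s k ^ 2 : ℝ) : ℂ) *
      ∫ w, profiledResolvent s z w k i * profiledResolvent s z w k i ∂(gaussianPi _)) -
    ((2 * s i ^ 2 : ℝ) : ℂ) * ∫ w, (weightedTrace (fun k => s k ^ 2) s z w -
      ∫ w', weightedTrace (fun k => s k ^ 2) s z w' ∂(gaussianPi _)) *
        profiledResolvent s z w i i ∂(gaussianPi _) := by
  set E := ∫ w, weightedTrace (fun k => s k ^ 2) s z w ∂(gaussianPi (Fin n × Fin n)) with hE
  have hIR := integrable_profiledResolvent hz s i i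
  have h1 : 1 + z * ∫ w, profiledResolvent s z w i i ∂(gaussianPi _) =
      ∑ k, ∫ w, (profiledMatrix s w i k : ℂ) * profiledResolvent s z w k i ∂(gaussianPi _) := by
    rw [← integral_finsetSum]
    · simp_rw [sum_profiledMatrix_mul_profiledResolvent hz]
      rw [integral_add (integrable_const _) (hIR.const_mul z), integral_const_mul]
      simp
    · intro k _
      have h1 : ∀ w, (profiledMatrix s w i k : ℂ) * profiledResolvent s z w k i =
          ((s i * s k / √n : ℝ) : ℂ) * ((w (i, k) : ℂ) * profiledResolvent s z w k i +
            (w (k, i) : ℂ) * profiledResolvent s z w k i) := by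
        intro w
        rw [profiledMatrix_apply]
        push_cast
        ring
      simp_rw [h1]
      exact ((integrable_eval_mul_profiledResolvent hz s _ _ _).add
        (integrable_eval_mul_profiledResolvent hz s _ _ _)).const_mul _
  simp_rw [integral_profiledMatrix_mul_profiledResolvent hz] at h1
  have h2 : ∫ w, weightedTrace (fun k => s k ^ 2) s z w * profiledResolvent s z w i i
      ∂(gaussianPi _) = (n : ℂ)⁻¹ * ∑ k, ((s k ^ 2 : ℝ) : ℂ) *
        ∫ w, profiledResolvent s z w k k * profiledResolvent s z w i i ∂(gaussianPi _) := by
    simp_rw [weightedTrace, mul_assoc, Finset.sum_mul]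
    rw [integral_const_mul, integral_finsetSum]
    · simp_rw [mul_assoc, integral_const_mul]
    · intro k _
      simp_rw [mul_assoc]
      exact (integrable_profiledResolvent_mul hz s _ _ _ _).const_mul _
  have h3 : ∫ w, (weightedTrace (fun k => s k ^ 2) s z w - E) * profiledResolvent s z w i i
      ∂(gaussianPi _) = (∫ w, weightedTrace (fun k => s k ^ 2) s z w * profiledResolvent s z w i i
      ∂(gaussianPi _)) - E * ∫ w, profiledResolvent s z w i i ∂(gaussianPi _) := by
    simp_rw [sub_mul]
    rw [integral_sub _ (hIR.const_mul E), integral_const_mul]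
    simp_rw [weightedTrace, mul_assoc, Finset.sum_mul]
    refine Integrable.const_mul (integrable_finsetSum _ fun k _ => ?_) _
    simp_rw [mul_assoc]
    exact (integrable_profiledResolvent_mul hz s _ _ _ _).const_mul _
  rw [h3, h2]
  have h4 : ∑ k, -((2 * (s i ^ 2 * s k ^ 2) / n : ℝ) : ℂ) *
        (∫ w, profiledResolvent s z w k i * profiledResolvent s z w k i ∂(gaussianPi _) +
        ∫ w, profiledResolvent s z w k k * profiledResolvent s z w i i ∂(gaussianPi _)) =
      -(((2 * s i ^ 2 / n : ℝ) : ℂ) * ∑ k, ((s k ^ 2 : ℝ) : ℂ) *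
      ∫ w, profiledResolvent s z w k i * profiledResolvent s z w k i ∂(gaussianPi _)) -
      ((2 * s i ^ 2 : ℝ) : ℂ) * ((n : ℂ)⁻¹ * ∑ k, ((s k ^ 2 : ℝ) : ℂ) *
        ∫ w, profiledResolvent s z w k k * profiledResolvent s z w i i ∂(gaussianPi _)) := by
    simp only [Finset.mul_sum, ← Finset.sum_neg_distrib, ← Finset.sum_sub_distrib]
    refine Finset.sum_congr rfl fun k _ => ?_
    push_cast
    ring
  rw [h4] at h1
  push_cast at h1 ⊢
  linear_combination h1

/-- The error term in the approximate self-consistent equation. -/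
noncomputable def loopError (n : ℕ) (M η : ℝ) : ℝ :=
  2 * M ^ 2 / (η ^ 2 * n) + 4 * M ^ 3 / (η ^ 3 * √n)

lemma integral_norm_weightedTrace_sub_le {z : ℂ} (hz : 0 < z.im) (hn : n ≠ 0) {u s : Fin n → ℝ}
    {U M : ℝ} (hU : 0 ≤ U) (hM : 0 ≤ M) (hu : ∀ k, |u k| ≤ U) (hs : ∀ k, s k ^ 2 ≤ M) :
    ∫ w, ‖weightedTrace u s z w - ∫ w', weightedTrace u s z w' ∂(gaussianPi _)‖ ∂(gaussianPi _)
      ≤ 2 * U * M / z.im ^ 2 / √n := by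
  set E := ∫ w', weightedTrace u s z w' ∂(gaussianPi (Fin n × Fin n))
  have hc := continuous_weightedTrace hz u s
  have hb : ∀ w, ‖‖weightedTrace u s z w - E‖‖ ≤ U / z.im + ‖E‖ := fun w => by
    rw [norm_norm]
    exact (norm_sub_le _ _).trans (add_le_add_left (norm_weightedTrace_le hz hn hu s w) _)
  refine (integral_le_sqrt_integral_sq _ (integrable_of_continuous_of_norm_le (by fun_prop) hb)
    (integrable_of_continuous_of_norm_le (by fun_prop) (B := (U / z.im + ‖E‖) ^ 2) fun w => ?_)).trans
    ?_
  · rw [norm_pow]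
    exact pow_le_pow_left₀ (norm_nonneg _) (hb w) 2
  · refine (Real.sqrt_le_sqrt (integral_norm_weightedTrace_sub_sq_le hz hn hu hs)).trans ?_
    rw [Real.sqrt_div (by positivity), Real.sqrt_sq (by positivity)]

lemma norm_loop_equation_le {z : ℂ} (hz : 0 < z.im) (hn : n ≠ 0) {s : Fin n → ℝ} {M : ℝ}
    (hs : ∀ k, s k ^ 2 ≤ M) (i : Fin n) :
    ‖(z + 2 * (∫ w, weightedTrace (fun k => s k ^ 2) s z w ∂(gaussianPi _)) * (s i ^ 2 : ℝ)) *
      (∫ w, profiledResolvent s z w i i ∂(gaussianPi _)) + 1‖ ≤ loopError n M z.im := by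
  have hn' : (0 : ℝ) < n := by positivity
  have hM0 : 0 ≤ M := (sq_nonneg _).trans (hs i)
  have hs' : ∀ k, |s k ^ 2| ≤ M := fun k => by rw [abs_of_nonneg (sq_nonneg _)]; exact hs k
  rw [loop_equation hz]
  set E := ∫ w, weightedTrace (fun k => s k ^ 2) s z w ∂(gaussianPi (Fin n × Fin n)) with hE
  refine (norm_sub_le _ _).trans (add_le_add ?_ ?_)
  · rw [norm_neg, norm_mul, Complex.norm_real, Real.norm_eq_abs, abs_of_nonneg (by positivity)]
    have h1 : ‖∑ k, ((s k ^ 2 : ℝ) : ℂ) *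
        ∫ w, profiledResolvent s z w k i * profiledResolvent s z w k i ∂(gaussianPi _)‖ ≤
        M * (1 / z.im ^ 2) := by
      calc _ ≤ ∑ k, M * ∫ w, ‖profiledResolvent s z w k i * profiledResolvent s z w i k‖
              ∂(gaussianPi _) := by
            refine norm_sum_le_of_le _ fun k _ => ?_
            rw [norm_mul, Complex.norm_real]
            simp_rw [profiledResolvent_symm s z _ i k]
            gcongr
            · exact hs' k
            · exact norm_integral_le_integral_norm _
        _ = M * ∫ w, ∑ k, ‖profiledResolvent s z w k i * profiledResolvent s z w i k‖
              ∂(gaussianPi _) := by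
            rw [← Finset.mul_sum, integral_finsetSum]
            exact fun k _ => (integrable_profiledResolvent_mul hz s _ _ _ _).norm
        _ ≤ M * ∫ w, 1 / z.im ^ 2 ∂(gaussianPi (Fin n × Fin n)) := by
            gcongr ?_ * ?_
            refine integral_mono_of_nonneg (Eventually.of_forall fun w => by positivity)
              (integrable_const _) (Eventually.of_forall fun w => ?_)
            exact sum_norm_profiledResolvent_mul_le hz s w w i i
        _ = _ := by simp
    calc _ ≤ 2 * M / n * (M * (1 / z.im ^ 2)) := by gcongr; exact hs i
      _ = _ := by ring
  · rw [norm_mul, Complex.norm_real, Real.norm_eq_abs, abs_of_nonneg (by positivity)]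
    have h1 : ‖∫ w, (weightedTrace (fun k => s k ^ 2) s z w - E) *
        profiledResolvent s z w i i ∂(gaussianPi _)‖ ≤ (2 * M * M / z.im ^ 2 / √n) * (1 / z.im) := by
      calc _ ≤ ∫ w, ‖weightedTrace (fun k => s k ^ 2) s z w - E‖ * (1 / z.im) ∂(gaussianPi _) := by
            refine (norm_integral_le_integral_norm _).trans (integral_mono_of_nonneg
              (Eventually.of_forall fun w => norm_nonneg _) ?_ (Eventually.of_forall fun w => ?_))
            · refine Integrable.mul_const ?_ _
              have hc := continuous_weightedTrace hz (fun k => s k ^ 2) s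
              refine integrable_of_continuous_of_norm_le (B := M / z.im + ‖E‖) (by fun_prop)
                fun w => ?_
              rw [norm_norm]
              exact (norm_sub_le _ _).trans
                (add_le_add_left (norm_weightedTrace_le hz hn hs' s w) _)
            · simp only [norm_mul]
              gcongr
              exact norm_profiledResolvent_le hz s w i i
        _ ≤ _ := by
            rw [integral_mul_const]
            gcongr
            exact integral_norm_weightedTrace_sub_le hz hn hM0 hM0 hs' hs
    calc _ ≤ 2 * M * ((2 * M * M / z.im ^ 2 / √n) * (1 / z.im)) := by gcongr; exact hs i
      _ = _ := by field_simp; ring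

lemma im_le_norm_add_mul {z g : ℂ} (hg : 0 ≤ g.im) {t : ℝ} (ht : 0 ≤ t) :
    z.im ≤ ‖z + g * t‖ := by
  refine le_trans ?_ ((le_abs_self _).trans (Complex.abs_im_le_norm _))
  simp only [Complex.add_im, Complex.mul_im, Complex.ofReal_re, Complex.ofReal_im, mul_zero,
    zero_add]
  nlinarith [mul_nonneg hg ht]

theorem exists_approx_selfConsistent {z : ℂ} (hz : 0 < z.im) (hn : n ≠ 0) {s : Fin n → ℝ} {M : ℝ}
    (hM0 : 0 ≤ M) (hs : ∀ k, s k ^ 2 ≤ M) :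
    ∃ g : ℂ, 0 ≤ g.im ∧ ‖g‖ ≤ 2 * M / z.im ∧
      ‖g + 2 * ((n : ℂ)⁻¹ * ∑ i, ((s i ^ 2 : ℝ) : ℂ) / (z + g * (s i ^ 2 : ℝ)))‖
        ≤ 2 * M * (loopError n M z.im / z.im) ∧
      ∫ w, ‖weightedTrace 1 s z w + (n : ℂ)⁻¹ * ∑ i, 1 / (z + g * (s i ^ 2 : ℝ))‖ ∂(gaussianPi _)
        ≤ 2 * M / z.im ^ 2 / √n + loopError n M z.im / z.im := by
  have hn' : (0 : ℝ) < n := by positivity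
  have hs' : ∀ k, |s k ^ 2| ≤ M := fun k => by rw [abs_of_nonneg (sq_nonneg _)]; exact hs k
  set E := ∫ w, weightedTrace (fun k => s k ^ 2) s z w ∂(gaussianPi (Fin n × Fin n)) with hE
  have hItr : ∀ u : Fin n → ℝ, ∫ w, weightedTrace u s z w ∂(gaussianPi _) =
      (n : ℂ)⁻¹ * ∑ k, (u k : ℂ) * ∫ w, profiledResolvent s z w k k ∂(gaussianPi _) := by
    intro u
    simp_rw [weightedTrace]
    rw [integral_const_mul, integral_finsetSum]
    · simp_rw [integral_const_mul]
    · exact fun k _ => (integrable_profiledResolvent hz s k k).const_mul _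
  have hEim : 0 ≤ E.im := by
    have hnn : ∀ w, 0 ≤ (weightedTrace (fun k => s k ^ 2) s z w).im := by
      intro w
      rw [weightedTrace, ← Complex.ofReal_natCast, ← Complex.ofReal_inv, Complex.im_ofReal_mul,
        Complex.im_sum]
      refine mul_nonneg (by positivity) (Finset.sum_nonneg fun k _ => ?_)
      rw [Complex.im_ofReal_mul]
      exact mul_nonneg (sq_nonneg _) (im_realResolvent_nonneg (isSymm_profiledMatrix s w) hz k)
    have hi : Integrable (weightedTrace (fun k => s k ^ 2) s z) (gaussianPi (Fin n × Fin n)) :=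
      integrable_of_continuous_of_norm_le (continuous_weightedTrace hz _ s)
        (norm_weightedTrace_le hz hn hs' s)
    have := integral_im (𝕜 := ℂ) hi
    exact (integral_nonneg hnn).trans_eq this
  have hgim : 0 ≤ (2 * E).im := by
    rw [show (2 : ℂ) = ((2 : ℝ) : ℂ) by norm_num, Complex.im_ofReal_mul]; positivity
  have hR : ∀ i, ‖(∫ w, profiledResolvent s z w i i ∂(gaussianPi _)) +
      1 / (z + 2 * E * (s i ^ 2 : ℝ))‖ ≤ loopError n M z.im / z.im := by
    intro i
    have h1 := norm_loop_equation_le hz hn hs i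
    have h2 := im_le_norm_add_mul (z := z) hgim (sq_nonneg (s i))
    have h3 : z + 2 * E * (s i ^ 2 : ℝ) ≠ 0 := norm_pos_iff.1 (hz.trans_le h2)
    rw [le_div_iff₀ hz]
    refine le_trans ?_ h1
    have h4 : (z + 2 * E * (s i ^ 2 : ℝ)) * (∫ w, profiledResolvent s z w i i ∂(gaussianPi _)) + 1
        = ((∫ w, profiledResolvent s z w i i ∂(gaussianPi _)) + 1 / (z + 2 * E * (s i ^ 2 : ℝ))) *
          (z + 2 * E * (s i ^ 2 : ℝ)) := by
      rw [one_div]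
      linear_combination -inv_mul_cancel₀ h3
    rw [h4, norm_mul]
    gcongr
  have hsum : ∀ (u : Fin n → ℝ) (U : ℝ), (∀ k, |u k| ≤ U) →
      ‖(n : ℂ)⁻¹ * ∑ k, (u k : ℂ) * ((∫ w, profiledResolvent s z w k k ∂(gaussianPi _)) +
        1 / (z + 2 * E * (s k ^ 2 : ℝ)))‖ ≤ U * (loopError n M z.im / z.im) := by
    intro u U hu
    rw [norm_mul, norm_inv, Complex.norm_natCast, inv_mul_le_iff₀ hn']
    calc _ ≤ ∑ _k : Fin n, U * (loopError n M z.im / z.im) := by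
          refine norm_sum_le_of_le _ fun k _ => ?_
          rw [norm_mul, Complex.norm_real]
          exact mul_le_mul (hu k) (hR k) (norm_nonneg _) ((abs_nonneg _).trans (hu k))
      _ = _ := by rw [Finset.sum_const, Finset.card_univ, Fintype.card_fin, nsmul_eq_mul]
  refine ⟨2 * E, hgim, ?_, ?_, ?_⟩
  · rw [norm_mul, Complex.norm_ofNat, mul_div_assoc]
    gcongr
    exact norm_integral_le_of_norm_le_of_isProbabilityMeasure _
      (norm_weightedTrace_le hz hn hs' s)
  · have h1 := hsum _ M hs'
    have h2 : 2 * E + 2 * ((n : ℂ)⁻¹ * ∑ i, ((s i ^ 2 : ℝ) : ℂ) / (z + 2 * E * (s i ^ 2 : ℝ)))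
        = 2 * ((n : ℂ)⁻¹ * ∑ k, ((s k ^ 2 : ℝ) : ℂ) *
          ((∫ w, profiledResolvent s z w k k ∂(gaussianPi _)) +
          1 / (z + 2 * E * (s k ^ 2 : ℝ)))) := by
      have hE' : E = (n : ℂ)⁻¹ * ∑ k, ((s k ^ 2 : ℝ) : ℂ) *
          ∫ w, profiledResolvent s z w k k ∂(gaussianPi _) := hItr _
      simp_rw [mul_add, Finset.sum_add_distrib, mul_one_div]
      linear_combination 2 * hE'
    rw [h2, norm_mul, Complex.norm_ofNat, mul_assoc]
    gcongr
  · have h1 := hsum 1 1 (by simp)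
    simp only [Pi.one_apply, Complex.ofReal_one, one_mul] at h1
    have h2 := integral_norm_weightedTrace_sub_le (u := 1) hz hn zero_le_one hM0 (by simp) hs
    rw [mul_one] at h2
    set E1 := ∫ w, weightedTrace 1 s z w ∂(gaussianPi (Fin n × Fin n)) with hE1
    have hi : Integrable (fun w => ‖weightedTrace 1 s z w - E1‖) (gaussianPi (Fin n × Fin n)) := by
      have hc := continuous_weightedTrace hz 1 s
      refine integrable_of_continuous_of_norm_le (B := 1 / z.im + ‖E1‖) (by fun_prop) fun w => ?_
      rw [norm_norm]
      exact (norm_sub_le _ _).trans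
        (add_le_add_left (norm_weightedTrace_le hz hn (by simp) s w) _)
    calc _ ≤ ∫ w, (‖weightedTrace 1 s z w - E1‖ + loopError n M z.im / z.im)
            ∂(gaussianPi (Fin n × Fin n)) := by
          refine integral_mono_of_nonneg (Eventually.of_forall fun w => norm_nonneg _)
            (hi.add (integrable_const _)) (Eventually.of_forall fun w => ?_)
          have h3 : weightedTrace 1 s z w + (n : ℂ)⁻¹ * ∑ i, 1 / (z + 2 * E * (s i ^ 2 : ℝ))
              = (weightedTrace 1 s z w - E1) + (n : ℂ)⁻¹ * ∑ k,
                ((∫ w, profiledResolvent s z w k k ∂(gaussianPi _)) +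
                1 / (z + 2 * E * (s k ^ 2 : ℝ))) := by
            have hE' : E1 = (n : ℂ)⁻¹ * ∑ k, ((1 : ℝ) : ℂ) *
                ∫ w, profiledResolvent s z w k k ∂(gaussianPi _) := hItr _
            simp only [Complex.ofReal_one, one_mul] at hE'
            rw [Finset.sum_add_distrib]
            linear_combination hE'
          simp only [h3]
          exact (norm_add_le _ _).trans (add_le_add_right h1 _)
      _ ≤ _ := by
          rw [integral_add hi (integrable_const _)]
          simp only [integral_const, probReal_univ, one_smul]
          gcongr

end LoopEquation

section Truncation

open ProbabilityTheory

variable {n : ℕ}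

lemma norm_sum_mul_sq_le {ι : Type*} (S : Finset ι) (a : ι → ℝ) (b : ι → ℂ) :
    ‖∑ p ∈ S, (a p : ℂ) * b p‖ ^ 2 ≤ (∑ p ∈ S, a p ^ 2) * ∑ p ∈ S, ‖b p‖ ^ 2 := by
  calc _ ≤ (∑ p ∈ S, |a p| * ‖b p‖) ^ 2 := by
        gcongr
        refine norm_sum_le_of_le _ fun p _ => ?_
        rw [norm_mul, Complex.norm_real, Real.norm_eq_abs]
    _ ≤ (∑ p ∈ S, |a p| ^ 2) * ∑ p ∈ S, ‖b p‖ ^ 2 := Finset.sum_mul_sq_le_sq_mul_sq _ _ _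
    _ = _ := by simp_rw [sq_abs]

lemma sum_norm_sq_realResolvent_mul_le {H H' : Matrix (Fin n) (Fin n) ℝ} (hH : H.IsSymm)
    (hH' : H'.IsSymm) {z : ℂ} (hz : 0 < z.im) :
    ∑ i, ∑ j, ‖(realResolvent H z * realResolvent H' z) i j‖ ^ 2 ≤ n / z.im ^ 4 := by
  rw [Finset.sum_comm]
  calc _ ≤ ∑ _j : Fin n, 1 / z.im ^ 4 := by
        refine Finset.sum_le_sum fun j _ => ?_
        have h1 := sum_norm_sq_realResolvent_mulVec_le hH hz (fun i => realResolvent H' z i j)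
        have h2 := sum_norm_sq_realResolvent_le hH' hz j
        calc _ ≤ _ := h1
          _ ≤ (1 / z.im ^ 2) / z.im ^ 2 := by gcongr
          _ = _ := by rw [div_div]; ring
    _ = _ := by simp [div_eq_mul_inv]

lemma norm_trace_realResolvent_sub_sq_le {H H' : Matrix (Fin n) (Fin n) ℝ} (hH : H.IsSymm)
    (hH' : H'.IsSymm) {z : ℂ} (hz : 0 < z.im) :
    ‖(realResolvent H z).trace - (realResolvent H' z).trace‖ ^ 2 ≤
      (∑ p : Fin n × Fin n, (H' p.1 p.2 - H p.1 p.2) ^ 2) * (n / z.im ^ 4) := by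
  have h1 : (realResolvent H z).trace - (realResolvent H' z).trace =
      ∑ p : Fin n × Fin n, ((H' p.1 p.2 - H p.1 p.2 : ℝ) : ℂ) *
        (realResolvent H' z * realResolvent H z) p.2 p.1 := by
    rw [← Matrix.trace_sub, realResolvent_sub_realResolvent hH hH' hz, mul_assoc,
      Matrix.trace_mul_comm, mul_assoc, Fintype.sum_prod_type]
    rfl
  rw [h1]
  refine (norm_sum_mul_sq_le _ _ _).trans ?_
  gcongr
  rw [Fintype.sum_prod_type, Finset.sum_comm]
  exact sum_norm_sq_realResolvent_mul_le hH' hH hz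

lemma integrable_sq_eval_gaussianPi {ι : Type*} [Fintype ι] (a : ι) :
    Integrable (fun w : ι → ℝ => w a ^ 2) (gaussianPi ι) :=
  (measurePreserving_eval (fun _ : ι => gaussianReal 0 1) a).integrable_comp_of_integrable
    integrable_sq_gaussianReal

lemma integral_sq_eval_gaussianPi {ι : Type*} [Fintype ι] (a : ι) :
    ∫ w : ι → ℝ, w a ^ 2 ∂(gaussianPi ι) = 1 := by
  rw [← integral_sq_gaussianReal,
    ← (measurePreserving_eval (fun _ : ι => gaussianReal 0 1) a).map_eq,
    integral_map (measurable_pi_apply a).aemeasurable (by fun_prop)]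
  rfl

lemma weightedTrace_one_eq (s : Fin n → ℝ) (z : ℂ) (w : Fin n × Fin n → ℝ) :
    weightedTrace 1 s z w = (n : ℂ)⁻¹ * (realResolvent (profiledMatrix s w) z).trace := by
  simp [weightedTrace, Matrix.trace, profiledResolvent]

lemma sum_sq_mul_sub_mul_le {s s' : Fin n → ℝ} (hs' : ∀ i, 0 ≤ s' i) (hss : ∀ i, s' i ≤ s i) :
    ∑ p : Fin n × Fin n, (s' p.1 * s' p.2 - s p.1 * s p.2) ^ 2 ≤
      2 * (∑ i, s i ^ 2) * ∑ i, (s i ^ 2 - s' i ^ 2) := by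
  have h0 : ∀ i, 0 ≤ s i := fun i => (hs' i).trans (hss i)
  have h1 : ∀ i, s' i ^ 2 ≤ s i ^ 2 := fun i => pow_le_pow_left₀ (hs' i) (hss i) 2
  calc _ ≤ ∑ p : Fin n × Fin n, (s p.1 ^ 2 * (s p.2 ^ 2 - s' p.2 ^ 2)
          + s p.2 ^ 2 * (s p.1 ^ 2 - s' p.1 ^ 2)) := by
        refine Finset.sum_le_sum fun p _ => ?_
        have h2 : s' p.1 * s' p.2 ≤ s p.1 * s p.2 :=
          mul_le_mul (hss _) (hss _) (hs' _) (h0 _)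
        have h3 : 0 ≤ s' p.1 * s' p.2 := mul_nonneg (hs' _) (hs' _)
        have h4 := mul_nonneg (sub_nonneg.2 (h1 p.1)) (sub_nonneg.2 (h1 p.2))
        nlinarith [mul_nonneg h3 (sub_nonneg.2 h2)]
    _ = _ := by
        rw [Finset.sum_add_distrib, Fintype.sum_prod_type, Fintype.sum_prod_type]
        rw [Finset.sum_comm (γ := Fin n) (f := fun x y => s y ^ 2 * (s x ^ 2 - s' x ^ 2))]
        simp_rw [← Finset.mul_sum, ← Finset.sum_mul]
        ring

lemma integral_norm_weightedTrace_sub_weightedTrace_le {z : ℂ} (hz : 0 < z.im) (hn : n ≠ 0)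
    {s s' : Fin n → ℝ} (hs' : ∀ i, 0 ≤ s' i) (hss : ∀ i, s' i ≤ s i) :
    ∫ w, ‖weightedTrace 1 s z w - weightedTrace 1 s' z w‖ ∂(gaussianPi _) ≤
      √(8 * ((n : ℝ)⁻¹ * ∑ i, s i ^ 2) * ((n : ℝ)⁻¹ * ∑ i, (s i ^ 2 - s' i ^ 2))) / z.im ^ 2 := by
  have hn' : (0 : ℝ) < n := by positivity
  have hc := continuous_weightedTrace hz 1 s
  have hc' := continuous_weightedTrace hz 1 s'
  have hb : ∀ w, ‖‖weightedTrace 1 s z w - weightedTrace 1 s' z w‖‖ ≤ 1 / z.im + 1 / z.im :=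
    fun w => by
      rw [norm_norm]
      exact (norm_sub_le _ _).trans (add_le_add (norm_weightedTrace_le hz hn (by simp) s w)
        (norm_weightedTrace_le hz hn (by simp) s' w))
  refine (integral_le_sqrt_integral_sq _ (integrable_of_continuous_of_norm_le (by fun_prop) hb)
    (integrable_of_continuous_of_norm_le (by fun_prop) (B := (1 / z.im + 1 / z.im) ^ 2)
      fun w => ?_)).trans ?_
  · rw [norm_pow]
    exact pow_le_pow_left₀ (norm_nonneg _) (hb w) 2
  have hI : ∀ p : Fin n × Fin n, Integrable
      (fun w : Fin n × Fin n → ℝ => 2 * w (p.1, p.2) ^ 2 + 2 * w (p.2, p.1) ^ 2)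
      (gaussianPi _) := fun p => ((integrable_sq_eval_gaussianPi _).const_mul 2).add
        ((integrable_sq_eval_gaussianPi _).const_mul 2)
  have h1 : ∀ w, ‖weightedTrace 1 s z w - weightedTrace 1 s' z w‖ ^ 2 ≤
      (n ^ 2 * z.im ^ 4)⁻¹ * ∑ p : Fin n × Fin n, (s' p.1 * s' p.2 - s p.1 * s p.2) ^ 2 *
        (2 * w (p.1, p.2) ^ 2 + 2 * w (p.2, p.1) ^ 2) := by
    intro w
    have h2 := norm_trace_realResolvent_sub_sq_le (isSymm_profiledMatrix s w)
      (isSymm_profiledMatrix s' w) hz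
    rw [weightedTrace_one_eq, weightedTrace_one_eq, ← mul_sub, norm_mul, mul_pow, norm_inv,
      Complex.norm_natCast]
    have h3 : ∑ p : Fin n × Fin n, (profiledMatrix s' w p.1 p.2 - profiledMatrix s w p.1 p.2) ^ 2
        ≤ (n : ℝ)⁻¹ * ∑ p : Fin n × Fin n, (s' p.1 * s' p.2 - s p.1 * s p.2) ^ 2 *
        (2 * w (p.1, p.2) ^ 2 + 2 * w (p.2, p.1) ^ 2) := by
      rw [Finset.mul_sum]
      refine Finset.sum_le_sum fun p _ => ?_
      rw [profiledMatrix_apply, profiledMatrix_apply, ← sub_div, div_pow,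
        Real.sq_sqrt (Nat.cast_nonneg n), div_eq_inv_mul]
      gcongr
      rw [← sub_mul, mul_pow]
      gcongr
      nlinarith [sq_nonneg (w (p.1, p.2) - w (p.2, p.1))]
    calc _ ≤ (n : ℝ)⁻¹ ^ 2 * (((n : ℝ)⁻¹ * ∑ p : Fin n × Fin n,
          (s' p.1 * s' p.2 - s p.1 * s p.2) ^ 2 *
          (2 * w (p.1, p.2) ^ 2 + 2 * w (p.2, p.1) ^ 2)) * (n / z.im ^ 4)) := by
          gcongr
          exact h2.trans (by gcongr)
      _ = _ := by
          generalize (∑ p : Fin n × Fin n, (s' p.1 * s' p.2 - s p.1 * s p.2) ^ 2 *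
            (2 * w (p.1, p.2) ^ 2 + 2 * w (p.2, p.1) ^ 2)) = S
          field_simp
  have h2 : ∫ w, ‖weightedTrace 1 s z w - weightedTrace 1 s' z w‖ ^ 2 ∂(gaussianPi _) ≤
      (n ^ 2 * z.im ^ 4)⁻¹ * ∑ p : Fin n × Fin n, (s' p.1 * s' p.2 - s p.1 * s p.2) ^ 2 * 4 := by
    refine (integral_mono_of_nonneg (Eventually.of_forall fun w => by positivity) ?_
      (Eventually.of_forall h1)).trans_eq ?_
    · exact (integrable_finsetSum _ fun p _ => (hI p).const_mul _).const_mul _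
    · rw [integral_const_mul, integral_finsetSum _ fun p _ => (hI p).const_mul _]
      congr 1
      refine Finset.sum_congr rfl fun p _ => ?_
      rw [integral_const_mul, integral_add ((integrable_sq_eval_gaussianPi _).const_mul 2)
        ((integrable_sq_eval_gaussianPi _).const_mul 2), integral_const_mul, integral_const_mul,
        integral_sq_eval_gaussianPi, integral_sq_eval_gaussianPi]
      norm_num
  rw [← Finset.sum_mul] at h2
  rw [le_div_iff₀ (by positivity)]
  refine Real.le_sqrt_of_sq_le ?_
  rw [mul_pow, Real.sq_sqrt (integral_nonneg fun _ => by positivity)]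
  calc _ ≤ ((n ^ 2 * z.im ^ 4)⁻¹ * ((2 * (∑ i, s i ^ 2) * ∑ i, (s i ^ 2 - s' i ^ 2)) * 4)) *
        (z.im ^ 2) ^ 2 := by
        gcongr
        refine h2.trans ?_
        gcongr
        exact sum_sq_mul_sub_mul_le hs' hss
    _ = _ := by
        field_simp
        ring

end Truncation

section SelfConsistent

open Topology

variable {σ : Measure ℝ} [IsProbabilityMeasure σ] {a M : ℝ} {z : ℂ}

lemma add_mul_ne_zero_of_im_pos {g : ℂ} (hg : 0 ≤ g.im) {t : ℝ} (ht : 0 ≤ t) (hz : 0 < z.im) :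
    z + g * t ≠ 0 :=
  norm_pos_iff.1 (hz.trans_le (im_le_norm_add_mul hg ht))

lemma norm_div_add_mul_le {g : ℂ} (hg : 0 ≤ g.im) {t : ℝ} (ht : 0 ≤ t) (hz : 0 < z.im) (c : ℂ) :
    ‖c / (z + g * t)‖ ≤ ‖c‖ / z.im := by
  rw [norm_div]
  exact div_le_div_of_nonneg_left (norm_nonneg _) hz (im_le_norm_add_mul hg ht)

lemma integrable_of_ae_mem_Icc {E : Type*} [NormedAddCommGroup E] [MeasurableSpace E]
    [BorelSpace E] [SecondCountableTopology E] (hσ : ∀ᵐ t ∂σ, a ≤ t ∧ t ≤ M) {f : ℝ → E}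
    (hf : Measurable f) {B : ℝ} (hB : ∀ t, a ≤ t → t ≤ M → ‖f t‖ ≤ B) : Integrable f σ :=
  Integrable.of_bound hf.aestronglyMeasurable B (hσ.mono fun t ht => hB t ht.1 ht.2)

lemma integrable_div_add_mul (hσ : ∀ᵐ t ∂σ, a ≤ t ∧ t ≤ M) (ha : 0 < a) (hz : 0 < z.im) {g : ℂ}
    (hg : 0 ≤ g.im) : Integrable (fun t : ℝ => (t : ℂ) / (z + g * t)) σ := by
  refine integrable_of_ae_mem_Icc hσ (by fun_prop) (B := M / z.im) fun t h1 h2 => ?_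
  refine (norm_div_add_mul_le hg (ha.le.trans h1) hz _).trans ?_
  rw [Complex.norm_real, Real.norm_of_nonneg (ha.le.trans h1)]
  gcongr

lemma integrable_inv_add_mul (hσ : ∀ᵐ t ∂σ, a ≤ t ∧ t ≤ M) (ha : 0 < a) (hz : 0 < z.im) {g : ℂ}
    (hg : 0 ≤ g.im) : Integrable (fun t : ℝ => 1 / (z + g * t)) σ := by
  refine integrable_of_ae_mem_Icc hσ (by fun_prop) (B := 1 / z.im) fun t h1 h2 => ?_
  simpa using norm_div_add_mul_le hg (ha.le.trans h1) hz 1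

lemma integrable_pow_div_normSq (hσ : ∀ᵐ t ∂σ, a ≤ t ∧ t ≤ M) (ha : 0 < a) (hz : 0 < z.im) {g : ℂ}
    (hg : 0 ≤ g.im) (k : ℕ) :
    Integrable (fun t : ℝ => t ^ k / ‖z + g * t‖ ^ 2) σ := by
  refine integrable_of_ae_mem_Icc hσ (by fun_prop) (B := M ^ k / z.im ^ 2) fun t h1 h2 => ?_
  have h0 : 0 ≤ t := ha.le.trans h1
  rw [Real.norm_of_nonneg (by positivity)]
  have := im_le_norm_add_mul (z := z) hg h0
  have := h0.trans h2
  gcongr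

/-- The linearised self-consistent equation is a strict contraction at a solution. -/
lemma two_mul_integral_sq_div_lt_one (hσ : ∀ᵐ t ∂σ, a ≤ t ∧ t ≤ M) (ha : 0 < a) (hz : 0 < z.im)
    {g : ℂ} (hg : 0 ≤ g.im) (hgeq : g = -2 * ∫ t : ℝ, (t : ℂ) / (z + g * t) ∂σ) :
    2 * ∫ t : ℝ, t ^ 2 / ‖z + g * t‖ ^ 2 ∂σ < 1 := by
  have hI1 := integrable_pow_div_normSq hσ ha hz hg 1
  have hI2 := integrable_pow_div_normSq hσ ha hz hg 2
  have h1 : g.im = 2 * z.im * (∫ t : ℝ, t ^ 1 / ‖z + g * t‖ ^ 2 ∂σ) +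
      2 * g.im * ∫ t : ℝ, t ^ 2 / ‖z + g * t‖ ^ 2 ∂σ := by
    have h2 := congrArg Complex.im hgeq
    have h3 : (∫ t : ℝ, (t : ℂ) / (z + g * t) ∂σ).im = ∫ t : ℝ, ((t : ℂ) / (z + g * t)).im ∂σ :=
      (integral_im (𝕜 := ℂ) (integrable_div_add_mul hσ ha hz hg)).symm
    have h4 : ∀ t : ℝ, ((t : ℂ) / (z + g * t)).im =
        -(z.im * (t ^ 1 / ‖z + g * t‖ ^ 2) + g.im * (t ^ 2 / ‖z + g * t‖ ^ 2)) := by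
      intro t
      rw [Complex.div_im, ← Complex.normSq_eq_norm_sq]
      simp
      ring
    simp_rw [h4] at h3
    rw [integral_neg, integral_add (hI1.const_mul _) (hI2.const_mul _), integral_const_mul,
      integral_const_mul] at h3
    rw [show (-2 : ℂ) = ((-2 : ℝ) : ℂ) by norm_num, Complex.im_ofReal_mul, h3] at h2
    linarith
  have hB : 0 ≤ ∫ t : ℝ, t ^ 2 / ‖z + g * t‖ ^ 2 ∂σ := integral_nonneg fun _ => by positivity
  have hzn : 0 < ‖z‖ := hz.trans_le ((le_abs_self _).trans (Complex.abs_im_le_norm _))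
  have haM : a ≤ M := by
    obtain ⟨t, ht⟩ := hσ.exists
    exact ht.1.trans ht.2
  have hM : 0 < M := ha.trans_le haM
  have hA : 0 < ∫ t : ℝ, t ^ 1 / ‖z + g * t‖ ^ 2 ∂σ := by
    have h5 : ∫ _t : ℝ, a / (‖z‖ + ‖g‖ * M) ^ 2 ∂σ ≤ ∫ t : ℝ, t ^ 1 / ‖z + g * t‖ ^ 2 ∂σ := by
      refine integral_mono_ae (integrable_const _) hI1 (hσ.mono fun t ht => ?_)
      have h0 : 0 ≤ t := ha.le.trans ht.1
      have h6 : ‖z + g * t‖ ≤ ‖z‖ + ‖g‖ * M := by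
        refine (norm_add_le _ _).trans ?_
        rw [norm_mul, Complex.norm_real, Real.norm_of_nonneg h0]
        gcongr
        exact ht.2
      have h7 := hz.trans_le (im_le_norm_add_mul (z := z) hg h0)
      simp only [pow_one]
      gcongr
      exact ht.1
    simp only [integral_const, probReal_univ, one_smul] at h5
    exact lt_of_lt_of_le (by positivity) h5
  have hzA := mul_pos hz hA
  have hgpos : 0 < g.im := by nlinarith [mul_nonneg hg hB]
  nlinarith

lemma norm_integral_inv_add_mul_le (hσ : ∀ᵐ t ∂σ, a ≤ t ∧ t ≤ M) (ha : 0 < a) (hz : 0 < z.im)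
    {g : ℂ} (hg : 0 ≤ g.im) (hgeq : g = -2 * ∫ t : ℝ, (t : ℂ) / (z + g * t) ∂σ) :
    ‖∫ t : ℝ, 1 / (z + g * t) ∂σ‖ ≤ (1 + 1 / (2 * a ^ 2)) / 2 := by
  have h1 := two_mul_integral_sq_div_lt_one hσ ha hz hg hgeq
  have hI2 := integrable_pow_div_normSq hσ ha hz hg 2
  calc _ ≤ ∫ t : ℝ, ‖1 / (z + g * t)‖ ∂σ := norm_integral_le_integral_norm _
    _ ≤ ∫ t : ℝ, ((1 / a ^ 2) * (t ^ 2 / ‖z + g * t‖ ^ 2) + 1) / 2 ∂σ := by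
        refine integral_mono_ae (integrable_inv_add_mul hσ ha hz hg).norm
          (((hI2.const_mul _).add (integrable_const _)).div_const _) (hσ.mono fun t ht => ?_)
        have h0 : 0 ≤ t := ha.le.trans ht.1
        have h3 : (‖1 / (z + g * t)‖) ^ 2 ≤ (1 / a ^ 2) * (t ^ 2 / ‖z + g * t‖ ^ 2) := by
          rw [norm_div, norm_one, div_pow, one_pow, ← mul_div_assoc]
          gcongr
          rw [one_div, ← div_eq_inv_mul, one_le_div (by positivity)]
          exact pow_le_pow_left₀ ha.le ht.1 2
        simp only
        nlinarith [sq_nonneg (‖1 / (z + g * t)‖ - 1)]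
    _ = ((1 / a ^ 2) * (∫ t : ℝ, t ^ 2 / ‖z + g * t‖ ^ 2 ∂σ) + 1) / 2 := by
        rw [integral_div, integral_add (hI2.const_mul _) (integrable_const _), integral_const_mul]
        simp
    _ ≤ ((1 / a ^ 2) * (1 / 2) + 1) / 2 := by
        gcongr
        linarith
    _ = _ := by
        field_simp
        ring

lemma selfConsistent_unique (hσ : ∀ᵐ t ∂σ, a ≤ t ∧ t ≤ M) (ha : 0 < a) (hz : 0 < z.im)
    {g h : ℂ} (hg : 0 ≤ g.im) (hgeq : g = -2 * ∫ t : ℝ, (t : ℂ) / (z + g * t) ∂σ)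
    (hh : 0 ≤ h.im) (hheq : h = -2 * ∫ t : ℝ, (t : ℂ) / (z + h * t) ∂σ) : g = h := by
  by_contra hne
  have h1 := two_mul_integral_sq_div_lt_one hσ ha hz hg hgeq
  have h2 := two_mul_integral_sq_div_lt_one hσ ha hz hh hheq
  have hIg := integrable_pow_div_normSq hσ ha hz hg 2
  have hIh := integrable_pow_div_normSq hσ ha hz hh 2
  have h3 : g - h = (g - h) * (2 * ∫ t : ℝ, (t : ℂ) ^ 2 / ((z + g * t) * (z + h * t)) ∂σ) := by
    conv_lhs => rw [hgeq, hheq]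
    rw [← mul_sub, ← integral_sub (integrable_div_add_mul hσ ha hz hg)
      (integrable_div_add_mul hσ ha hz hh), ← mul_assoc, ← integral_const_mul,
      ← integral_const_mul]
    refine integral_congr_ae (hσ.mono fun t ht => ?_)
    have h4 := add_mul_ne_zero_of_im_pos hg (ha.le.trans ht.1) hz
    have h5 := add_mul_ne_zero_of_im_pos hh (ha.le.trans ht.1) hz
    simp only
    rw [div_sub_div _ _ h4 h5]
    ring
  have h4 : 2 * ∫ t : ℝ, (t : ℂ) ^ 2 / ((z + g * t) * (z + h * t)) ∂σ = 1 :=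
    (mul_eq_left₀ (sub_ne_zero.2 hne)).1 h3.symm
  have h5 : ‖∫ t : ℝ, (t : ℂ) ^ 2 / ((z + g * t) * (z + h * t)) ∂σ‖ ≤
      ∫ t : ℝ, (t ^ 2 / ‖z + g * t‖ ^ 2 + t ^ 2 / ‖z + h * t‖ ^ 2) / 2 ∂σ := by
    refine norm_integral_le_of_norm_le ((hIg.add hIh).div_const 2) (Eventually.of_forall fun t => ?_)
    rw [norm_div, norm_mul, norm_pow, Complex.norm_real, Real.norm_eq_abs, sq_abs]
    have h6 : ∀ x y : ℝ, t ^ 2 / (x * y) ≤ (t ^ 2 / x ^ 2 + t ^ 2 / y ^ 2) / 2 := by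
      intro x y
      have h7 : t ^ 2 / (x * y) = (t / x) * (t / y) := by rw [div_mul_div_comm, sq]
      rw [h7, ← div_pow, ← div_pow]
      nlinarith [sq_nonneg (t / x - t / y)]
    exact h6 _ _
  rw [integral_div, integral_add hIg hIh] at h5
  have h6 : (1 : ℝ) = 2 * ‖∫ t : ℝ, (t : ℂ) ^ 2 / ((z + g * t) * (z + h * t)) ∂σ‖ := by
    rw [← Complex.norm_ofNat 2, ← norm_mul, h4, norm_one]
  linarith

lemma norm_div_sub_div_le {g h : ℂ} (hg : 0 ≤ g.im) (hh : 0 ≤ h.im) (hz : 0 < z.im) {t : ℝ}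
    (ht : 0 ≤ t) (c : ℂ) :
    ‖c / (z + g * t) - c / (z + h * t)‖ ≤ ‖c‖ * t / z.im ^ 2 * ‖g - h‖ := by
  have h4 := add_mul_ne_zero_of_im_pos hg ht hz
  have h5 := add_mul_ne_zero_of_im_pos hh ht hz
  have h6 := im_le_norm_add_mul (z := z) hg ht
  have h7 := im_le_norm_add_mul (z := z) hh ht
  have h8 : c / (z + g * t) - c / (z + h * t) =
      c * t * (h - g) / ((z + g * t) * (z + h * t)) := by
    rw [div_sub_div _ _ h4 h5]
    ring
  rw [h8, norm_div, norm_mul, norm_mul, norm_mul, Complex.norm_real, Real.norm_of_nonneg ht,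
    norm_sub_rev h g, sq]
  calc _ ≤ ‖c‖ * t * ‖g - h‖ / (z.im * z.im) := by gcongr
    _ = _ := by ring

/-- Stability of the self-consistent equation: approximate solutions with respect to discrete
measures converging to `σ` converge to the exact solution. -/
theorem exists_selfConsistent_limit (hσ : ∀ᵐ t ∂σ, a ≤ t ∧ t ≤ M) (ha : 0 < a) (hz : 0 < z.im)
    {d : ∀ N : ℕ, Fin N → ℝ} (hd0 : ∀ N i, 0 ≤ d N i) (hdM : ∀ N i, d N i ≤ M)
    (hΦ : ∀ g : ℂ, 0 ≤ g.im → Tendsto (fun N : ℕ => (N : ℂ)⁻¹ * ∑ i, (d N i : ℂ) / (z + g * d N i))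
      atTop (𝓝 (∫ t : ℝ, (t : ℂ) / (z + g * t) ∂σ)))
    (hm : ∀ g : ℂ, 0 ≤ g.im → Tendsto (fun N : ℕ => (N : ℂ)⁻¹ * ∑ i, 1 / (z + g * d N i))
      atTop (𝓝 (∫ t : ℝ, 1 / (z + g * t) ∂σ)))
    {g : ℕ → ℂ} (hg : ∀ N, 0 ≤ (g N).im) {B : ℝ} (hgB : ∀ N, ‖g N‖ ≤ B)
    (hgeq : Tendsto (fun N : ℕ => g N + 2 * ((N : ℂ)⁻¹ * ∑ i, (d N i : ℂ) / (z + g N * d N i)))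
      atTop (𝓝 0)) :
    ∃ m : ℂ, ‖m‖ ≤ (1 + 1 / (2 * a ^ 2)) / 2 ∧
      Tendsto (fun N : ℕ => (N : ℂ)⁻¹ * ∑ i, 1 / (z + g N * d N i)) atTop (𝓝 (-m)) := by
  have hM : 0 ≤ M := by
    obtain ⟨t, ht⟩ := hσ.exists
    exact ha.le.trans (ht.1.trans ht.2)
  have havg : ∀ (N : ℕ) (c : Fin N → ℂ) (L : ℝ), 0 ≤ L → (∀ i, ‖c i‖ ≤ L) →
      ‖(N : ℂ)⁻¹ * ∑ i, c i‖ ≤ L := by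
    intro N c L hL hc
    rcases Nat.eq_zero_or_pos N with rfl | hN
    · simpa using hL
    · rw [norm_mul, norm_inv, Complex.norm_natCast, inv_mul_le_iff₀ (by positivity)]
      refine (norm_sum_le_of_le _ fun i _ => hc i).trans ?_
      simp
  have hlip : ∀ (N : ℕ) (c : Fin N → ℂ) (L : ℝ), 0 ≤ L → (∀ i, ‖c i‖ ≤ L) → ∀ x y : ℂ, 0 ≤ x.im →
      0 ≤ y.im → ‖(N : ℂ)⁻¹ * ∑ i, c i / (z + x * d N i) - (N : ℂ)⁻¹ * ∑ i, c i / (z + y * d N i)‖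
        ≤ L * M / z.im ^ 2 * ‖x - y‖ := by
    intro N c L hL hc x y hx hy
    rw [← mul_sub, ← Finset.sum_sub_distrib]
    refine havg _ _ _ (by positivity) fun i => ?_
    refine (norm_div_sub_div_le hx hy hz (hd0 N i) _).trans ?_
    have := hc i
    have := hdM N i
    have := hd0 N i
    gcongr
  have hlim : ∀ (c : ∀ N, Fin N → ℂ) (L : ℝ), 0 ≤ L → (∀ N i, ‖c N i‖ ≤ L) → ∀ (x m : ℂ), 0 ≤ x.im →
      Tendsto (fun N : ℕ => (N : ℂ)⁻¹ * ∑ i, c N i / (z + x * d N i)) atTop (𝓝 m) → ∀ φ : ℕ → ℕ,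
      Tendsto φ atTop atTop → Tendsto (fun N => g (φ N)) atTop (𝓝 x) →
      Tendsto (fun N => ((φ N : ℕ) : ℂ)⁻¹ * ∑ i, c (φ N) i / (z + g (φ N) * d (φ N) i)) atTop
        (𝓝 m) := by
    intro c L hL hc x m hx h1 φ hφ h2
    have h3 := h1.comp hφ
    have h4 : Tendsto (fun N => L * M / z.im ^ 2 * ‖g (φ N) - x‖) atTop (𝓝 0) := by
      have := (tendsto_iff_norm_sub_tendsto_zero.1 h2).const_mul (L * M / z.im ^ 2)
      simpa using this
    have h5 := squeeze_zero_norm (fun N => hlip (φ N) (c (φ N)) L hL (hc _) _ _ (hg _) hx) h4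
    simpa using h5.add h3
  have hclosed : IsClosed {x : ℂ | 0 ≤ x.im} := isClosed_le continuous_const Complex.continuous_im
  have hsub : ∀ (φ : ℕ → ℕ), Tendsto φ atTop atTop → ∀ x, Tendsto (fun N => g (φ N)) atTop (𝓝 x) →
      0 ≤ x.im ∧ x = -2 * ∫ t : ℝ, (t : ℂ) / (z + x * t) ∂σ := by
    intro φ hφ x hx
    have hx0 : 0 ≤ x.im := hclosed.mem_of_tendsto hx (Eventually.of_forall fun N => hg _)
    refine ⟨hx0, ?_⟩
    have h1 := hlim (fun N i => d N i) M hM (fun N i => by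
      rw [Complex.norm_real, Real.norm_of_nonneg (hd0 N i)]; exact hdM N i) x _ hx0 (hΦ x hx0) φ hφ hx
    have h2 := tendsto_nhds_unique (hgeq.comp hφ) (hx.add (h1.const_mul 2))
    linear_combination -h2
  have hcpt : IsCompact (Metric.closedBall (0 : ℂ) B) := isCompact_closedBall 0 B
  have hgmem : ∀ N, g N ∈ Metric.closedBall (0 : ℂ) B := fun N => by simpa using hgB N
  obtain ⟨x, -, φ, hφ, hφx⟩ := hcpt.tendsto_subseq hgmem
  have hx := hsub φ hφ.tendsto_atTop x hφx
  have hgx : Tendsto g atTop (𝓝 x) := by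
    refine tendsto_of_subseq_tendsto fun ns hns => ?_
    obtain ⟨y, -, ms, hms, hmsy⟩ := hcpt.tendsto_subseq fun N => hgmem (ns N)
    have hy := hsub (fun N => ns (ms N)) (hns.comp hms.tendsto_atTop) y hmsy
    have hxy := selfConsistent_unique hσ ha hz hx.1 hx.2 hy.1 hy.2
    exact ⟨ms, hxy ▸ hmsy⟩
  refine ⟨-∫ t : ℝ, 1 / (z + x * t) ∂σ, ?_, ?_⟩
  · rw [norm_neg]
    exact norm_integral_inv_add_mul_le hσ ha hz hx.1 hx.2
  · rw [neg_neg]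
    exact hlim (fun _ _ => 1) 1 zero_le_one (by simp) x _ hx.1 (hm x hx.1) id tendsto_id hgx

end SelfConsistent

section TraceLimit

open Topology

lemma tendsto_loopError (M η : ℝ) : Tendsto (fun n : ℕ => loopError n M η) atTop (𝓝 0) := by
  have h1 : Tendsto (fun n : ℕ => (n : ℝ)) atTop atTop := tendsto_natCast_atTop_atTop
  have h2 : Tendsto (fun n : ℕ => √(n : ℝ)) atTop atTop := Real.tendsto_sqrt_atTop.comp h1
  have h3 := (tendsto_inv_atTop_zero.comp h1).const_mul (2 * M ^ 2 / η ^ 2)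
  have h4 := (tendsto_inv_atTop_zero.comp h2).const_mul (4 * M ^ 3 / η ^ 3)
  have h5 := h3.add h4
  simp only [mul_zero, add_zero, Function.comp_apply] at h5
  refine h5.congr fun n => ?_
  rw [loopError]
  ring

lemma tendsto_div_sqrt_natCast (c : ℝ) : Tendsto (fun n : ℕ => c / √(n : ℝ)) atTop (𝓝 0) :=
  (Real.tendsto_sqrt_atTop.comp tendsto_natCast_atTop_atTop).const_div_atTop c

lemma integrable_norm_weightedTrace_sub {n : ℕ} {z : ℂ} (hz : 0 < z.im) (hn : n ≠ 0)
    (s : Fin n → ℝ) (m : ℂ) :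
    Integrable (fun w => ‖weightedTrace 1 s z w - m‖) (gaussianPi _) := by
  have hc := continuous_weightedTrace hz 1 s
  refine integrable_of_continuous_of_norm_le (B := 1 / z.im + ‖m‖) (by fun_prop) fun w => ?_
  rw [norm_norm]
  exact (norm_sub_le _ _).trans
    (add_le_add_left (norm_weightedTrace_le hz hn (by simp) s w) _)

theorem exists_tendsto_weightedTrace_of_bounded {σ : Measure ℝ} [IsProbabilityMeasure σ]
    {a M : ℝ} {z : ℂ} (hσ : ∀ᵐ t ∂σ, a ≤ t ∧ t ≤ M) (ha : 0 < a) (hz : 0 < z.im)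
    {s : ∀ N : ℕ, Fin N → ℝ} (hsM : ∀ N i, s N i ^ 2 ≤ M)
    (hΦ : ∀ g : ℂ, 0 ≤ g.im →
      Tendsto (fun N : ℕ => (N : ℂ)⁻¹ * ∑ i, ((s N i ^ 2 : ℝ) : ℂ) / (z + g * (s N i ^ 2 : ℝ)))
      atTop (𝓝 (∫ t : ℝ, (t : ℂ) / (z + g * t) ∂σ)))
    (hm : ∀ g : ℂ, 0 ≤ g.im →
      Tendsto (fun N : ℕ => (N : ℂ)⁻¹ * ∑ i, 1 / (z + g * (s N i ^ 2 : ℝ)))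
      atTop (𝓝 (∫ t : ℝ, 1 / (z + g * t) ∂σ))) :
    ∃ m : ℂ, ‖m‖ ≤ (1 + 1 / (2 * a ^ 2)) / 2 ∧
      Tendsto (fun N => ∫ w, ‖weightedTrace 1 (s N) z w - m‖ ∂(gaussianPi (Fin N × Fin N)))
        atTop (𝓝 0) := by
  have hM : 0 ≤ M := by
    obtain ⟨t, ht⟩ := hσ.exists
    exact ha.le.trans (ht.1.trans ht.2)
  have hex : ∀ N : ℕ, ∃ g : ℂ, 0 ≤ g.im ∧ ‖g‖ ≤ 2 * M / z.im ∧ (N ≠ 0 →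
      ‖g + 2 * ((N : ℂ)⁻¹ * ∑ i, ((s N i ^ 2 : ℝ) : ℂ) / (z + g * (s N i ^ 2 : ℝ)))‖
        ≤ 2 * M * (loopError N M z.im / z.im) ∧
      ∫ w, ‖weightedTrace 1 (s N) z w + (N : ℂ)⁻¹ * ∑ i, 1 / (z + g * (s N i ^ 2 : ℝ))‖
        ∂(gaussianPi _) ≤ 2 * M / z.im ^ 2 / √N + loopError N M z.im / z.im) := by
    intro N
    rcases eq_or_ne N 0 with rfl | hN
    · exact ⟨0, by simp, by simpa using by positivity, fun h => absurd rfl h⟩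
    · obtain ⟨g, h1, h2, h3⟩ := exists_approx_selfConsistent hz hN hM (hsM N)
      exact ⟨g, h1, h2, fun _ => h3⟩
  choose g hg0 hgB hgN using hex
  have hL := (tendsto_loopError M z.im).div_const z.im
  rw [zero_div] at hL
  have hgeq : Tendsto (fun N : ℕ => g N + 2 * ((N : ℂ)⁻¹ * ∑ i, ((s N i ^ 2 : ℝ) : ℂ) /
      (z + g N * (s N i ^ 2 : ℝ)))) atTop (𝓝 0) := by
    have h1 := hL.const_mul (2 * M)
    rw [mul_zero] at h1
    exact squeeze_zero_norm' ((eventually_ne_atTop 0).mono fun N hN => (hgN N hN).1) h1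
  obtain ⟨m, hmC, hmt⟩ := exists_selfConsistent_limit hσ ha hz (d := fun N i => s N i ^ 2)
    (fun N i => sq_nonneg _) hsM hΦ hm hg0 hgB hgeq
  refine ⟨m, hmC, ?_⟩
  have h2 : Tendsto (fun N : ℕ => (2 * M / z.im ^ 2 / √N + loopError N M z.im / z.im) +
      ‖(N : ℂ)⁻¹ * ∑ i, 1 / (z + g N * (s N i ^ 2 : ℝ)) - -m‖) atTop (𝓝 0) := by
    have := ((tendsto_div_sqrt_natCast (2 * M / z.im ^ 2)).add hL).add
      (tendsto_iff_norm_sub_tendsto_zero.1 hmt)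
    simpa using this
  refine squeeze_zero' (Eventually.of_forall fun N => integral_nonneg fun _ => norm_nonneg _)
    ((eventually_ne_atTop 0).mono fun N hN => ?_) h2
  set q := (N : ℂ)⁻¹ * ∑ i, 1 / (z + g N * (s N i ^ 2 : ℝ)) with hq
  have hi := integrable_norm_weightedTrace_sub hz hN (s N) (-q)
  simp only [sub_neg_eq_add] at hi
  calc _ ≤ ∫ w, (‖weightedTrace 1 (s N) z w + q‖ + ‖q - -m‖) ∂(gaussianPi (Fin N × Fin N)) := by
        refine integral_mono_of_nonneg (Eventually.of_forall fun w => norm_nonneg _)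
          (hi.add (integrable_const _)) (Eventually.of_forall fun w => ?_)
        have : weightedTrace 1 (s N) z w - m = (weightedTrace 1 (s N) z w + q) - (q - -m) := by ring
        simp only [this]
        exact norm_sub_le _ _
    _ ≤ _ := by
        rw [integral_add hi (integrable_const _)]
        simp only [integral_const, probReal_univ, one_smul]
        gcongr
        exact (hgN N hN).2

/-- Smooth truncation of `[0, ∞)` to `[0, M)`. -/
noncomputable def softTruncation (M t : ℝ) : ℝ := M * t / (M + t)

lemma softTruncation_nonneg {M t : ℝ} (hM : 0 < M) (ht : 0 ≤ t) : 0 ≤ softTruncation M t := by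
  unfold softTruncation
  positivity

lemma softTruncation_le {M t : ℝ} (hM : 0 < M) (ht : 0 ≤ t) : softTruncation M t ≤ M := by
  unfold softTruncation
  rw [div_le_iff₀ (by positivity)]
  nlinarith

lemma self_sub_softTruncation {M t : ℝ} (hM : 0 < M) (ht : 0 ≤ t) :
    t - softTruncation M t = t ^ 2 / (M + t) := by
  have : M + t ≠ 0 := by positivity
  unfold softTruncation
  field_simp
  ring

lemma le_softTruncation {M t δ : ℝ} (hM : 1 ≤ M) (hδ : 0 < δ) (ht : δ ≤ t) :
    δ / (1 + δ) ≤ softTruncation M t := by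
  unfold softTruncation
  rw [div_le_div_iff₀ (by positivity) (by linarith)]
  nlinarith [mul_nonneg (sub_nonneg.2 hM) (sub_nonneg.2 ht), mul_pos hδ (hδ.trans_le ht),
    mul_nonneg (mul_nonneg (sub_nonneg.2 hM) hδ.le) (sub_nonneg.2 ht),
    mul_nonneg (sub_nonneg.2 hM) (mul_pos hδ (hδ.trans_le ht)).le]

lemma add_mul_softTruncation {M t : ℝ} (hM : 0 < M) (ht : 0 ≤ t) (z g : ℂ) :
    z + g * (softTruncation M t : ℂ) = (z * M + (z + g * M) * t) / ((M : ℂ) + t) := by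
  have : (M : ℂ) + t ≠ 0 := by
    rw [← Complex.ofReal_add]
    exact Complex.ofReal_ne_zero.2 (by positivity)
  unfold softTruncation
  push_cast
  field_simp
  ring

lemma inv_add_mul_softTruncation {M t : ℝ} (hM : 0 < M) (ht : 0 ≤ t) {z g : ℂ}
    (hb : z + g * M ≠ 0) (hab : z * M + (z + g * M) * t ≠ 0) :
    1 / (z + g * (softTruncation M t : ℂ)) =
      1 / (z + g * M) + (M - z * M / (z + g * M)) * (1 / (z * M + (z + g * M) * t)) := by
  rw [add_mul_softTruncation hM ht]
  generalize z + g * M = b at *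
  have : (M : ℂ) + t ≠ 0 := by
    rw [← Complex.ofReal_add]
    exact Complex.ofReal_ne_zero.2 (by positivity)
  field_simp
  ring

lemma softTruncation_div_add_mul {M t : ℝ} (hM : 0 < M) (ht : 0 ≤ t) {z g : ℂ}
    (hb : z + g * M ≠ 0) (hab : z * M + (z + g * M) * t ≠ 0) :
    (softTruncation M t : ℂ) / (z + g * (softTruncation M t : ℂ)) =
      M / (z + g * M) + (-(M * (z * M) / (z + g * M))) * (1 / (z * M + (z + g * M) * t)) := by
  rw [add_mul_softTruncation hM ht]
  generalize z + g * M = b at *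
  have : (M : ℂ) + t ≠ 0 := by
    rw [← Complex.ofReal_add]
    exact Complex.ofReal_ne_zero.2 (by positivity)
  unfold softTruncation
  push_cast
  generalize hD : z * M + b * t = D at *
  field_simp
  rw [← hD]
  ring

lemma mul_one_add_le_norm {M : ℝ} (hM : 1 ≤ M) {z g : ℂ} (hz : 0 < z.im) (hg : 0 ≤ g.im) {t : ℝ}
    (ht : 0 ≤ t) : z.im * (1 + t) ≤ ‖z * M + (z + g * M) * t‖ := by
  refine le_trans ?_ ((le_abs_self _).trans (Complex.abs_im_le_norm _))
  simp only [Complex.add_im, Complex.mul_im, Complex.ofReal_re, Complex.ofReal_im, mul_zero,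
    zero_add, Complex.add_re, Complex.mul_re]
  nlinarith [mul_nonneg (mul_nonneg hg (zero_le_one.trans hM)) ht,
    mul_nonneg hz.le (sub_nonneg.2 hM)]

variable {σ : Measure ℝ} [IsProbabilityMeasure σ]

lemma tendsto_average_const_add_const_mul {d : ∀ N : ℕ, Fin N → ℝ} {F : ℝ → ℂ}
    (hF : Integrable F σ)
    (h : Tendsto (fun N : ℕ => (N : ℂ)⁻¹ * ∑ i, F (d N i)) atTop (𝓝 (∫ t, F t ∂σ))) (α β : ℂ) :
    Tendsto (fun N : ℕ => (N : ℂ)⁻¹ * ∑ i, (α + β * F (d N i))) atTop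
      (𝓝 (∫ t, (α + β * F t) ∂σ)) := by
  rw [integral_add (integrable_const _) (hF.const_mul _), integral_const_mul]
  simp only [integral_const, probReal_univ, one_smul]
  refine ((h.const_mul β).const_add α).congr' ((eventually_ne_atTop 0).mono fun N hN => ?_)
  have : (N : ℂ) ≠ 0 := Nat.cast_ne_zero.2 hN
  simp only [Finset.sum_add_distrib, ← Finset.mul_sum, Finset.sum_const, Finset.card_univ, Fintype.card_fin, nsmul_eq_mul]
  field_simp

/-- Limit of the normalised resolvent trace of a profiled Gaussian matrix whose squared profile has
empirical distribution converging to `σ`. -/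
theorem exists_tendsto_weightedTrace {δ : ℝ} (hδ : 0 < δ) (hσ : ∀ᵐ t ∂σ, δ ≤ t)
    (hσ1 : Integrable (fun t => t) σ) {s : ∀ N : ℕ, Fin N → ℝ} (hs0 : ∀ N i, 0 ≤ s N i)
    (H1 : ∀ (a b : ℂ) (κ : ℝ), 0 < κ → (∀ t : ℝ, 0 ≤ t → κ * (1 + t) ≤ ‖a + b * t‖) →
      Tendsto (fun N : ℕ => (N : ℂ)⁻¹ * ∑ i, 1 / (a + b * (s N i ^ 2 : ℝ))) atTop
        (𝓝 (∫ t : ℝ, 1 / (a + b * t) ∂σ)))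
    (H2 : ∀ N : ℕ, N ≠ 0 → (N : ℝ)⁻¹ * ∑ i, s N i ^ 2 ≤ ∫ t, t ∂σ)
    (H3 : ∀ N : ℕ, N ≠ 0 → ∀ M : ℝ, 0 < M →
      (N : ℝ)⁻¹ * ∑ i, (s N i ^ 2) ^ 2 / (M + s N i ^ 2) ≤ ∫ t, t ^ 2 / (M + t) ∂σ)
    {z : ℂ} (hz : 0 < z.im) :
    ∃ m : ℂ, ‖m‖ ≤ (1 + 1 / (2 * (δ / (1 + δ)) ^ 2)) / 2 ∧
      Tendsto (fun N => ∫ w, ‖weightedTrace 1 (s N) z w - m‖ ∂(gaussianPi (Fin N × Fin N)))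
        atTop (𝓝 0) := by
  set s' : ℝ → ∀ N : ℕ, Fin N → ℝ := fun M N i => √(softTruncation M (s N i ^ 2)) with hs'
  have hs'sq : ∀ M, 0 < M → ∀ N i, s' M N i ^ 2 = softTruncation M (s N i ^ 2) := fun M hM N i =>
    Real.sq_sqrt (softTruncation_nonneg hM (sq_nonneg _))
  have htrunc : ∀ M : ℝ, 1 ≤ M → ∃ m : ℂ, ‖m‖ ≤ (1 + 1 / (2 * (δ / (1 + δ)) ^ 2)) / 2 ∧
      Tendsto (fun N => ∫ w, ‖weightedTrace 1 (s' M N) z w - m‖ ∂(gaussianPi (Fin N × Fin N)))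
        atTop (𝓝 0) := by
    intro M hM
    have hM0 : 0 < M := zero_lt_one.trans_le hM
    have hmeas : Measurable (softTruncation M) := by
      unfold softTruncation
      fun_prop
    have hae : ∀ᵐ t ∂(σ.map (softTruncation M)), δ / (1 + δ) ≤ t ∧ t ≤ M := by
      rw [ae_map_iff hmeas.aemeasurable
        (p := fun t => δ / (1 + δ) ≤ t ∧ t ≤ M) measurableSet_Icc]
      exact hσ.mono fun t ht => ⟨le_softTruncation hM hδ ht, softTruncation_le hM0 (hδ.le.trans ht)⟩
    have := Measure.isProbabilityMeasure_map (μ := σ) hmeas.aemeasurable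
    have hint : ∀ g : ℂ, 0 ≤ g.im →
        Integrable (fun t : ℝ => 1 / (z * M + (z + g * M) * t)) σ := by
      intro g hg
      refine Integrable.of_bound (Measurable.aestronglyMeasurable (by fun_prop)) (1 / z.im)
        (hσ.mono fun t ht => ?_)
      rw [norm_div, norm_one]
      have h1 := mul_one_add_le_norm hM hz hg (hδ.le.trans ht)
      have h2 : 0 ≤ z.im * t := mul_nonneg hz.le (hδ.le.trans ht)
      exact one_div_le_one_div_of_le hz (by linarith)
    refine exists_tendsto_weightedTrace_of_bounded hae (by positivity) hz (s := s' M)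
      (fun N i => (hs'sq M hM0 N i).trans_le (softTruncation_le hM0 (sq_nonneg _))) ?_ ?_
    · intro g hg
      have hb := add_mul_ne_zero_of_im_pos hg hM0.le hz
      have hab : ∀ t : ℝ, 0 ≤ t → z * M + (z + g * M) * t ≠ 0 := fun t ht =>
        norm_pos_iff.1 ((mul_pos hz (by positivity)).trans_le (mul_one_add_le_norm hM hz hg ht))
      have h1 := tendsto_average_const_add_const_mul (hint g hg)
        (H1 (z * M) (z + g * M) z.im hz fun t ht => mul_one_add_le_norm hM hz hg ht)
        (M / (z + g * M)) (-(M * (z * M) / (z + g * M)))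
      rw [integral_map hmeas.aemeasurable (Measurable.aestronglyMeasurable (by fun_prop))]
      rw [integral_congr_ae (hσ.mono fun t ht =>
        (softTruncation_div_add_mul hM0 (hδ.le.trans ht) hb (hab t (hδ.le.trans ht))).symm)] at h1
      refine h1.congr fun N => ?_
      congr 1
      refine Finset.sum_congr rfl fun i _ => ?_
      rw [hs'sq M hM0, softTruncation_div_add_mul hM0 (sq_nonneg _) hb (hab _ (sq_nonneg _))]
    · intro g hg
      have hb := add_mul_ne_zero_of_im_pos hg hM0.le hz
      have hab : ∀ t : ℝ, 0 ≤ t → z * M + (z + g * M) * t ≠ 0 := fun t ht =>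
        norm_pos_iff.1 ((mul_pos hz (by positivity)).trans_le (mul_one_add_le_norm hM hz hg ht))
      have h1 := tendsto_average_const_add_const_mul (hint g hg)
        (H1 (z * M) (z + g * M) z.im hz fun t ht => mul_one_add_le_norm hM hz hg ht)
        (1 / (z + g * M)) (M - z * M / (z + g * M))
      rw [integral_map hmeas.aemeasurable (Measurable.aestronglyMeasurable (by fun_prop))]
      rw [integral_congr_ae (hσ.mono fun t ht =>
        (inv_add_mul_softTruncation hM0 (hδ.le.trans ht) hb (hab t (hδ.le.trans ht))).symm)] at h1
      refine h1.congr fun N => ?_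
      congr 1
      refine Finset.sum_congr rfl fun i _ => ?_
      rw [hs'sq M hM0, inv_add_mul_softTruncation hM0 (sq_nonneg _) hb (hab _ (sq_nonneg _))]
  choose! m hmC hmt using htrunc
  set τ : ℕ → ℝ := fun k => ∫ t, t ^ 2 / (((k : ℝ) + 1) + t) ∂σ with hτ
  have hτ0 : Tendsto τ atTop (𝓝 0) := by
    have h1 := tendsto_integral_of_dominated_convergence (μ := σ) (f := fun _ : ℝ => (0 : ℝ))
      (F := fun (k : ℕ) t => t ^ 2 / (((k : ℝ) + 1) + t)) (fun t => t)
      (fun k => Measurable.aestronglyMeasurable (by fun_prop)) hσ1 (fun k => hσ.mono fun t ht => ?_)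
      (Eventually.of_forall fun t => ?_)
    · simpa using h1
    · have ht0 : 0 ≤ t := hδ.le.trans ht
      rw [Real.norm_of_nonneg (by positivity), div_le_iff₀ (by positivity)]
      nlinarith [mul_nonneg ht0 (by positivity : (0 : ℝ) ≤ (k : ℝ) + 1)]
    · refine Tendsto.const_div_atTop ?_ _
      exact tendsto_atTop_add_const_right _ _
        (tendsto_atTop_add_const_right _ _ tendsto_natCast_atTop_atTop)
  set e : ℕ → ℝ := fun k => √(8 * (∫ t, t ∂σ) * τ k) / z.im ^ 2 with he
  have he0 : Tendsto e atTop (𝓝 0) := by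
    have h1 := ((hτ0.const_mul (8 * ∫ t, t ∂σ)).sqrt).div_const (z.im ^ 2)
    simpa using h1
  have hclose : ∀ (k N : ℕ), N ≠ 0 →
      ∫ w, ‖weightedTrace 1 (s N) z w - weightedTrace 1 (s' (k + 1) N) z w‖ ∂(gaussianPi _) ≤ e k := by
    intro k N hN
    have hM0 : (0 : ℝ) < k + 1 := by positivity
    refine (integral_norm_weightedTrace_sub_weightedTrace_le hz hN (fun i => Real.sqrt_nonneg _)
      (fun i => ?_)).trans ?_
    · refine Real.sqrt_le_iff.2 ⟨hs0 N i, ?_⟩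
      have := self_sub_softTruncation hM0 (sq_nonneg (s N i))
      have h2 : 0 ≤ (s N i ^ 2) ^ 2 / ((k : ℝ) + 1 + s N i ^ 2) := by positivity
      linarith
    · have h3 : ∑ i, (s N i ^ 2 - s' (k + 1) N i ^ 2) =
          ∑ i, (s N i ^ 2) ^ 2 / ((k : ℝ) + 1 + s N i ^ 2) :=
        Finset.sum_congr rfl fun i _ => by
          rw [hs'sq _ hM0, self_sub_softTruncation hM0 (sq_nonneg (s N i))]
      have h4 : (0 : ℝ) ≤ (N : ℝ)⁻¹ * ∑ i, s N i ^ 2 := by positivity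
      rw [h3]
      have h5 := H2 N hN
      have h6 := H3 N hN (k + 1) hM0
      have h7 : (0 : ℝ) ≤ (N : ℝ)⁻¹ * ∑ i, (s N i ^ 2) ^ 2 / ((k : ℝ) + 1 + s N i ^ 2) := by
        positivity
      simp only [he, hτ]
      gcongr
      linarith
  obtain ⟨m₀, hm₀, φ, hφ, hφm⟩ := (isCompact_closedBall (0 : ℂ)
    ((1 + 1 / (2 * (δ / (1 + δ)) ^ 2)) / 2)).tendsto_subseq
    (x := fun k : ℕ => m ((k : ℝ) + 1)) fun k => by
      simpa using hmC ((k : ℝ) + 1) (by simp)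
  refine ⟨m₀, by simpa using hm₀, ?_⟩
  rw [Metric.tendsto_atTop']
  intro ε hε
  have h1 : ∀ᶠ j in atTop, e (φ j) < ε / 3 :=
    (he0.comp hφ.tendsto_atTop).eventually_lt_const (by positivity)
  have h2 : ∀ᶠ j in atTop, ‖m ((φ j : ℝ) + 1) - m₀‖ < ε / 3 :=
    (tendsto_iff_norm_sub_tendsto_zero.1 hφm).eventually_lt_const (by positivity)
  obtain ⟨j, hj1, hj2⟩ := (h1.and h2).exists
  have h3 := (hmt ((φ j : ℝ) + 1) (by simp)).eventually_lt_const (show (0 : ℝ) < ε / 3 by positivity)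
  obtain ⟨N₀, hN₀⟩ := eventually_atTop.1 h3
  refine ⟨N₀, fun N hN => ?_⟩
  have hN0 : N ≠ 0 := by omega
  rw [Real.dist_eq, sub_zero, abs_of_nonneg (integral_nonneg fun _ => norm_nonneg _)]
  have hi1 : Integrable (fun w => ‖weightedTrace 1 (s N) z w
      - weightedTrace 1 (s' (φ j + 1) N) z w‖) (gaussianPi _) := by
    have hc := continuous_weightedTrace hz 1 (s N)
    have hc' := continuous_weightedTrace hz 1 (s' (φ j + 1) N)
    refine integrable_of_continuous_of_norm_le (B := 1 / z.im + 1 / z.im) (by fun_prop) fun w => ?_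
    rw [norm_norm]
    exact (norm_sub_le _ _).trans (add_le_add (norm_weightedTrace_le hz hN0 (by simp) _ w)
      (norm_weightedTrace_le hz hN0 (by simp) _ w))
  have hi2 := integrable_norm_weightedTrace_sub hz hN0 (s' (φ j + 1) N) (m ((φ j : ℝ) + 1))
  have hi3 := hi1.add hi2
  simp only [Pi.add_def] at hi3
  calc _ ≤ ∫ w, ((‖weightedTrace 1 (s N) z w - weightedTrace 1 (s' (φ j + 1) N) z w‖ +
          ‖weightedTrace 1 (s' (φ j + 1) N) z w - m ((φ j : ℝ) + 1)‖) +
          ‖m ((φ j : ℝ) + 1) - m₀‖) ∂(gaussianPi (Fin N × Fin N)) := by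
        refine integral_mono_of_nonneg (Eventually.of_forall fun w => norm_nonneg _)
          (hi3.add (integrable_const _)) (Eventually.of_forall fun w => ?_)
        exact (norm_sub_le_norm_sub_add_norm_sub _ (m ((φ j : ℝ) + 1)) _).trans
          (add_le_add_left (norm_sub_le_norm_sub_add_norm_sub _ _ _) _)
    _ < ε := by
        rw [integral_add hi3 (integrable_const _), integral_add hi1 hi2]
        simp only [integral_const, probReal_univ, one_smul]
        have h5 := hclose (φ j) N hN0
        have h6 := hN₀ N hN.le
        linarith

end TraceLimit

section PartitionOfUnity

open Topology

variable {X : Type*} [MeasurableSpace X] {m : Measure X} {R : X → ℝ}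
  {N : ℕ}

/-- A bounded measurable partition of unity on a probability space into `N` functions of equal mass,
such that `d i` is the mean of `R` under the `i`-th normalised weight. -/
structure IsBalancedPartition (m : Measure X) (R : X → ℝ) (w : Fin N → X → ℝ) (d : Fin N → ℝ) :
    Prop where
  measurable : ∀ i, Measurable (w i)
  nonneg : ∀ i x, 0 ≤ w i x
  sum_eq_one : ∀ x, ∑ i, w i x = 1
  integral_eq : ∀ i, ∫ x, w i x ∂m = (N : ℝ)⁻¹
  integral_mul_eq : ∀ i, ∫ x, w i x * R x ∂m = (N : ℝ)⁻¹ * d i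

namespace IsBalancedPartition

variable {w : Fin N → X → ℝ} {d : Fin N → ℝ} (h : IsBalancedPartition m R w d)

include h in
lemma norm_le_one (i : Fin N) (x : X) : ‖w i x‖ ≤ 1 := by
  rw [Real.norm_of_nonneg (h.nonneg i x), ← h.sum_eq_one x]
  exact Finset.single_le_sum (f := fun i => w i x) (fun j _ => h.nonneg j x) (Finset.mem_univ i)

include h in
lemma nonneg_of_ae_nonneg (hR0 : ∀ᵐ x ∂m, 0 ≤ R x) (i : Fin N) :
    0 ≤ d i := by
  have h1 : 0 ≤ ∫ x, w i x * R x ∂m :=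
    integral_nonneg_of_ae (hR0.mono fun x hx => mul_nonneg (h.nonneg i x) hx)
  rw [h.integral_mul_eq] at h1
  have hN : (0 : ℝ) < (N : ℝ)⁻¹ := inv_pos.2 (Nat.cast_pos.2 (Fin.pos i))
  exact nonneg_of_mul_nonneg_right h1 hN

end IsBalancedPartition

lemma IsBalancedPartition.integrable_smul {w : Fin N → X → ℝ} {d : Fin N → ℝ}
    (h : IsBalancedPartition m R w d) {E : Type*} [NormedAddCommGroup E] [NormedSpace ℝ E]
    {f : X → E} (hf : Integrable f m) (i : Fin N) : Integrable (fun x => w i x • f x) m :=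
  hf.bdd_smul 1 (h.measurable i).aestronglyMeasurable (Eventually.of_forall (h.norm_le_one i))


variable [IsProbabilityMeasure m]

namespace IsBalancedPartition

variable {w : Fin N → X → ℝ} {d : Fin N → ℝ}

lemma integrable (h : IsBalancedPartition m R w d) (i : Fin N) : Integrable (w i) m := by
  simpa using h.integrable_smul (integrable_const (1 : ℝ)) i

/-- The part of the integrand `w i • F R` left after subtracting a first order expansion at `d i`
of arbitrary slope carries the whole quadrature error. -/
lemma integral_sub_sum_eq (h : IsBalancedPartition m R w d) {E : Type*} [NormedAddCommGroup E]
    [NormedSpace ℝ E] [CompleteSpace E] (hR : Integrable R m) {F : ℝ → E}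
    (hF : Integrable (fun x => F (R x)) m) (c : Fin N → E) :
    ∫ x, F (R x) ∂m - (N : ℝ)⁻¹ • ∑ i, F (d i)
      = ∑ i, ∫ x, w i x • (F (R x) - F (d i) - (R x - d i) • c i) ∂m := by
  have key : ∀ i, ∫ x, w i x • (F (R x) - F (d i) - (R x - d i) • c i) ∂m
      = ∫ x, w i x • F (R x) ∂m - (N : ℝ)⁻¹ • F (d i) := by
    intro i
    have h1 := h.integrable_smul hF i
    have h2 : Integrable (fun x => w i x • F (d i)) m := (h.integrable i).smul_const _
    have hwR : Integrable (fun x => w i x * R x) m := h.integrable_smul hR i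
    have h3 : Integrable (fun x => (w i x * R x) • c i) m := hwR.smul_const _
    have h4 : Integrable (fun x => (w i x * d i) • c i) m :=
      ((h.integrable i).mul_const _).smul_const _
    have h5 : ∀ x, w i x • (F (R x) - F (d i) - (R x - d i) • c i)
        = (w i x • F (R x) - w i x • F (d i)) - ((w i x * R x) • c i - (w i x * d i) • c i) := by
      intro x
      simp only [smul_sub, sub_smul, mul_smul]
    simp only [h5]
    rw [integral_sub (f := fun x => w i x • F (R x) - w i x • F (d i))
      (g := fun x => (w i x * R x) • c i - (w i x * d i) • c i) (h1.sub h2) (h3.sub h4),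
      integral_sub h1 h2, integral_sub h3 h4,
      integral_smul_const, integral_smul_const, integral_smul_const, h.integral_mul_eq,
      integral_mul_const, h.integral_eq, sub_self, sub_zero]
  rw [Finset.sum_congr rfl fun i _ => key i, Finset.sum_sub_distrib, ← Finset.smul_sum,
    ← integral_finsetSum _ fun i _ => h.integrable_smul hF i]
  congr 1
  refine integral_congr_ae (Eventually.of_forall fun x => ?_)
  simp only [← Finset.sum_smul, h.sum_eq_one, one_smul]

/-- `d` has the same mean as `R`. -/
lemma sum_eq_integral (h : IsBalancedPartition m R w d) (hR : Integrable R m) :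
    (N : ℝ)⁻¹ * ∑ i, d i = ∫ x, R x ∂m := by
  have := h.integral_sub_sum_eq hR (F := fun t => t) hR (fun _ => 1)
  simp only [smul_eq_mul, mul_one, sub_self, mul_zero, integral_zero, Finset.sum_const_zero] at this
  linarith

end IsBalancedPartition

lemma integrable_inv_one_add (hR : Integrable R m) (hR0 : ∀ᵐ x ∂m, 0 ≤ R x) :
    Integrable (fun x => 1 / (1 + R x)) m := by
  refine Integrable.of_bound (C := 1) ?_ (hR0.mono fun x hx => ?_)
  · exact ((hR.aemeasurable.const_add 1).const_div 1).aestronglyMeasurable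
  · rw [Real.norm_of_nonneg (by positivity), div_le_one (by positivity)]
    linarith

namespace IsBalancedPartition

variable {w : Fin N → X → ℝ} {d : Fin N → ℝ}

/-- Quadrature errors of Möbius functions without poles on the positive half-line are dominated by
the error of `t ↦ (1 + t)⁻¹`. -/
lemma norm_integral_moebius_sub_le (h : IsBalancedPartition m R w d) (hR : Integrable R m)
    (hR0 : ∀ᵐ x ∂m, 0 ≤ R x) {a b : ℂ} {κ : ℝ} (hκ : 0 < κ)
    (hab : ∀ t : ℝ, 0 ≤ t → κ * (1 + t) ≤ ‖a + b * t‖) :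
    ‖∫ x, 1 / (a + b * (R x : ℂ)) ∂m - (N : ℂ)⁻¹ * ∑ i, 1 / (a + b * (d i : ℂ))‖
      ≤ ‖b‖ ^ 2 / κ ^ 3 * (∫ x, 1 / (1 + R x) ∂m - (N : ℝ)⁻¹ * ∑ i, 1 / (1 + d i)) := by
  have hd := h.nonneg_of_ae_nonneg hR0
  have hF : Integrable (fun x => 1 / (a + b * (R x : ℂ))) m := by
    refine Integrable.of_bound (C := κ⁻¹) ?_ (hR0.mono fun x hx => ?_)
    · exact (((Complex.measurable_ofReal.comp_aemeasurable hR.aemeasurable).const_mul b).const_add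
        a |>.const_div 1).aestronglyMeasurable
    · rw [norm_div, norm_one, one_div]
      exact inv_anti₀ hκ (le_trans (by nlinarith) (hab _ hx))
  have hψ := integrable_inv_one_add hR hR0
  have e1 := h.integral_sub_sum_eq hR (F := fun t : ℝ => 1 / (a + b * (t : ℂ))) hF
    (fun i => - b / (a + b * (d i : ℂ)) ^ 2)
  have e2 := h.integral_sub_sum_eq hR (F := fun t : ℝ => 1 / (1 + t)) hψ
    (fun i => - 1 / (1 + d i) ^ 2)
  rw [smul_eq_mul] at e2
  have e1' : (N : ℝ)⁻¹ • ∑ i, 1 / (a + b * (d i : ℂ)) = (N : ℂ)⁻¹ * ∑ i, 1 / (a + b * (d i : ℂ)) := by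
    rw [Complex.real_smul]; push_cast; rfl
  rw [← e1', e1, e2, Finset.mul_sum]
  refine (norm_sum_le _ _).trans (Finset.sum_le_sum fun i _ => ?_)
  rw [← integral_const_mul]
  have hrem : Integrable (fun x => 1 / (1 + R x) - 1 / (1 + d i) - (R x - d i) • (-1 / (1 + d i) ^ 2))
      m := (hψ.sub (integrable_const _)).sub ((hR.sub (integrable_const _)).smul_const _)
  refine norm_integral_le_of_norm_le ((h.integrable_smul hrem i).const_mul _)
    (hR0.mono fun x hx => ?_)
  have hm := hd i
  have n1 := hab _ hx
  have n2 := hab _ hm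
  have p1 : 0 < κ * (1 + R x) := by positivity
  have p2 : 0 < κ * (1 + d i) := by positivity
  have z1 : a + b * (R x : ℂ) ≠ 0 := norm_pos_iff.1 (p1.trans_le n1)
  have z2 : a + b * (d i : ℂ) ≠ 0 := norm_pos_iff.1 (p2.trans_le n2)
  have i1 : 1 / (a + b * (R x : ℂ)) - 1 / (a + b * (d i : ℂ))
      - (R x - d i) • (-b / (a + b * (d i : ℂ)) ^ 2)
      = b ^ 2 * ((R x - d i : ℝ) : ℂ) ^ 2 / ((a + b * (d i : ℂ)) ^ 2 * (a + b * (R x : ℂ))) := by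
    rw [Complex.real_smul]
    push_cast
    field_simp
    ring
  have i2 : 1 / (1 + R x) - 1 / (1 + d i) - (R x - d i) • (-1 / (1 + d i) ^ 2)
      = (R x - d i) ^ 2 / ((1 + d i) ^ 2 * (1 + R x)) := by
    have y1 : 1 + R x ≠ 0 := by positivity
    have y2 : 1 + d i ≠ 0 := by positivity
    rw [smul_eq_mul]
    field_simp
    ring
  rw [i1, i2, norm_smul, Real.norm_of_nonneg (h.nonneg i x), smul_eq_mul, mul_left_comm]
  refine mul_le_mul_of_nonneg_left ?_ (h.nonneg i x)
  rw [norm_div, norm_mul, norm_mul, norm_pow, norm_pow, norm_pow, Complex.norm_real, Real.norm_eq_abs,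
    sq_abs, div_mul_div_comm]
  refine div_le_div_of_nonneg_left (by positivity) (by positivity) ?_
  calc κ ^ 3 * ((1 + d i) ^ 2 * (1 + R x)) = (κ * (1 + d i)) ^ 2 * (κ * (1 + R x)) := by ring
    _ ≤ _ := by gcongr

/-- The quadrature error of `t ↦ (1 + t)⁻¹` is bounded through the tangent at `R x`. -/
lemma integral_inv_one_add_sub_le (h : IsBalancedPartition m R w d) (hR : Integrable R m)
    (hR0 : ∀ᵐ x ∂m, 0 ≤ R x) :
    ∫ x, 1 / (1 + R x) ∂m - (N : ℝ)⁻¹ * ∑ i, 1 / (1 + d i)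
      ≤ ∫ x, 1 / (1 + R x) ^ 2 * ∑ i, d i * w i x ∂m - ∫ x, 1 / (1 + R x) ^ 2 * R x ∂m := by
  have hd := h.nonneg_of_ae_nonneg hR0
  have hψ := integrable_inv_one_add hR hR0
  have hbm : AEStronglyMeasurable (fun x => 1 / (1 + R x) ^ 2) m :=
    (((hR.aemeasurable.const_add 1).pow_const 2).const_div 1).aestronglyMeasurable
  have hb1 : ∀ᵐ x ∂m, ‖1 / (1 + R x) ^ 2‖ ≤ 1 := hR0.mono fun x hx => by
    rw [Real.norm_of_nonneg (by positivity), div_le_one (by positivity)]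
    nlinarith
  have j1 : Integrable (fun x => 1 / (1 + R x) ^ 2 * R x) m := hR.bdd_mul hbm hb1
  have j2 : Integrable (fun x => 1 / (1 + R x) ^ 2 * ∑ i, d i * w i x) m :=
    (integrable_finsetSum _ fun i _ => (h.integrable i).const_mul _).bdd_mul hbm hb1
  have j3 : Integrable (fun x => ∑ i, w i x * (1 / (1 + d i))) m :=
    integrable_finsetSum _ fun i _ => (h.integrable i).mul_const _
  have e : (N : ℝ)⁻¹ * ∑ i, 1 / (1 + d i) = ∫ x, ∑ i, w i x * (1 / (1 + d i)) ∂m := by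
    rw [integral_finsetSum _ fun i _ => (h.integrable i).mul_const _, Finset.mul_sum]
    simp only [integral_mul_const, h.integral_eq]
  rw [e, ← integral_sub hψ j3, ← integral_sub j2 j1]
  refine integral_mono_ae (hψ.sub j3) (j2.sub j1) (hR0.mono fun x hx => ?_)
  simp only []
  have s1 := h.sum_eq_one x
  have t : ∀ i, 1 / (1 + R x) - 1 / (1 + d i) ≤ 1 / (1 + R x) ^ 2 * (d i - R x) := by
    intro i
    have hm := hd i
    have : 1 / (1 + R x) ^ 2 * (d i - R x) - (1 / (1 + R x) - 1 / (1 + d i))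
        = (d i - R x) ^ 2 / ((1 + R x) ^ 2 * (1 + d i)) := by
      have y1 : 1 + R x ≠ 0 := by positivity
      have y2 : 1 + d i ≠ 0 := by positivity
      field_simp
      ring
    have h0 : 0 ≤ (d i - R x) ^ 2 / ((1 + R x) ^ 2 * (1 + d i)) := by positivity
    linarith
  calc 1 / (1 + R x) - ∑ i, w i x * (1 / (1 + d i))
      = ∑ i, w i x * (1 / (1 + R x) - 1 / (1 + d i)) := by
        simp only [mul_sub, Finset.sum_sub_distrib, ← Finset.sum_mul, s1, one_mul]
    _ ≤ ∑ i, w i x * (1 / (1 + R x) ^ 2 * (d i - R x)) :=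
        Finset.sum_le_sum fun i _ => mul_le_mul_of_nonneg_left (t i) (h.nonneg i x)
    _ = _ := by
        have : ∀ i, w i x * (1 / (1 + R x) ^ 2 * (d i - R x))
            = 1 / (1 + R x) ^ 2 * (d i * w i x) - w i x * (1 / (1 + R x) ^ 2 * R x) := by
          intro i; ring
        simp only [this, Finset.sum_sub_distrib, ← Finset.sum_mul, s1, one_mul, ← Finset.mul_sum]

/-- Jensen's inequality for `t ↦ t ^ 2 / (M + t)`. -/
lemma sum_sq_div_le (h : IsBalancedPartition m R w d) (hR : Integrable R m)
    (hR0 : ∀ᵐ x ∂m, 0 ≤ R x) {M : ℝ} (hM : 0 < M) :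
    (N : ℝ)⁻¹ * ∑ i, d i ^ 2 / (M + d i) ≤ ∫ x, R x ^ 2 / (M + R x) ∂m := by
  have hd := h.nonneg_of_ae_nonneg hR0
  have hF : Integrable (fun x => R x ^ 2 / (M + R x)) m := by
    refine hR.mono' ?_ (hR0.mono fun x hx => ?_)
    · exact ((hR.aemeasurable.pow_const 2).div (hR.aemeasurable.const_add M)).aestronglyMeasurable
    · rw [Real.norm_of_nonneg (by positivity), div_le_iff₀ (by positivity)]
      nlinarith
  have e := h.integral_sub_sum_eq hR (F := fun t : ℝ => t ^ 2 / (M + t)) hF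
    (fun i => 1 - M ^ 2 / (M + d i) ^ 2)
  rw [smul_eq_mul] at e
  rw [← sub_nonneg, e]
  refine Finset.sum_nonneg fun i _ => integral_nonneg_of_ae (hR0.mono fun x hx => ?_)
  have hm := hd i
  refine smul_nonneg (h.nonneg i x) ?_
  have : R x ^ 2 / (M + R x) - d i ^ 2 / (M + d i) - (R x - d i) • (1 - M ^ 2 / (M + d i) ^ 2)
      = M ^ 2 * (R x - d i) ^ 2 / ((M + d i) ^ 2 * (M + R x)) := by
    have y1 : M + R x ≠ 0 := by positivity
    have y2 : M + d i ≠ 0 := by positivity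
    rw [smul_eq_mul]
    field_simp
    ring
  rw [this]
  positivity

end IsBalancedPartition

end PartitionOfUnity

section FejerMeans

open Topology AddCircle ComplexConjugate

/-- Uniformly bounded functionals which tend to zero on a set spanning a dense subspace tend to
zero everywhere. -/
lemma tendsto_zero_of_topologicalClosure_span_eq_top {V : Type*} [NormedAddCommGroup V]
    [NormedSpace ℂ V] (L : ℕ → V →ₗ[ℂ] ℂ) {C : ℝ} (hL : ∀ n v, ‖L n v‖ ≤ C * ‖v‖) {s : Set V}
    (hs : (Submodule.span ℂ s).topologicalClosure = ⊤)
    (h : ∀ v ∈ s, Tendsto (fun n => L n v) atTop (𝓝 0)) (v : V) :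
    Tendsto (fun n => L n v) atTop (𝓝 0) := by
  have hspan : ∀ u ∈ Submodule.span ℂ s, Tendsto (fun n => L n u) atTop (𝓝 0) := by
    intro u hu
    induction hu using Submodule.span_induction with
    | mem x hx => exact h x hx
    | zero => simp
    | add x y _ _ hx hy => simpa using hx.add hy
    | smul a x _ hx => simpa using hx.const_mul a
  have hv : v ∈ closure (Submodule.span ℂ s : Set V) := by
    rw [← Submodule.topologicalClosure_coe, hs]
    trivial
  rw [Metric.tendsto_atTop]
  intro ε hε
  obtain ⟨u, hu, huv⟩ := Metric.mem_closure_iff.1 hv (ε / (2 * (|C| + 1))) (by positivity)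
  obtain ⟨n₀, hn₀⟩ := Metric.tendsto_atTop.1 (hspan u hu) (ε / 2) (by positivity)
  refine ⟨n₀, fun n hn => ?_⟩
  have h1 := hn₀ n hn
  rw [dist_zero_right] at h1 ⊢
  rw [dist_eq_norm, lt_div_iff₀ (by positivity)] at huv
  have h2 : ‖L n v‖ ≤ ‖L n (v - u)‖ + ‖L n u‖ := by
    rw [map_sub]
    simpa using norm_add_le (L n v - L n u) (L n u)
  have h3 := hL n (v - u)
  have h4 : C * ‖v - u‖ ≤ (|C| + 1) * ‖v - u‖ := by
    gcongr
    linarith [le_abs_self C]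
  linarith

variable {T : ℝ}

/-- The Fejér kernel. -/
noncomputable def fejerKernel (N : ℕ) (x y : AddCircle T) : ℝ :=
  (N : ℝ)⁻¹ * ‖∑ j : Fin N, fourier (j : ℤ) x * fourier (-(j : ℤ)) y‖ ^ 2

lemma fejerKernel_nonneg (N : ℕ) (x y : AddCircle T) : 0 ≤ fejerKernel N x y := by
  unfold fejerKernel
  positivity

lemma ofReal_fejerKernel (N : ℕ) (x y : AddCircle T) :
    (fejerKernel N x y : ℂ) = (N : ℂ)⁻¹ * ∑ j : Fin N, ∑ l : Fin N,
      fourier ((l : ℤ) - (j : ℤ)) y * fourier ((j : ℤ) - (l : ℤ)) x := by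
  unfold fejerKernel
  push_cast
  rw [← Complex.mul_conj', map_sum, Finset.sum_mul_sum]
  congr 1
  refine Finset.sum_congr rfl fun j _ => Finset.sum_congr rfl fun l _ => ?_
  simp only [map_mul, ← fourier_neg, neg_neg, sub_eq_add_neg, fourier_add]
  ring

lemma continuous_fejerKernel (N : ℕ) (x : AddCircle T) : Continuous (fejerKernel N x) := by
  unfold fejerKernel
  fun_prop

lemma norm_fourier_apply (k : ℤ) (x : AddCircle T) : ‖(fourier k x : ℂ)‖ = 1 := by
  rw [fourier_apply, Circle.norm_coe]

variable [hT : Fact (0 < T)]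

/-- The `N`-th Fejér mean of a function on the circle. -/
noncomputable def fejer (N : ℕ) (f : AddCircle T → ℂ) (x : AddCircle T) : ℂ :=
  (N : ℂ)⁻¹ * ∑ j : Fin N, ∑ l : Fin N,
    (∫ y, f y * fourier ((l : ℤ) - (j : ℤ)) y ∂haarAddCircle) * fourier ((j : ℤ) - (l : ℤ)) x

lemma integral_fourier (k : ℤ) :
    ∫ x : AddCircle T, fourier k x ∂haarAddCircle = if k = 0 then 1 else 0 := by
  split_ifs with hk
  · simp [hk]
  · refine integral_eq_zero_of_add_right_eq_neg (μ := haarAddCircle)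
      (fourier_add_half_inv_index hk hT.out)

lemma integrable_mul_fourier {f : AddCircle T → ℂ} (hf : Integrable f haarAddCircle) (k : ℤ) :
    Integrable (fun y => f y * fourier k y) haarAddCircle :=
  hf.mul_bdd (c := 1) (fourier k).continuous.aestronglyMeasurable
    (Eventually.of_forall fun x => (norm_fourier_apply k x).le)

lemma fejer_eq_integral {f : AddCircle T → ℂ} (hf : Integrable f haarAddCircle) (N : ℕ)
    (x : AddCircle T) : fejer N f x = ∫ y, f y * fejerKernel N x y ∂haarAddCircle := by
  have hi : ∀ j l : Fin N, Integrable (fun y => f y * fourier ((l : ℤ) - (j : ℤ)) y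
      * fourier ((j : ℤ) - (l : ℤ)) x) haarAddCircle :=
    fun j l => (integrable_mul_fourier hf _).mul_const _
  have : ∀ y, f y * fejerKernel N x y = (N : ℂ)⁻¹ * ∑ j : Fin N, ∑ l : Fin N,
      f y * fourier ((l : ℤ) - (j : ℤ)) y * fourier ((j : ℤ) - (l : ℤ)) x := by
    intro y
    rw [ofReal_fejerKernel, mul_left_comm, Finset.mul_sum]
    simp only [Finset.mul_sum, mul_assoc]
  simp only [this]
  rw [integral_const_mul, integral_finsetSum _ fun j _ => integrable_finsetSum _ fun l _ => hi j l]
  simp only [integral_finsetSum _ fun l _ => hi _ l, integral_mul_const]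
  rfl

lemma integral_fejerKernel {N : ℕ} (hN : N ≠ 0) (x : AddCircle T) :
    ∫ y, fejerKernel N x y ∂haarAddCircle = 1 := by
  have h := fejer_eq_integral (f := fun _ : AddCircle T => (1 : ℂ)) (integrable_const _) N x
  simp only [one_mul] at h
  rw [integral_complex_ofReal] at h
  apply Complex.ofReal_injective
  rw [← h]
  unfold fejer
  have hN' : (N : ℂ) ≠ 0 := Nat.cast_ne_zero.2 hN
  simp only [one_mul, integral_fourier, sub_eq_zero, Nat.cast_inj, Fin.val_inj, ite_mul, zero_mul,
    Finset.sum_ite_eq', Finset.mem_univ, if_true, sub_self, fourier_zero, Finset.sum_const,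
    Finset.card_univ, Fintype.card_fin, nsmul_eq_mul, mul_one, inv_mul_cancel₀ hN', Complex.ofReal_one]

lemma norm_fejer_le {f : AddCircle T → ℂ} (hf : AEStronglyMeasurable f haarAddCircle) {B : ℝ}
    (hB : ∀ x, ‖f x‖ ≤ B) {N : ℕ} (hN : N ≠ 0) (x : AddCircle T) : ‖fejer N f x‖ ≤ B := by
  rw [fejer_eq_integral (.of_bound hf B (Eventually.of_forall hB))]
  have hK : Integrable (fejerKernel N x) haarAddCircle :=
    (continuous_fejerKernel N x).integrable_of_hasCompactSupport
      (HasCompactSupport.of_compactSpace _)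
  refine (norm_integral_le_of_norm_le (hK.const_mul B) (Eventually.of_forall fun y => ?_)).trans_eq
    (by rw [integral_const_mul, integral_fejerKernel hN, mul_one])
  rw [norm_mul, Complex.norm_real, Real.norm_of_nonneg (fejerKernel_nonneg N x y)]
  exact mul_le_mul_of_nonneg_right (hB y) (fejerKernel_nonneg N x y)

lemma continuous_fejer (N : ℕ) (f : AddCircle T → ℂ) : Continuous (fejer N f) := by
  unfold fejer
  fun_prop

lemma integral_mul_fejer_comm {b h : AddCircle T → ℂ} (hb : Integrable b haarAddCircle)
    (hh : Integrable h haarAddCircle) (N : ℕ) :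
    ∫ x, b x * fejer N h x ∂haarAddCircle = ∫ x, h x * fejer N b x ∂haarAddCircle := by
  have key : ∀ b h : AddCircle T → ℂ, Integrable b haarAddCircle →
      ∫ x, b x * fejer N h x ∂haarAddCircle = (N : ℂ)⁻¹ * ∑ j : Fin N, ∑ l : Fin N,
        (∫ y, h y * fourier ((l : ℤ) - (j : ℤ)) y ∂haarAddCircle)
          * ∫ x, b x * fourier ((j : ℤ) - (l : ℤ)) x ∂haarAddCircle := by
    intro b h hb
    have e : ∀ x, b x * fejer N h x = (N : ℂ)⁻¹ * ∑ j : Fin N, ∑ l : Fin N,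
        (∫ y, h y * fourier ((l : ℤ) - (j : ℤ)) y ∂haarAddCircle)
          * (b x * fourier ((j : ℤ) - (l : ℤ)) x) := by
      intro x
      unfold fejer
      rw [mul_left_comm, Finset.mul_sum]
      simp only [Finset.mul_sum]
      simp only [mul_left_comm]
    have hi : ∀ j l : Fin N, Integrable (fun x =>
        (∫ y, h y * fourier ((l : ℤ) - (j : ℤ)) y ∂haarAddCircle)
          * (b x * fourier ((j : ℤ) - (l : ℤ)) x)) haarAddCircle :=
      fun j l => (integrable_mul_fourier hb _).const_mul _
    simp only [e]
    rw [integral_const_mul,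
      integral_finsetSum _ fun j _ => integrable_finsetSum _ fun l _ => hi j l]
    simp only [integral_finsetSum _ fun l _ => hi _ l, integral_const_mul]
  rw [key b h hb, key h b hh, Finset.sum_comm]
  simp only [mul_comm]

lemma tendsto_card_sub_eq (k : ℤ) :
    Tendsto (fun N : ℕ => (N : ℂ)⁻¹ * ∑ j : Fin N, ∑ l : Fin N,
      if (l : ℤ) - (j : ℤ) = k then (1 : ℂ) else 0) atTop (𝓝 1) := by
  have hS : ∀ (N : ℕ) (j : Fin N), (∑ l : Fin N, if (l : ℤ) - (j : ℤ) = k then (1 : ℂ) else 0)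
      = if 0 ≤ (j : ℤ) + k ∧ (j : ℤ) + k < N then 1 else 0 := by
    intro N j
    split_ifs with hj
    · rw [Finset.sum_eq_single (⟨((j : ℤ) + k).toNat, by omega⟩ : Fin N)]
      · rw [if_pos]
        simp only
        omega
      · intro l _ hl
        rw [if_neg]
        rintro rfl
        apply hl
        ext
        simp
      · simp
    · refine Finset.sum_eq_zero fun l _ => if_neg ?_
      have := l.2
      omega
  have hbound : ∀ N : ℕ, N ≠ 0 → ‖(N : ℂ)⁻¹ * ∑ j : Fin N, (∑ l : Fin N,
      if (l : ℤ) - (j : ℤ) = k then (1 : ℂ) else 0) - 1‖ ≤ (2 * k.natAbs : ℝ) / N := by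
    intro N hN
    have hN' : (N : ℂ) ≠ 0 := Nat.cast_ne_zero.2 hN
    have e : (N : ℂ)⁻¹ * ∑ j : Fin N, (∑ l : Fin N, if (l : ℤ) - (j : ℤ) = k then (1 : ℂ) else 0)
        - 1 = (N : ℂ)⁻¹ * ∑ j : Fin N,
          ((if 0 ≤ (j : ℤ) + k ∧ (j : ℤ) + k < N then (1 : ℂ) else 0) - 1) := by
      simp only [hS, Finset.sum_sub_distrib, mul_sub]
      simp [hN']
    rw [e, norm_mul, norm_inv, Complex.norm_natCast, div_eq_inv_mul]
    gcongr
    refine (norm_sum_le _ _).trans ?_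
    rw [Fin.sum_univ_eq_sum_range
      (fun j => ‖(if 0 ≤ (j : ℤ) + k ∧ (j : ℤ) + k < N then (1 : ℂ) else 0) - 1‖)]
    have t : ∀ j ∈ Finset.range N,
        ‖(if 0 ≤ (j : ℤ) + k ∧ (j : ℤ) + k < N then (1 : ℂ) else 0) - 1‖
          ≤ (if j < k.natAbs then (1 : ℝ) else 0) + if N - k.natAbs ≤ j then 1 else 0 := by
      intro j hj
      have := Finset.mem_range.1 hj
      split_ifs <;> first | (exfalso; omega) | norm_num
    refine (Finset.sum_le_sum t).trans ?_
    rw [Finset.sum_add_distrib, Finset.sum_boole, Finset.sum_boole]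
    have c1 : ((Finset.range N).filter fun j => j < k.natAbs).card ≤ k.natAbs := by
      refine (Finset.card_le_card (t := Finset.range k.natAbs) fun j hj => ?_).trans (by simp)
      simp only [Finset.mem_filter, Finset.mem_range] at hj ⊢
      exact hj.2
    have c2 : ((Finset.range N).filter fun j => N - k.natAbs ≤ j).card ≤ k.natAbs := by
      refine (Finset.card_le_card (t := Finset.Ico (N - k.natAbs) N) fun j hj => ?_).trans
        (by rw [Nat.card_Ico]; omega)
      simp only [Finset.mem_filter, Finset.mem_range, Finset.mem_Ico] at hj ⊢
      exact ⟨hj.2, hj.1⟩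
    have c1' : ((((Finset.range N).filter fun j => j < k.natAbs).card : ℕ) : ℝ) ≤ k.natAbs := by
      exact_mod_cast c1
    have c2' : ((((Finset.range N).filter fun j => N - k.natAbs ≤ j).card : ℕ) : ℝ)
        ≤ k.natAbs := by
      exact_mod_cast c2
    linarith
  rw [tendsto_iff_norm_sub_tendsto_zero]
  refine squeeze_zero' (Eventually.of_forall fun _ => norm_nonneg _)
    ((eventually_ne_atTop 0).mono hbound) ?_
  exact tendsto_const_nhds.div_atTop tendsto_natCast_atTop_atTop

lemma tendsto_integral_fourier_mul_fejer (b : AddCircle T → ℂ) (k : ℤ) : Tendsto (fun N => ∫ x, fourier k x * fejer N b x ∂haarAddCircle) atTop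
      (𝓝 (∫ x, fourier k x * b x ∂haarAddCircle)) := by
  have h := (tendsto_card_sub_eq k).mul_const (∫ x, fourier k x * b x ∂haarAddCircle)
  rw [one_mul] at h
  refine h.congr fun N => ?_
  have hi : ∀ j l : Fin N, Integrable (fun x : AddCircle T =>
      (∫ y, b y * fourier ((l : ℤ) - (j : ℤ)) y ∂haarAddCircle)
        * (fourier (k + ((j : ℤ) - (l : ℤ))) x)) haarAddCircle := fun j l =>
    (Continuous.integrable_of_hasCompactSupport (by fun_prop)
      (HasCompactSupport.of_compactSpace _))
  have e : ∀ x : AddCircle T, fourier k x * fejer N b x = (N : ℂ)⁻¹ * ∑ j : Fin N, ∑ l : Fin N,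
      (∫ y, b y * fourier ((l : ℤ) - (j : ℤ)) y ∂haarAddCircle)
        * (fourier (k + ((j : ℤ) - (l : ℤ))) x) := by
    intro x
    unfold fejer
    rw [mul_left_comm, Finset.mul_sum]
    simp only [Finset.mul_sum, fourier_add]
    simp only [mul_left_comm]
  simp only [e]
  rw [integral_const_mul,
    integral_finsetSum _ fun j _ => integrable_finsetSum _ fun l _ => hi j l]
  simp only [integral_finsetSum _ fun l _ => hi _ l, integral_const_mul, integral_fourier]
  rw [mul_assoc, Finset.sum_mul]
  congr 1
  refine Finset.sum_congr rfl fun j _ => ?_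
  rw [Finset.sum_mul]
  refine Finset.sum_congr rfl fun l _ => ?_
  by_cases hk : (l : ℤ) - (j : ℤ) = k
  · rw [if_pos hk, if_pos (by omega), one_mul, mul_one, hk]
    simp only [mul_comm]
  · rw [if_neg hk, if_neg (by omega), zero_mul, mul_zero]

/-- Fejér means of an integrable function converge weakly against bounded functions. -/
theorem tendsto_integral_mul_fejer {b h : AddCircle T → ℂ}
    (hb : AEStronglyMeasurable b haarAddCircle) {B : ℝ} (hB : ∀ x, ‖b x‖ ≤ B)
    (hh : Integrable h haarAddCircle) :
    Tendsto (fun N => ∫ x, b x * fejer N h x ∂haarAddCircle) atTop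
      (𝓝 (∫ x, b x * h x ∂haarAddCircle)) := by
  have hbi : Integrable b haarAddCircle := .of_bound hb B (Eventually.of_forall hB)
  have hg : ∀ N, AEStronglyMeasurable (fun x => fejer (N + 1) b x - b x) haarAddCircle :=
    fun N => (continuous_fejer _ b).aestronglyMeasurable.sub hb
  have hgB : ∀ N x, ‖fejer (N + 1) b x - b x‖ ≤ B + B := fun N x =>
    (norm_sub_le _ _).trans (add_le_add (norm_fejer_le hb hB N.succ_ne_zero x) (hB x))
  have hint : ∀ (N : ℕ) {u : AddCircle T → ℂ}, Integrable u haarAddCircle →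
      Integrable (fun x => u x * (fejer (N + 1) b x - b x)) haarAddCircle := fun N u hu =>
    hu.mul_bdd (hg N) (Eventually.of_forall (hgB N))
  let L : ℕ → Lp ℂ 1 (haarAddCircle (T := T)) →ₗ[ℂ] ℂ := fun N =>
    { toFun := fun u => ∫ x, u x * (fejer (N + 1) b x - b x) ∂haarAddCircle
      map_add' := fun u v => by
        rw [← integral_add (hint N (L1.integrable_coeFn u)) (hint N (L1.integrable_coeFn v))]
        refine integral_congr_ae ((Lp.coeFn_add u v).mono fun x hx => ?_)
        simp only [hx, Pi.add_apply, add_mul]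
      map_smul' := fun c u => by
        rw [RingHom.id_apply, smul_eq_mul, ← integral_const_mul]
        refine integral_congr_ae ((Lp.coeFn_smul c u).mono fun x hx => ?_)
        simp only [hx, Pi.smul_apply, smul_eq_mul, mul_assoc] }
  have hL : ∀ N u, ‖L N u‖ ≤ (B + B) * ‖u‖ := by
    intro N u
    rw [L1.norm_eq_integral_norm, ← integral_const_mul]
    refine norm_integral_le_of_norm_le ((L1.integrable_coeFn u).norm.const_mul _)
      (Eventually.of_forall fun x => ?_)
    rw [norm_mul, mul_comm]
    exact mul_le_mul_of_nonneg_right (hgB N x) (norm_nonneg _)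
  have h0 : ∀ v ∈ Set.range (fun n : ℤ => fourierLp (T := T) 1 n),
      Tendsto (fun N => L N v) atTop (𝓝 0) := by
    rintro _ ⟨k, rfl⟩
    have h1 := (tendsto_integral_fourier_mul_fejer b k).comp (tendsto_add_atTop_nat 1)
    have h2 := h1.sub_const (∫ x, fourier k x * b x ∂haarAddCircle)
    rw [sub_self] at h2
    refine h2.congr fun N => ?_
    have i1 : Integrable (fun x => fourier k x * fejer (N + 1) b x) (haarAddCircle (T := T)) :=
      Continuous.integrable_of_hasCompactSupport
        ((fourier k).continuous.mul (continuous_fejer _ b)) (HasCompactSupport.of_compactSpace _)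
    have i2 : Integrable (fun x => fourier k x * b x) (haarAddCircle (T := T)) := by
      simpa only [mul_comm] using integrable_mul_fourier hbi k
    simp only [Function.comp_apply]
    rw [← integral_sub i1 i2]
    refine integral_congr_ae ((coeFn_fourierLp 1 k).mono fun x hx => ?_)
    simp only [hx, mul_sub]
  have hlim := tendsto_zero_of_topologicalClosure_span_eq_top L hL
    (span_fourierLp_closure_eq_top (T := T) ENNReal.one_ne_top) h0 (hh.toL1 h)
  have hlim' : Tendsto (fun N => ∫ x, b x * fejer (N + 1) h x ∂haarAddCircle) atTop
      (𝓝 (∫ x, b x * h x ∂haarAddCircle)) := by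
    rw [← tendsto_sub_nhds_zero_iff]
    refine hlim.congr fun N => ?_
    have i2 : Integrable (fun x => h x * b x) (haarAddCircle (T := T)) :=
      hh.mul_bdd hb (Eventually.of_forall hB)
    have i1 : Integrable (fun x => h x * fejer (N + 1) b x) (haarAddCircle (T := T)) :=
      hh.mul_bdd (continuous_fejer _ b).aestronglyMeasurable
        (Eventually.of_forall (norm_fejer_le hb hB N.succ_ne_zero))
    rw [integral_mul_fejer_comm hbi hh]
    simp only [mul_comm (b _)]
    rw [← integral_sub i1 i2]
    refine integral_congr_ae (hh.coeFn_toL1.mono fun x hx => ?_)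
    simp only [hx, mul_sub]
  exact (tendsto_add_atTop_iff_nat 1).1 hlim'

end FejerMeans

section Toeplitz

open Topology AddCircle ComplexConjugate

variable {T : ℝ}

/-- The normalised squared modulus of the trigonometric polynomial with coefficients `v`. -/
noncomputable def spectralWeight {N : ℕ} (v : Fin N → ℝ) (x : AddCircle T) : ℝ :=
  (N : ℝ)⁻¹ * ‖∑ j : Fin N, (v j : ℂ) * fourier (j : ℤ) x‖ ^ 2

lemma ofReal_spectralWeight {N : ℕ} (v : Fin N → ℝ) (x : AddCircle T) :
    (spectralWeight v x : ℂ) = (N : ℂ)⁻¹ * ∑ j : Fin N, ∑ l : Fin N,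
      ((v j * v l : ℝ) : ℂ) * fourier ((j : ℤ) - (l : ℤ)) x := by
  unfold spectralWeight
  push_cast
  rw [← Complex.mul_conj', map_sum, Finset.sum_mul_sum]
  congr 1
  refine Finset.sum_congr rfl fun j _ => Finset.sum_congr rfl fun l _ => ?_
  simp only [map_mul, Complex.conj_ofReal, ← fourier_neg, sub_eq_add_neg, fourier_add]
  ring

lemma continuous_spectralWeight {N : ℕ} (v : Fin N → ℝ) :
    Continuous (spectralWeight v : AddCircle T → ℝ) := by
  unfold spectralWeight
  fun_prop

variable [hT : Fact (0 < T)]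

lemma integral_spectralWeight_mul {N : ℕ} (v : Fin N → ℝ) {f : AddCircle T → ℝ} {ρ : ℤ → ℝ}
    (hf : Integrable f haarAddCircle)
    (hρ : ∀ k, ∫ x, (f x : ℂ) * fourier k x ∂haarAddCircle = ρ k) :
    ∫ x, spectralWeight v x * f x ∂haarAddCircle
      = (N : ℝ)⁻¹ * ∑ j : Fin N, ∑ l : Fin N, v j * v l * ρ ((j : ℤ) - (l : ℤ)) := by
  have hi : ∀ j l : Fin N, Integrable (fun x : AddCircle T =>
      ((v j * v l : ℝ) : ℂ) * ((f x : ℂ) * fourier ((j : ℤ) - (l : ℤ)) x)) haarAddCircle :=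
    fun j l => (integrable_mul_fourier hf.ofReal _).const_mul _
  have e : ∀ x : AddCircle T, ((spectralWeight v x * f x : ℝ) : ℂ) = (N : ℂ)⁻¹ *
      ∑ j : Fin N, ∑ l : Fin N,
        ((v j * v l : ℝ) : ℂ) * ((f x : ℂ) * fourier ((j : ℤ) - (l : ℤ)) x) := by
    intro x
    rw [Complex.ofReal_mul, ofReal_spectralWeight, mul_assoc, Finset.sum_mul]
    simp only [Finset.sum_mul]
    congr 1
    refine Finset.sum_congr rfl fun j _ => Finset.sum_congr rfl fun l _ => ?_
    ring
  apply Complex.ofReal_injective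
  rw [← integral_complex_ofReal]
  simp only [e]
  rw [integral_const_mul,
    integral_finsetSum _ fun j _ => integrable_finsetSum _ fun l _ => hi j l]
  simp only [integral_finsetSum _ fun l _ => hi _ l, integral_const_mul, hρ]
  push_cast
  rfl

/-- The `N × N` symmetric Toeplitz matrix with symbol `ρ`. -/
def toeplitz (ρ : ℤ → ℝ) (N : ℕ) : Matrix (Fin N) (Fin N) ℝ :=
  Matrix.of fun j l => ρ ((j : ℤ) - (l : ℤ))

omit hT in
lemma spectralWeight_sum {N : ℕ} (hN : N ≠ 0) {O : Matrix (Fin N) (Fin N) ℝ} (hO : O * Oᵀ = 1)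
    (x : AddCircle T) : ∑ i, spectralWeight (fun j => O j i) x = 1 := by
  have hN' : (N : ℂ) ≠ 0 := Nat.cast_ne_zero.2 hN
  have h1 : ∀ j l, (∑ i, ((O j i * O l i : ℝ) : ℂ)) = if j = l then 1 else 0 := by
    intro j l
    have := congrFun (congrFun hO j) l
    rw [Matrix.mul_apply, Matrix.one_apply] at this
    simp only [Matrix.transpose_apply] at this
    rw [← Complex.ofReal_sum, this]
    split_ifs <;> simp
  apply Complex.ofReal_injective
  rw [Complex.ofReal_sum]
  simp only [ofReal_spectralWeight]
  rw [← Finset.mul_sum, Finset.sum_comm]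
  have h2 : ∀ j : Fin N, ∑ i, ∑ l : Fin N, ((O j i * O l i : ℝ) : ℂ)
      * fourier ((j : ℤ) - (l : ℤ)) x = 1 := by
    intro j
    rw [Finset.sum_comm]
    simp only [← Finset.sum_mul, h1, ite_mul, one_mul, zero_mul, Finset.sum_ite_eq,
      Finset.mem_univ, if_true, sub_self, fourier_zero]
  simp only [h2, Finset.sum_const, Finset.card_univ, Fintype.card_fin, nsmul_eq_mul, mul_one,
    inv_mul_cancel₀ hN', Complex.ofReal_one]

variable {R : AddCircle T → ℝ} {ρ : ℤ → ℝ}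

lemma isBalancedPartition_spectralWeight (hR : Integrable R haarAddCircle)
    (hρ : ∀ k, ∫ x, (R x : ℂ) * fourier k x ∂haarAddCircle = ρ k) {N : ℕ} (hN : N ≠ 0)
    {O : Matrix (Fin N) (Fin N) ℝ} {d : Fin N → ℝ} (hO : O * Oᵀ = 1)
    (hd : toeplitz ρ N = O * Matrix.diagonal d * Oᵀ) :
    IsBalancedPartition (haarAddCircle (T := T)) R (fun i => spectralWeight fun j => O j i) d where
  measurable i := (continuous_spectralWeight _).measurable
  nonneg i x := by
    unfold spectralWeight
    positivity
  sum_eq_one x := spectralWeight_sum hN hO x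
  integral_eq i := by
    have h := integral_spectralWeight_mul (fun j => O j i) (f := fun _ : AddCircle T => (1 : ℝ))
      (ρ := fun k => if k = 0 then 1 else 0) (integrable_const _) (fun k => by
        simp only [Complex.ofReal_one, one_mul, integral_fourier]
        split_ifs <;> simp)
    simp only [mul_one] at h
    have h1 : (Oᵀ * O) i i = 1 := by rw [mul_eq_one_comm.1 hO, Matrix.one_apply_eq]
    rw [Matrix.mul_apply] at h1
    simp only [Matrix.transpose_apply] at h1
    rw [h]
    simp [sub_eq_zero, Fin.val_inj, h1]
  integral_mul_eq i := by
    rw [integral_spectralWeight_mul _ hR hρ]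
    have h1 : (Oᵀ * toeplitz ρ N * O) i i = d i := by
      have hO' := mul_eq_one_comm.1 hO
      rw [hd, show Oᵀ * (O * Matrix.diagonal d * Oᵀ) * O
        = (Oᵀ * O) * Matrix.diagonal d * (Oᵀ * O) by simp only [Matrix.mul_assoc], hO', one_mul,
        mul_one, Matrix.diagonal_apply_eq]
    rw [← h1, Matrix.mul_apply]
    simp only [Matrix.mul_apply, Matrix.transpose_apply, toeplitz, Matrix.of_apply, Finset.sum_mul]
    rw [Finset.sum_comm]
    congr 1
    refine Finset.sum_congr rfl fun j _ => Finset.sum_congr rfl fun l _ => ?_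
    ring

lemma sum_mul_spectralWeight_eq_fejer
    (hρ : ∀ k, ∫ x, (R x : ℂ) * fourier k x ∂haarAddCircle = ρ k) {N : ℕ}
    {O : Matrix (Fin N) (Fin N) ℝ} {d : Fin N → ℝ}
    (hd : toeplitz ρ N = O * Matrix.diagonal d * Oᵀ) (x : AddCircle T) :
    ((∑ i, d i * spectralWeight (fun j => O j i) x : ℝ) : ℂ) = fejer N (fun y => (R y : ℂ)) x := by
  have hsymm : ∀ j l, toeplitz ρ N l j = ∑ i, O j i * d i * O l i := by
    intro j l
    rw [hd, Matrix.mul_apply]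
    simp only [Matrix.mul_diagonal, Matrix.transpose_apply]
    exact Finset.sum_congr rfl fun i _ => by ring
  unfold fejer
  simp only [hρ]
  have : ∀ j l : Fin N, ρ ((l : ℤ) - (j : ℤ)) = ∑ i, O j i * d i * O l i := hsymm
  simp only [this]
  push_cast
  simp only [ofReal_spectralWeight, Finset.sum_mul, Finset.mul_sum]
  rw [Finset.sum_comm]
  refine Finset.sum_congr rfl fun j _ => ?_
  rw [Finset.sum_comm]
  refine Finset.sum_congr rfl fun l _ => Finset.sum_congr rfl fun i _ => ?_
  push_cast
  ring

/-- Averages of Möbius functions over the eigenvalues of Toeplitz matrices converge. -/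
lemma tendsto_sum_moebius_toeplitz (hR : Integrable R haarAddCircle) (hR0 : ∀ x, 0 ≤ R x)
    (hρ : ∀ k, ∫ x, (R x : ℂ) * fourier k x ∂haarAddCircle = ρ k)
    {O : ∀ N : ℕ, Matrix (Fin N) (Fin N) ℝ} {d : ∀ N : ℕ, Fin N → ℝ} (hO : ∀ N, O N * (O N)ᵀ = 1)
    (hd : ∀ N, toeplitz ρ N = O N * Matrix.diagonal (d N) * (O N)ᵀ) {a b : ℂ} {κ : ℝ}
    (hκ : 0 < κ) (hab : ∀ t : ℝ, 0 ≤ t → κ * (1 + t) ≤ ‖a + b * t‖) :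
    Tendsto (fun N : ℕ => (N : ℂ)⁻¹ * ∑ i, 1 / (a + b * (d N i : ℂ))) atTop
      (𝓝 (∫ x, 1 / (a + b * (R x : ℂ)) ∂haarAddCircle)) := by
  have hR0' : ∀ᵐ x ∂haarAddCircle, 0 ≤ R x := Eventually.of_forall hR0
  have hfej := tendsto_integral_mul_fejer (b := fun x => ((1 / (1 + R x) ^ 2 : ℝ) : ℂ))
    (h := fun x => (R x : ℂ)) (B := 1)
    (Complex.measurable_ofReal.comp_aemeasurable
      (((hR.aemeasurable.const_add 1).pow_const 2).const_div 1)).aestronglyMeasurable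
    (fun x => by
      have := hR0 x
      rw [Complex.norm_real, Real.norm_of_nonneg (by positivity), div_le_one (by positivity)]
      nlinarith) hR.ofReal
  have hU : Tendsto (fun N : ℕ => ∫ x, 1 / (1 + R x) ^ 2 * ∑ i, d N i *
      spectralWeight (fun j => O N j i) x ∂haarAddCircle
        - ∫ x, 1 / (1 + R x) ^ 2 * R x ∂haarAddCircle) atTop (𝓝 0) := by
    rw [tendsto_sub_nhds_zero_iff]
    have hre := (Complex.continuous_re.tendsto _).comp hfej
    simp only [← sum_mul_spectralWeight_eq_fejer hρ (hd _), ← Complex.ofReal_mul,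
      integral_complex_ofReal, Complex.ofReal_re, Function.comp_def] at hre
    exact hre
  rw [tendsto_iff_norm_sub_tendsto_zero]
  have hU' := hU.const_mul (‖b‖ ^ 2 / κ ^ 3)
  rw [mul_zero] at hU'
  refine squeeze_zero' (Eventually.of_forall fun _ => norm_nonneg _)
    ((eventually_ne_atTop 0).mono fun N hN => ?_) hU'
  have h := isBalancedPartition_spectralWeight hR hρ hN (hO N) (hd N)
  rw [norm_sub_rev]
  refine (h.norm_integral_moebius_sub_le hR hR0' hκ hab).trans ?_
  exact mul_le_mul_of_nonneg_left (h.integral_inv_one_add_sub_le hR hR0') (by positivity)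

/-- Traces of resolvents of Gaussian matrices whose variance profile is given by the eigenvalues
of Toeplitz matrices converge. -/
theorem exists_tendsto_weightedTrace_toeplitz (hR : Integrable R haarAddCircle)
    (hR0 : ∀ x, 0 ≤ R x) {δ : ℝ} (hδ : 0 < δ) (hRδ : ∀ᵐ x ∂haarAddCircle, δ ≤ R x)
    (hρ : ∀ k, ∫ x, (R x : ℂ) * fourier k x ∂haarAddCircle = ρ k)
    {O : ∀ N : ℕ, Matrix (Fin N) (Fin N) ℝ} {d : ∀ N : ℕ, Fin N → ℝ} (hO : ∀ N, O N * (O N)ᵀ = 1)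
    (hd : ∀ N, toeplitz ρ N = O N * Matrix.diagonal (d N) * (O N)ᵀ) {z : ℂ} (hz : 0 < z.im) :
    ∃ m : ℂ, ‖m‖ ≤ (1 + 1 / (2 * (δ / (1 + δ)) ^ 2)) / 2 ∧
      Tendsto (fun N => ∫ w, ‖weightedTrace 1 (fun i => √(d N i)) z w - m‖
        ∂(gaussianPi (Fin N × Fin N))) atTop (𝓝 0) := by
  have hR0' : ∀ᵐ x ∂haarAddCircle, 0 ≤ R x := Eventually.of_forall hR0
  have hRm := hR.aemeasurable
  have := Measure.isProbabilityMeasure_map (μ := haarAddCircle (T := T)) hRm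
  have hP := fun (N : ℕ) (hN : N ≠ 0) =>
    isBalancedPartition_spectralWeight hR hρ hN (hO N) (hd N)
  have hd0 : ∀ N i, 0 ≤ d N i := fun N i =>
    (hP N (Fin.pos i).ne').nonneg_of_ae_nonneg hR0' i
  have hsq : ∀ N i, √(d N i) ^ 2 = d N i := fun N i => Real.sq_sqrt (hd0 N i)
  refine exists_tendsto_weightedTrace (σ := Measure.map R haarAddCircle) hδ ?_ ?_
    (s := fun N i => √(d N i)) (fun N i => Real.sqrt_nonneg _) ?_ ?_ ?_ hz
  · rwa [ae_map_iff hRm measurableSet_Ici]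
  · exact (integrable_map_measure (f := R) (g := fun t : ℝ => t) aestronglyMeasurable_id hRm).2 hR
  · intro a b κ hκ hab
    have hmeas : Measurable fun t : ℝ => 1 / (a + b * (t : ℂ)) := by fun_prop
    rw [integral_map hRm hmeas.aestronglyMeasurable]
    simp only [hsq]
    exact tendsto_sum_moebius_toeplitz hR hR0 hρ hO hd hκ hab
  · intro N hN
    simp only [hsq]
    rw [integral_map (f := fun t : ℝ => t) hRm aestronglyMeasurable_id,
      (hP N hN).sum_eq_integral hR]
  · intro N hN M hM
    have hmeas : Measurable fun t : ℝ => t ^ 2 / (M + t) := by fun_prop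
    rw [integral_map hRm hmeas.aestronglyMeasurable]
    simp only [hsq]
    exact (hP N hN).sum_sq_div_le hR hR0' hM

end Toeplitz

section Quantile

open Topology

/-- The quantile function of a measure on the line, extended by zero outside `(0, 1)`. -/
noncomputable def quantile (μ : Measure ℝ) (u : ℝ) : ℝ :=
  (Set.Ioo (0 : ℝ) 1).indicator (fun u => sInf {y : ℝ | ENNReal.ofReal u ≤ μ (Set.Iic y)}) u

variable {μ : Measure ℝ} [IsProbabilityMeasure μ] {δ : ℝ}

lemma nonempty_quantile_set (μ : Measure ℝ) [IsProbabilityMeasure μ] {u : ℝ} (hu : u < 1) :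
    {y : ℝ | ENNReal.ofReal u ≤ μ (Set.Iic y)}.Nonempty := by
  have h := tendsto_measure_Iic_atTop μ
  rw [measure_univ] at h
  have hlt : ENNReal.ofReal u < 1 := by rwa [ENNReal.ofReal_lt_one]
  obtain ⟨y, hy⟩ := (h.eventually (lt_mem_nhds hlt)).exists
  exact ⟨y, hy.le⟩

lemma le_of_mem_quantile_set (hμδ : μ (Set.Ici δ) = 1) {u y : ℝ} (hu : 0 < u)
    (hy : ENNReal.ofReal u ≤ μ (Set.Iic y)) : δ ≤ y := by
  by_contra! hlt
  have h0 : μ (Set.Ici δ)ᶜ = 0 := (prob_compl_eq_zero_iff measurableSet_Ici).2 hμδ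
  have h1 : μ (Set.Iic y) = 0 := measure_mono_null (fun x hx => by
    simp only [Set.mem_compl_iff, Set.mem_Ici, not_le]
    exact lt_of_le_of_lt hx hlt) h0
  rw [h1] at hy
  exact absurd (ENNReal.ofReal_pos.2 hu) (not_lt.2 hy)

lemma le_quantile (hμδ : μ (Set.Ici δ) = 1) {u : ℝ} (hu : u ∈ Set.Ioo (0 : ℝ) 1) :
    δ ≤ quantile μ u := by
  rw [quantile, Set.indicator_of_mem hu]
  exact le_csInf (nonempty_quantile_set μ hu.2) fun y hy => le_of_mem_quantile_set hμδ hu.1 hy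

lemma quantile_nonneg (hδ : 0 < δ) (hμδ : μ (Set.Ici δ) = 1) (u : ℝ) : 0 ≤ quantile μ u := by
  by_cases hu : u ∈ Set.Ioo (0 : ℝ) 1
  · exact hδ.le.trans (le_quantile hμδ hu)
  · rw [quantile, Set.indicator_of_notMem hu]

lemma measurable_quantile (hμδ : μ (Set.Ici δ) = 1) : Measurable (quantile μ) := by
  refine measurable_of_restrict_of_restrict_compl (s := Set.Ioo (0 : ℝ) 1) measurableSet_Ioo ?_ ?_
  · refine Monotone.measurable ?_
    rintro ⟨u, hu⟩ ⟨v, hv⟩ huv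
    simp only [Set.domRestrict_apply, quantile, Set.indicator_of_mem hu, Set.indicator_of_mem hv]
    exact csInf_le_csInf ⟨δ, fun y hy => le_of_mem_quantile_set hμδ hu.1 hy⟩
      (nonempty_quantile_set μ hv.2) fun y hy => (ENNReal.ofReal_le_ofReal huv).trans hy
  · convert! measurable_const (a := (0 : ℝ)) using 1
    ext ⟨u, hu⟩
    simp [quantile, Set.indicator_of_notMem hu]

lemma integrable_quantile (hδ : 0 < δ) (hμδ : μ (Set.Ici δ) = 1)
    (hmean : Integrable (fun x : ℝ => x) μ) : Integrable (quantile μ) := by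
  have hm := measurable_quantile hμδ
  refine ⟨hm.aestronglyMeasurable, ?_⟩
  rw [hasFiniteIntegral_iff_ofReal (Eventually.of_forall (quantile_nonneg hδ hμδ)),
    lintegral_eq_lintegral_meas_lt _ (Eventually.of_forall (quantile_nonneg hδ hμδ)) hm.aemeasurable]
  have hpos : 0 ≤ᵐ[μ] fun x : ℝ => x := by
    have h0 : μ (Set.Ici δ)ᶜ = 0 := (prob_compl_eq_zero_iff measurableSet_Ici).2 hμδ
    filter_upwards [measure_eq_zero_iff_ae_notMem.1 h0] with x hx
    simp only [Set.mem_compl_iff, Set.mem_Ici, not_not] at hx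
    exact hδ.le.trans hx
  have hfin := hmean.2
  rw [hasFiniteIntegral_iff_ofReal hpos,
    lintegral_eq_lintegral_meas_lt _ hpos hmean.aemeasurable] at hfin
  refine (setLIntegral_mono' measurableSet_Ioi fun t ht => ?_).trans_lt hfin
  have hsub : {u | t < quantile μ u} ⊆ Set.Ioc (μ.real (Set.Iic t)) 1 := by
    intro u hu
    rw [Set.mem_ofPred_eq] at hu
    have hu1 : u ∈ Set.Ioo (0 : ℝ) 1 := by
      by_contra h
      rw [quantile, Set.indicator_of_notMem h] at hu
      exact absurd hu (not_lt.2 (le_of_lt ht))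
    refine ⟨?_, hu1.2.le⟩
    by_contra! h
    rw [quantile, Set.indicator_of_mem hu1] at hu
    refine absurd hu (not_lt.2 (csInf_le ⟨δ, fun y hy => le_of_mem_quantile_set hμδ hu1.1 hy⟩ ?_))
    rw [Set.mem_ofPred_eq]
    exact ENNReal.ofReal_le_of_le_toReal h
  refine (measure_mono hsub).trans ?_
  rw [Real.volume_Ioc, ← probReal_univ (μ := μ), ← measureReal_compl measurableSet_Iic,
    Set.compl_Iic, ofReal_measureReal]
  rfl

/-- The symmetric rearrangement on `(-π, π)` of a quantile function is integrable. -/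
lemma integrable_quantile_abs_div (hδ : 0 < δ) (hμδ : μ (Set.Ici δ) = 1)
    (hmean : Integrable (fun x : ℝ => x) μ) : Integrable fun x : ℝ => quantile μ (|x| / π) := by
  have h1 : Integrable fun x : ℝ => quantile μ (x / π) :=
    (integrable_quantile hδ hμδ hmean).comp_div pi_ne_zero
  have hneg : ∀ x : ℝ, x ≤ 0 → quantile μ (x / π) = 0 := by
    intro x hx
    rw [quantile, Set.indicator_of_notMem]
    intro h
    exact absurd h.1 (not_lt.2 (div_nonpos_of_nonpos_of_nonneg hx pi_pos.le))
  refine (h1.add h1.comp_neg).congr (Eventually.of_forall fun x => ?_)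
  simp only [Pi.add_apply]
  rcases le_total 0 x with hx | hx
  · rw [abs_of_nonneg hx, hneg (-x) (by linarith), add_zero]
  · rw [abs_of_nonpos hx, hneg x hx, zero_add]

end Quantile

section CircleDensity

open Topology AddCircle ComplexConjugate

instance fact_two_pi_pos : Fact (0 < 2 * π) := ⟨two_pi_pos⟩

/-- A nonnegative even integrable function on `(-π, π)` viewed as a density on the circle. -/
lemma exists_circle_density {r : ℝ → ℝ} (hrm : Measurable r) (hri : Integrable r)
    (hr0 : ∀ x, 0 ≤ r x) (heven : ∀ x, r (-x) = r x) {c : ℝ}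
    (hrc : ∀ x, 0 < |x| → |x| < π → c ≤ r x) :
    ∃ (R : AddCircle (2 * π) → ℝ) (ρ : ℤ → ℝ), Integrable R haarAddCircle ∧ (∀ x, 0 ≤ R x) ∧
      (∀ᵐ x ∂haarAddCircle, 2 * π * c ≤ R x) ∧
      (∀ k, ∫ x, (R x : ℂ) * fourier k x ∂haarAddCircle = ρ k) ∧
      ∀ k : ℤ, ∫ x in (-π)..π, Complex.exp (Complex.I * ((k : ℂ) * (x : ℂ))) * (r x : ℂ) = ρ k := by
  set R : AddCircle (2 * π) → ℝ := liftIoc (2 * π) (-π) fun x => 2 * π * r x with hRdef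
  have hR : ∀ x ∈ Set.Ioc (-π) (-π + 2 * π), R (x : AddCircle (2 * π)) = 2 * π * r x :=
    fun x hx => liftIoc_coe_apply hx
  have hRm : Measurable R :=
    ((hrm.const_mul (2 * π)).comp measurable_subtype_coe).comp
      (measurableEquivIoc (2 * π) (-π)).measurable
  have hmk := AddCircle.measurePreserving_mk (2 * π) (-π)
  have hvol : (volume : Measure (AddCircle (2 * π))) = ENNReal.ofReal (2 * π) • haarAddCircle :=
    volume_eq_smul_haarAddCircle
  have hT0 : ENNReal.ofReal (2 * π) ≠ 0 := by simp [pi_pos]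
  have hIoc : Set.Ioc (-π) (-π + 2 * π) = Set.Ioc (-π) π := by congr 1; ring
  have hint : ∀ k : ℤ, ∫ x, (R x : ℂ) * fourier k x ∂haarAddCircle
      = ∫ x in (-π)..π, Complex.exp (Complex.I * ((k : ℂ) * (x : ℂ))) * (r x : ℂ) := by
    intro k
    rw [integral_haarAddCircle, ← AddCircle.intervalIntegral_preimage (2 * π) (-π),
      show -π + 2 * π = π by ring, ← intervalIntegral.integral_smul]
    refine intervalIntegral.integral_congr_ae (Eventually.of_forall fun x hx => ?_)
    rw [Set.uIoc_of_le (by linarith [pi_pos])] at hx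
    rw [hR x (hIoc ▸ hx), fourier_coe_apply, Complex.real_smul]
    have hpi : (π : ℂ) ≠ 0 := Complex.ofReal_ne_zero.2 pi_ne_zero
    have : 2 * (π : ℂ) * Complex.I * k * x / ((2 * π : ℝ) : ℂ) = Complex.I * (k * x) := by
      push_cast
      field_simp
    rw [this]
    push_cast
    field_simp
  have hreal : ∀ k : ℤ, ∃ ρ : ℝ, ∫ x in (-π)..π,
      Complex.exp (Complex.I * ((k : ℂ) * (x : ℂ))) * (r x : ℂ) = ρ := by
    intro k
    refine ⟨_, (Complex.conj_eq_iff_re.1 ?_).symm⟩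
    rw [intervalIntegral.integral_of_le (by linarith [pi_pos]), ← integral_conj,
      ← intervalIntegral.integral_of_le (by linarith [pi_pos])]
    have h := intervalIntegral.integral_comp_neg (a := -π) (b := π)
      (fun x : ℝ => Complex.exp (Complex.I * ((k : ℂ) * (x : ℂ))) * (r x : ℂ))
    rw [neg_neg] at h
    rw [← intervalIntegral.integral_of_le (by linarith [pi_pos]), ← h]
    congr 1
    ext x
    rw [heven, map_mul, Complex.conj_ofReal, ← Complex.exp_conj]
    congr 2
    simp
  choose ρ hρ using hreal
  refine ⟨R, ρ, ?_, fun x => ?_, ?_, fun k => (hint k).trans (hρ k), hρ⟩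
  · have h1 : Integrable R volume := by
      rw [← hmk.integrable_comp hRm.aestronglyMeasurable]
      refine (hri.const_mul (2 * π)).integrableOn.congr_fun
        (fun x hx => (hR x hx).symm) measurableSet_Ioc
    rwa [hvol, integrable_smul_measure hT0 ENNReal.ofReal_ne_top] at h1
  · exact mul_nonneg two_pi_pos.le (hr0 _)
  · have h1 : ∀ᵐ x ∂(volume : Measure (AddCircle (2 * π))), 2 * π * c ≤ R x := by
      rw [← hmk.map_eq, ae_map_iff hmk.aemeasurable (measurableSet_le measurable_const hRm),
        ae_restrict_iff' measurableSet_Ioc]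
      filter_upwards [Measure.ae_ne volume 0, Measure.ae_ne volume π] with x h0 hπ hx
      rw [hR x hx]
      rw [hIoc] at hx
      refine mul_le_mul_of_nonneg_left (hrc x (abs_pos.2 h0) ?_) two_pi_pos.le
      exact abs_lt.2 ⟨hx.1, lt_of_le_of_ne hx.2 hπ⟩
    rwa [hvol, Measure.ae_ennreal_smul_measure_eq hT0] at h1

end CircleDensity

section GaussianTransfer

open ProbabilityTheory

lemma map_gaussianPi_sum_mul {κ : Type*} [Fintype κ] (a : κ → ℝ) :
    (gaussianPi κ).map (fun w => ∑ q, a q * w q) = gaussianReal 0 (∑ q, a q ^ 2).toNNReal := by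
  refine Measure.ext_of_charFun ?_
  ext t
  have hm : Measurable fun w : κ → ℝ => ∑ q, a q * w q :=
    Finset.measurable_fun_sum _ fun q _ => (measurable_pi_apply q).const_mul _
  rw [charFun_apply_real, integral_map hm.aemeasurable (by fun_prop), charFun_gaussianReal]
  have h : ∀ w : κ → ℝ, Complex.exp (t * ((∑ q, a q * w q : ℝ) : ℂ) * Complex.I) =
      ∏ q, Complex.exp ((t * a q : ℝ) * (w q : ℂ) * Complex.I) := by
    intro w
    rw [← Complex.exp_sum]
    push_cast
    rw [Finset.mul_sum, Finset.sum_mul]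
    congr 1
    exact Finset.sum_congr rfl fun _ _ => by ring
  simp_rw [h]
  rw [gaussianPi, integral_fintype_prod_eq_prod
    (f := fun q (x : ℝ) => Complex.exp ((t * a q : ℝ) * (x : ℂ) * Complex.I))]
  simp_rw [← charFun_apply_real, charFun_gaussianReal]
  rw [← Complex.exp_sum]
  congr 1
  have h0 : 0 ≤ ∑ q, a q ^ 2 := Finset.sum_nonneg fun _ _ => sq_nonneg _
  rw [Real.coe_toNNReal _ h0]
  push_cast
  simp only [Finset.sum_div, Finset.sum_mul, mul_zero, zero_mul, zero_sub]
  rw [← Finset.sum_neg_distrib]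
  exact Finset.sum_congr rfl fun _ _ => by ring

variable {Ω : Type*} [MeasurableSpace Ω] {P : Measure Ω}

lemma memLp_two_of_map_eq_gaussianReal {X : Ω → ℝ} (hX : Measurable X) {v : NNReal}
    (h : P.map X = gaussianReal 0 v) : MemLp X 2 P := by
  have h2 := memLp_id_gaussianReal (μ := 0) (v := v) 2
  rw [← h] at h2
  exact (memLp_map_measure_iff h2.aestronglyMeasurable hX.aemeasurable).1 h2

lemma integral_sq_of_map_eq_gaussianReal {X : Ω → ℝ} (hX : Measurable X) {v : NNReal}
    (h : P.map X = gaussianReal 0 v) : ∫ ω, X ω ^ 2 ∂P = v := by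
  rw [← variance_id_gaussianReal (μ := 0) (v := v),
    variance_of_integral_eq_zero (by fun_prop) (by simp), ← h,
    integral_map hX.aemeasurable (by fun_prop)]
  rfl

variable {ι κ : Type*} [Fintype ι] [Fintype κ]

/-- A centered Gaussian vector with covariance matrix `B * Bᵀ` has the law of the image under `B`
of a standard Gaussian vector. -/
theorem map_eq_map_gaussianPi [IsProbabilityMeasure P] {X : Ω → ι → ℝ}
    (hX : ∀ i, Measurable fun ω => X ω i)
    (hG : ∀ c : ι → ℝ, ∃ v, P.map (fun ω => ∑ i, c i * X ω i) = gaussianReal 0 v)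
    (B : Matrix ι κ ℝ) (hB : ∀ i j, ∫ ω, X ω i * X ω j ∂P = (B * Bᵀ) i j) :
    P.map X = (gaussianPi κ).map (fun w => B *ᵥ w) := by
  classical
  have hXm : Measurable X := measurable_pi_iff.2 hX
  have hBm : Measurable fun w : κ → ℝ => B *ᵥ w :=
    (Continuous.matrix_mulVec continuous_const continuous_id).measurable
  have := Measure.isProbabilityMeasure_map (μ := P) hXm.aemeasurable
  have := Measure.isProbabilityMeasure_map (μ := gaussianPi κ) hBm.aemeasurable
  have hX2 : ∀ i, MemLp (fun ω => X ω i) 2 P := by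
    intro i
    obtain ⟨v, hv⟩ := hG (Pi.single i 1)
    refine memLp_two_of_map_eq_gaussianReal (hX i) (v := v) ?_
    rw [← hv]
    congr 1
    ext ω
    simp [Pi.single_apply]
  refine Measure.ext_of_charFunDual ?_
  ext L
  rw [charFunDual_eq_charFun_map_one, charFunDual_eq_charFun_map_one,
    Measure.map_map (by fun_prop) hXm, Measure.map_map (by fun_prop) hBm]
  congr 1
  set c : ι → ℝ := fun i => L (Pi.single i 1) with hc
  have hL : ∀ x : ι → ℝ, L x = ∑ i, c i * x i := by
    intro x
    conv_lhs => rw [← Finset.univ_sum_single x]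
    rw [map_sum]
    refine Finset.sum_congr rfl fun i _ => ?_
    rw [hc, show Pi.single i (x i) = x i • (Pi.single i (1 : ℝ) : ι → ℝ) by
      rw [← Pi.single_smul]; simp, map_smul, smul_eq_mul, mul_comm]
  have h1 : L ∘ X = fun ω => ∑ i, c i * X ω i := funext fun ω => hL _
  have h2 : (L ∘ fun w : κ → ℝ => B *ᵥ w) = fun w => ∑ q, (c ᵥ* B) q * w q := by
    ext w
    rw [Function.comp_apply, hL]
    exact Matrix.dotProduct_mulVec c B w
  obtain ⟨v, hv⟩ := hG c
  have hv2 := integral_sq_of_map_eq_gaussianReal (by fun_prop) hv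
  rw [h1, h2, map_gaussianPi_sum_mul, hv]
  congr 1
  rw [← NNReal.coe_inj, ← hv2, Real.coe_toNNReal _ (Finset.sum_nonneg fun _ _ => sq_nonneg _)]
  have h3 : ∀ ω, (∑ i, c i * X ω i) ^ 2 = ∑ i, ∑ j, c i * c j * (X ω i * X ω j) := by
    intro ω
    rw [sq, Finset.sum_mul_sum]
    exact Finset.sum_congr rfl fun _ _ => Finset.sum_congr rfl fun _ _ => by ring
  simp_rw [h3]
  have h4 : ∀ i j, Integrable (fun ω => c i * c j * (X ω i * X ω j)) P := fun i j =>
    ((hX2 i).integrable_mul (hX2 j)).const_mul _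
  rw [integral_finsetSum _ fun i _ => integrable_finsetSum _ fun j _ => h4 i j]
  simp_rw [integral_finsetSum _ fun j _ => h4 _ j, integral_const_mul, hB]
  have h5 : ∑ q, (c ᵥ* B) q ^ 2 = c ⬝ᵥ ((B * Bᵀ) *ᵥ c) := by
    rw [← Matrix.mulVec_mulVec, Matrix.dotProduct_mulVec, Matrix.mulVec_transpose]
    simp [dotProduct, sq]
  rw [h5]
  simp only [dotProduct, Matrix.mulVec, Finset.mul_sum]
  exact Finset.sum_congr rfl fun _ _ => Finset.sum_congr rfl fun _ _ => by ring

end GaussianTransfer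

section SeparableCovariance

open ProbabilityTheory
open scoped Kronecker

lemma toeplitz_apply (ρ : ℤ → ℝ) {N : ℕ} (i j : Fin N) : toeplitz ρ N i j = ρ ((i : ℤ) - j) := rfl

lemma isSymm_toeplitz {ρ : ℤ → ℝ} (hρ : ∀ k, ρ (-k) = ρ k) (N : ℕ) : (toeplitz ρ N).IsSymm := by
  ext i j
  rw [Matrix.transpose_apply, toeplitz_apply, toeplitz_apply, ← hρ, neg_sub]

lemma profiledMatrix_one_kronecker_mulVec {N : ℕ} (O : Matrix (Fin N) (Fin N) ℝ) (s : Fin N → ℝ)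
    (w : Fin N × Fin N → ℝ) :
    profiledMatrix 1 (((O * Matrix.diagonal s) ⊗ₖ (O * Matrix.diagonal s)) *ᵥ w) =
      O * profiledMatrix s w * Oᵀ := by
  ext i j
  have h : ∀ i j, (((O * Matrix.diagonal s) ⊗ₖ (O * Matrix.diagonal s)) *ᵥ w) (i, j) =
      ∑ p, ∑ q, O i p * s p * (O j q * s q) * w (p, q) := by
    intro i j
    simp only [Matrix.mulVec, dotProduct, Fintype.sum_prod_type, Matrix.kronecker_apply,
      Matrix.mul_diagonal]
  have h' : (O * profiledMatrix s w * Oᵀ) i j =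
      ∑ q, ∑ p, O i p * (s p * s q * (w (p, q) + w (q, p)) / √N) * O j q := by
    simp only [Matrix.mul_apply, Finset.sum_mul, Matrix.transpose_apply, profiledMatrix_apply]
  rw [profiledMatrix_apply, h, h, h', Finset.sum_comm
    (f := fun q p => O i p * (s p * s q * (w (p, q) + w (q, p)) / √N) * O j q),
    Finset.sum_comm (f := fun p q => O j p * s p * (O i q * s q) * w (p, q))]
  simp only [Pi.one_apply, one_mul]
  rw [← Finset.sum_add_distrib, Finset.sum_div]
  refine Finset.sum_congr rfl fun p _ => ?_
  rw [← Finset.sum_add_distrib, Finset.sum_div]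
  exact Finset.sum_congr rfl fun q _ => by ring

variable {Ω : Type*} [MeasurableSpace Ω] {P : Measure Ω}

/-- A Gaussian matrix with separable Toeplitz covariance, after symmetrization, is orthogonally
conjugate in law to a matrix with a rank one variance profile. -/
lemma integral_norm_weightedTrace_comp [IsProbabilityMeasure P] {N : ℕ} {X : Ω → Fin N × Fin N → ℝ}
    (hX : ∀ p, Measurable fun ω => X ω p)
    (hG : ∀ c : Fin N × Fin N → ℝ, ∃ v, P.map (fun ω => ∑ p, c p * X ω p) = gaussianReal 0 v)
    {ρ : ℤ → ℝ}
    (hcov : ∀ p q, ∫ ω, X ω p * X ω q ∂P = toeplitz ρ N p.1 q.1 * toeplitz ρ N p.2 q.2)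
    {O : Matrix (Fin N) (Fin N) ℝ} {d : Fin N → ℝ} (hO : O * Oᵀ = 1)
    (hd : toeplitz ρ N = O * Matrix.diagonal d * Oᵀ) (hd0 : ∀ i, 0 ≤ d i)
    {z : ℂ} (hz : 0 < z.im) (m : ℂ) :
    ∫ ω, ‖weightedTrace 1 1 z (X ω) - m‖ ∂P =
      ∫ w, ‖weightedTrace 1 (fun i => √(d i)) z w - m‖ ∂(gaussianPi (Fin N × Fin N)) := by
  set A := O * Matrix.diagonal fun i => √(d i) with hA
  have hAA : A * Aᵀ = toeplitz ρ N := by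
    rw [hd, hA, Matrix.transpose_mul, Matrix.diagonal_transpose, ← Matrix.mul_assoc,
      Matrix.mul_assoc O, Matrix.diagonal_mul_diagonal]
    simp_rw [Real.mul_self_sqrt (hd0 _)]
  have hlaw := map_eq_map_gaussianPi hX hG (A ⊗ₖ A) fun p q => by
    rw [hcov, ← Matrix.kroneckerMap_transpose, ← Matrix.mul_kronecker_mul, hAA]
    rfl
  have hc : Continuous fun x => ‖weightedTrace 1 (1 : Fin N → ℝ) z x - m‖ := by
    have := continuous_weightedTrace hz 1 (1 : Fin N → ℝ)
    fun_prop
  have hXm : Measurable X := measurable_pi_iff.2 hX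
  have hBm : Measurable fun w : Fin N × Fin N → ℝ => (A ⊗ₖ A) *ᵥ w :=
    (Continuous.matrix_mulVec continuous_const continuous_id).measurable
  rw [← integral_map (f := fun x => ‖weightedTrace 1 (1 : Fin N → ℝ) z x - m‖) hXm.aemeasurable
    hc.aestronglyMeasurable, hlaw, integral_map hBm.aemeasurable hc.aestronglyMeasurable]
  simp only [weightedTrace_one_eq, hA, profiledMatrix_one_kronecker_mulVec,
    trace_realResolvent_conj hO]

lemma integral_sq_ESD_profiledMatrix_le {N : ℕ} (hN : N ≠ 0) {X : Ω → Fin N × Fin N → ℝ}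
    (hX : ∀ p, MemLp (fun ω => X ω p) 2 P) {c : ℝ} (hc : ∀ p, ∫ ω, X ω p * X ω p ∂P ≤ c) :
    Integrable (fun ω => ∫ x, x ^ 2 ∂ESD (profiledMatrix 1 (X ω))) P ∧
      ∫ ω, ∫ x, x ^ 2 ∂ESD (profiledMatrix 1 (X ω)) ∂P ≤ 4 * c := by
  have hN' : (0 : ℝ) < N := by positivity
  simp only [integral_sq_ESD (isSymm_profiledMatrix _ _), profiledMatrix_apply, Pi.one_apply,
    one_mul, div_pow, Real.sq_sqrt hN'.le]
  have hi : ∀ p, Integrable (fun ω => X ω p * X ω p) P := fun p => (hX p).integrable_mul (hX p)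
  have hi2 : ∀ i j, Integrable (fun ω => (X ω (i, j) + X ω (j, i)) ^ 2 / (N : ℝ)) P := fun i j =>
    ((hX (i, j)).add (hX (j, i))).integrable_sq.div_const _
  have hle : ∀ i j, ∫ ω, (X ω (i, j) + X ω (j, i)) ^ 2 / (N : ℝ) ∂P ≤ 4 * c / N := by
    intro i j
    rw [integral_div]
    gcongr
    calc ∫ ω, (X ω (i, j) + X ω (j, i)) ^ 2 ∂P
        ≤ ∫ ω, (2 * (X ω (i, j) * X ω (i, j)) + 2 * (X ω (j, i) * X ω (j, i))) ∂P := by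
          refine integral_mono ((hX (i, j)).add (hX (j, i))).integrable_sq
            (((hi _).const_mul 2).add ((hi _).const_mul 2)) fun ω => ?_
          dsimp only
          nlinarith [sq_nonneg (X ω (i, j) - X ω (j, i))]
      _ ≤ 4 * c := by
          rw [integral_add ((hi _).const_mul 2) ((hi _).const_mul 2), integral_const_mul,
            integral_const_mul]
          linarith [hc (i, j), hc (j, i)]
  have hi3 : ∀ i, Integrable (fun ω => ∑ j, (X ω (i, j) + X ω (j, i)) ^ 2 / (N : ℝ)) P :=
    fun i => integrable_finsetSum _ fun j _ => hi2 i j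
  refine ⟨(integrable_finsetSum _ fun i _ => hi3 i).const_mul _, ?_⟩
  rw [integral_const_mul, integral_finsetSum _ fun i _ => hi3 i]
  simp_rw [integral_finsetSum _ fun j _ => hi2 _ j]
  calc _ ≤ (N : ℝ)⁻¹ * ∑ _i : Fin N, ∑ _j : Fin N, 4 * c / N := by
        gcongr with i _ j _
        exact hle i j
    _ = 4 * c := by
        simp only [Finset.sum_const, Finset.card_univ, Fintype.card_fin, nsmul_eq_mul]
        field_simp

variable {T : ℝ} [Fact (0 < T)]

lemma symm_of_integral_mul_fourier {R : AddCircle T → ℝ} {ρ : ℤ → ℝ}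
    (hρ : ∀ k, ∫ x, (R x : ℂ) * fourier k x ∂AddCircle.haarAddCircle = ρ k) (k : ℤ) :
    ρ (-k) = ρ k := by
  have h : ∀ x : AddCircle T, (R x : ℂ) * fourier (-k) x = (starRingEnd ℂ) (R x * fourier k x) := by
    intro x
    rw [map_mul, Complex.conj_ofReal, fourier_neg]
  have h2 := hρ (-k)
  simp_rw [h] at h2
  rw [integral_conj, hρ, Complex.conj_ofReal] at h2
  exact_mod_cast h2.symm

end SeparableCovariance

section SpectralLimit

open ProbabilityTheory AddCircle Topology

variable {Ω : Type*} [MeasurableSpace Ω] {P : Measure Ω}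

lemma memLp_two_apply_of_gaussian {ι : Type*} [Fintype ι] {X : Ω → ι → ℝ}
    (hX : ∀ i, Measurable fun ω => X ω i)
    (hG : ∀ c : ι → ℝ, ∃ v, P.map (fun ω => ∑ i, c i * X ω i) = gaussianReal 0 v) (i : ι) :
    MemLp (fun ω => X ω i) 2 P := by
  classical
  obtain ⟨v, hv⟩ := hG (Pi.single i 1)
  refine memLp_two_of_map_eq_gaussianReal (hX i) (v := v) ?_
  rw [← hv]
  congr 1
  ext ω
  simp [Pi.single_apply]

lemma measure_le_ofReal_of_integral_le [IsFiniteMeasure P] {f : Ω → ℝ} (hf : Integrable f P)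
    (hf0 : ∀ ω, 0 ≤ f ω) {C : ℝ} (hC : ∫ ω, f ω ∂P ≤ C) {K : ℝ} (hK : 0 < K) :
    P {ω | K ≤ f ω} ≤ ENNReal.ofReal (C / K) := by
  have h := mul_meas_ge_le_integral_of_nonneg (Eventually.of_forall hf0) hf K
  rw [← ofReal_measureReal]
  refine ENNReal.ofReal_le_ofReal ?_
  rw [le_div_iff₀ hK, mul_comm]
  exact h.trans hC

lemma tendstoInMeasure_of_tendsto_integral_norm [IsFiniteMeasure P] {f : ℕ → Ω → ℂ} {m : ℂ}
    (hf : ∀ N : ℕ, N ≠ 0 → Integrable (fun ω => ‖f N ω - m‖) P)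
    (h : Tendsto (fun N => ∫ ω, ‖f N ω - m‖ ∂P) atTop (𝓝 0)) :
    TendstoInMeasure P f atTop fun _ => m := by
  rw [tendstoInMeasure_iff_norm]
  intro ε hε
  have h2 : Tendsto (fun N => ENNReal.ofReal ((∫ ω, ‖f N ω - m‖ ∂P) / ε)) atTop (𝓝 0) := by
    have := ENNReal.tendsto_ofReal (h.div_const ε)
    simpa using this
  refine tendsto_of_tendsto_of_tendsto_of_le_of_le' tendsto_const_nhds h2
    (Eventually.of_forall fun _ => zero_le) ((eventually_ne_atTop 0).mono fun N hN => ?_)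
  exact measure_le_ofReal_of_integral_le (hf N hN) (fun _ => norm_nonneg _) le_rfl hε

variable [IsProbabilityMeasure P] {T : ℝ} [Fact (0 < T)]

/-- The empirical spectral distributions of symmetrized Gaussian matrices with separable Toeplitz
covariance converge weakly in probability to an absolutely continuous measure, as soon as the
symbol is bounded below. -/
theorem exists_tendstoInMeasure_ESD_profiledMatrix_one {X : ∀ N : ℕ, Ω → Fin N × Fin N → ℝ}
    (hX : ∀ N p, Measurable fun ω => X N ω p)
    (hG : ∀ (N : ℕ) (c : Fin N × Fin N → ℝ),
      ∃ v, P.map (fun ω => ∑ p, c p * X N ω p) = gaussianReal 0 v)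
    {R : AddCircle T → ℝ} {ρ : ℤ → ℝ}
    (hcov : ∀ N p q, ∫ ω, X N ω p * X N ω q ∂P = toeplitz ρ N p.1 q.1 * toeplitz ρ N p.2 q.2)
    (hR : Integrable R haarAddCircle) (hR0 : ∀ x, 0 ≤ R x) {δ : ℝ} (hδ : 0 < δ)
    (hRδ : ∀ᵐ x ∂haarAddCircle, δ ≤ R x)
    (hρ : ∀ k, ∫ x, (R x : ℂ) * fourier k x ∂haarAddCircle = ρ k) :
    ∃ ν : Measure ℝ, IsProbabilityMeasure ν ∧ ν ≪ volume ∧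
      ∀ φ : BoundedContinuousFunction ℝ ℝ, TendstoInMeasure P
        (fun N ω => ∫ x, φ x ∂ESD (profiledMatrix 1 (X N ω))) atTop fun _ => ∫ x, φ x ∂ν := by
  choose O d hO hd _ using fun N : ℕ =>
    exists_orthogonal_diagonalization (isSymm_toeplitz (symm_of_integral_mul_fourier hρ) N)
  have hd0 : ∀ N i, 0 ≤ d N i := fun N i =>
    (isBalancedPartition_spectralWeight hR hρ (Fin.pos i).ne' (hO N) (hd N)).nonneg_of_ae_nonneg
      (Eventually.of_forall hR0) i
  choose m hmC hm using fun (z : ℂ) (hz : 0 < z.im) =>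
    exists_tendsto_weightedTrace_toeplitz hR hR0 hδ hRδ hρ hO hd hz
  have hL2 : ∀ N : ℕ, N ≠ 0 → _ := fun N hN =>
    integral_sq_ESD_profiledMatrix_le hN (memLp_two_apply_of_gaussian (hX N) (hG N))
      (c := ρ 0 * ρ 0) fun p => by rw [hcov]; simp [toeplitz_apply]
  have hsymm := fun N ω => isSymm_profiledMatrix 1 (X N ω)
  have hprob : ∀ N : ℕ, N ≠ 0 → ∀ ω, IsProbabilityMeasure (ESD (profiledMatrix 1 (X N ω))) :=
    fun N hN ω => isProbabilityMeasure_ESD hN (hsymm N ω)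
  refine exists_absolutelyContinuous_tendstoInMeasure P hprob
    (C₂ := 4 * (ρ 0 * ρ 0)) (m := fun z => if hz : 0 < z.im then m z hz else 0)
    (C := (1 + 1 / (2 * (δ / (1 + δ)) ^ 2)) / 2) ?_ ?_ ?_ ?_
  · exact fun N hN ω => integrable_ESD hN (hsymm N ω)
      (continuous_pow 2).stronglyMeasurable
  · intro N hN K hK
    exact measure_le_ofReal_of_integral_le (hL2 N hN).1
      (fun ω => integral_nonneg fun x => sq_nonneg x) (hL2 N hN).2 hK
  · intro z hz
    rw [dif_pos hz]
    exact hmC z hz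
  · intro z hz
    simp only [dif_pos hz, integral_cauchyKernel_ESD (hsymm _ _) hz.ne', ← weightedTrace_one_eq]
    refine tendstoInMeasure_of_tendsto_integral_norm (fun N hN => ?_) ?_
    · have hc := continuous_weightedTrace hz 1 (1 : Fin N → ℝ)
      have hXm : Measurable (X N) := measurable_pi_iff.2 (hX N)
      refine integrable_of_measurable_of_norm_le P (B := 1 / z.im + ‖m z hz‖)
        ((hc.measurable.comp hXm).sub_const _).norm fun ω => ?_
      rw [norm_norm]
      exact (norm_sub_le _ _).trans
        (add_le_add_left (norm_weightedTrace_le hz hN (by simp) _ _) _)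
    · simp only [integral_norm_weightedTrace_comp (hX _) (hG _) (hcov _) (hO _) (hd _) (hd0 _) hz]
      exact hm z hz

end SpectralLimit

section SeparableSpectralDensity

variable {r : ℝ → ℝ} {ρ : ℤ → ℝ}

lemma integral_exp_mul_separable
    (hr : ∀ k : ℤ, ∫ x in (-π)..π, Complex.exp (Complex.I * ((k : ℂ) * (x : ℂ))) * (r x : ℂ) = ρ k)
    (u v : ℤ) :
    ∫ x in (-π)..π, ∫ y in (-π)..π,
      Complex.exp (Complex.I * ((u : ℂ) * (x : ℂ) + (v : ℂ) * (y : ℂ))) * ((r x * r y : ℝ) : ℂ)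
        = ((ρ u * ρ v : ℝ) : ℂ) := by
  have h : ∀ x y : ℝ,
      Complex.exp (Complex.I * ((u : ℂ) * (x : ℂ) + (v : ℂ) * (y : ℂ))) * ((r x * r y : ℝ) : ℂ) =
        Complex.exp (Complex.I * ((u : ℂ) * (x : ℂ))) * (r x : ℂ) *
          (Complex.exp (Complex.I * ((v : ℂ) * (y : ℂ))) * (r y : ℂ)) := by
    intro x y
    rw [mul_add, Complex.exp_add]
    push_cast
    ring
  simp_rw [h, intervalIntegral.integral_const_mul, intervalIntegral.integral_mul_const, hr]
  push_cast
  rfl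

end SeparableSpectralDensity

/-- Let `δ > 0` and let `μ` be a probability measure on `ℝ` with
`μ([δ,∞)) = 1` and finite mean. With
`r(x) = (1/(2^{3/2}π)) · inf{y : |x|/π ≤ μ((-∞,y])}` for `0 < |x| < π` (and `0` otherwise)
and `f(x,y) = r(x)r(y)`, let `(G_{i,j} : i,j ∈ ℤ)` be a centered stationary Gaussian
process with spectral density `f`, and let `Ḡ_N(i,j) = (G_{i,j} + G_{j,i})/√N`,
`1 ≤ i,j ≤ N`. Then there is a probability measure `ν` which is absolutely continuous with
respect to Lebesgue measure such that `ESD(Ḡ_N) → ν` weakly in probability. -/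
theorem stmt_1
    {Ω : Type*} [MeasurableSpace Ω] (P : Measure Ω) [IsProbabilityMeasure P]
    (δ : ℝ) (hδ : 0 < δ)
    (μ : Measure ℝ) [IsProbabilityMeasure μ]
    (hμδ : μ (Set.Ici δ) = 1)
    (hmean : Integrable (fun x : ℝ => x) μ)
    (r : ℝ → ℝ)
    (hr : ∀ x : ℝ, r x =
      if 0 < |x| ∧ |x| < π then
        (2 ^ ((3 : ℝ) / 2) * π)⁻¹ *
          sInf {y : ℝ | ENNReal.ofReal (|x| / π) ≤ μ (Set.Iic y)}
      else 0)
    (f : ℝ → ℝ → ℝ)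
    (hf : ∀ x y : ℝ, f x y = r x * r y)
    (G : ℤ → ℤ → Ω → ℝ)
    (hGmeas : ∀ i j : ℤ, Measurable (G i j))
    (hGauss : ∀ (m : ℕ) (c : Fin m → ℝ) (idx : Fin m → ℤ × ℤ), ∃ v : NNReal,
      Measure.map (fun ω => ∑ p, c p * G (idx p).1 (idx p).2 ω) P =
        ProbabilityTheory.gaussianReal 0 v)
    (hcov : ∀ i j u v : ℤ,
      ((∫ ω, G i j ω * G (i + u) (j + v) ω ∂P : ℝ) : ℂ) =
        ∫ x in (-π)..π, ∫ y in (-π)..π,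
          Complex.exp (Complex.I * ((u : ℂ) * (x : ℂ) + (v : ℂ) * (y : ℂ)))
            * (f x y : ℂ)) :
    ∃ ν : Measure ℝ, IsProbabilityMeasure ν ∧ ν ≪ volume ∧
      ∀ φ : BoundedContinuousFunction ℝ ℝ,
        TendstoInMeasure P
          (fun N ω => ∫ x, φ x ∂(ESD (Matrix.of fun i j : Fin N =>
            (G (((i : ℕ) : ℤ) + 1) (((j : ℕ) : ℤ) + 1) ω
              + G (((j : ℕ) : ℤ) + 1) (((i : ℕ) : ℤ) + 1) ω) / Real.sqrt N)))
          atTop (fun _ => ∫ x, φ x ∂ν) := by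
  set a : ℝ := (2 ^ ((3 : ℝ) / 2) * π)⁻¹ with ha_def
  have ha : 0 < a := by positivity
  have hmem : ∀ x : ℝ, |x| / π ∈ Set.Ioo (0 : ℝ) 1 ↔ 0 < |x| ∧ |x| < π := fun x => by
    rw [Set.mem_Ioo, div_pos_iff_of_pos_right Real.pi_pos, div_lt_one Real.pi_pos]
  have hrq : r = fun x => a * quantile μ (|x| / π) := by
    ext x
    rw [hr, quantile, Set.indicator_apply, mul_ite, mul_zero]
    simp only [hmem]
  have hqm := measurable_quantile (μ := μ) hμδ
  obtain ⟨R, ρ, hR, hR0, hRδ, hρ, hρr⟩ := exists_circle_density (r := r) (c := a * δ)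
    (by rw [hrq]; exact (hqm.comp (by fun_prop)).const_mul a)
    (by rw [hrq]; exact (integrable_quantile_abs_div hδ hμδ hmean).const_mul a)
    (fun x => by rw [hrq]; exact mul_nonneg ha.le (quantile_nonneg hδ hμδ _))
    (fun x => by simp only [hrq, abs_neg])
    (fun x hx hx' => by
      rw [hrq]
      exact mul_le_mul_of_nonneg_left (le_quantile hμδ ((hmem x).2 ⟨hx, hx'⟩)) ha.le)
  have hsymm := symm_of_integral_mul_fourier hρ
  have hG2 : ∀ i j k l : ℤ, ∫ ω, G i j ω * G k l ω ∂P = ρ (i - k) * ρ (j - l) := by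
    intro i j k l
    have h := hcov i j (k - i) (l - j)
    simp only [hf] at h
    rw [integral_exp_mul_separable hρr, add_sub_cancel, add_sub_cancel, Complex.ofReal_inj] at h
    rw [h, ← hsymm, ← hsymm (l - j), neg_sub, neg_sub]
  obtain ⟨ν, h1, h2, h3⟩ := exists_tendstoInMeasure_ESD_profiledMatrix_one (P := P)
    (X := fun N ω p => G ((p.1 : ℤ) + 1) ((p.2 : ℤ) + 1) ω) (fun N p => hGmeas _ _)
    (fun N c => by
      let e := (Fintype.equivFin (Fin N × Fin N)).symm
      obtain ⟨v, hv⟩ := hGauss _ (fun k => c (e k))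
        fun k => (((e k).1 : ℤ) + 1, ((e k).2 : ℤ) + 1)
      refine ⟨v, ?_⟩
      rw [← hv]
      congr 1
      ext ω
      exact (Equiv.sum_comp e fun p => c p * G ((p.1 : ℤ) + 1) ((p.2 : ℤ) + 1) ω).symm)
    (fun N p q => by
      rw [hG2, toeplitz_apply, toeplitz_apply, add_sub_add_right_eq_sub,
        add_sub_add_right_eq_sub])
    hR hR0 (by positivity) hRδ hρ
  refine ⟨ν, h1, h2, fun φ => ?_⟩
  convert h3 φ using 6 with N ω
  ext i j
  simp [profiledMatrix_apply]
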